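/- arXiv:2504.00594 — 2 statements merged into one kernel-verified Lean document; each statement's English description precedes it below -/
import Mathlib

section
/- Let {S_n}_{n≥0} and {S'_n}_{n≥0} be two independent elephant random walks on ℤ with the same memory parameter p. (a) If 0 < p < 3/4, then almost surely limsup_{n→∞} ±(S_n − S'_n)/√(2 n log log n) = √2/√(3−4p) (for both choices of sign). (b) If p = 3/4, then almost surely limsup_{n→∞} ±(S_n − S'_n)/√(2 n log n log log log n) = √2 (for both choices of sign). -/
open MeasureTheory ProbabilityTheory Filter Asymptotics

noncomputable section

/-- The step sequence `X 0, X 1, X 2, …` (with `X i` the `(i+1)`-th step) of an elephant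
random walk on `ℤ` with memory parameter `p` and initial parameter `q`: the steps take
values in `{+1, -1}`, the first step is `+1` with probability `q` and `-1` with
probability `1 - q`, and the conditional law of each further step given the past is
`P(X_{n+1} = x | X_1,…,X_n) = (1/n) ∑_{i=1}^n (p·1{X_i = x} + (1-p)·1{X_i = -x})`,
expressed via the resulting finite-dimensional distributions. -/
def IsERW {Ω : Type*} [MeasurableSpace Ω] (P : Measure Ω) (p q : ℝ)
    (X : ℕ → Ω → ℤ) : Prop :=
  (∀ n, Measurable (X n)) ∧
  (∀ n ω, X n ω = 1 ∨ X n ω = -1) ∧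
  ∀ (n : ℕ) (ε : ℕ → ℤ), (∀ i, ε i = 1 ∨ ε i = -1) →
    (P {ω | ∀ i ≤ n, X i ω = ε i}).toReal =
      (if ε 0 = 1 then q else 1 - q) *
        ∏ m ∈ Finset.range n,
          ((1 : ℝ) / (m + 1) *
            ∑ i ∈ Finset.range (m + 1),
              (p * (if ε i = ε (m + 1) then 1 else 0) +
                (1 - p) * (if ε i = -ε (m + 1) then 1 else 0)))

/-- Bounded martingale differences with conditional variance one, where `ζ n` is known at time
`n + 1`; the conditional moments are stated against bounded test functions. -/
structure IsNormalizedDiff {Ω : Type*} {m : MeasurableSpace Ω} (P : Measure Ω)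
    (ℱ : Filtration ℕ m) (ζ : ℕ → Ω → ℝ) (C : ℝ) : Prop where
  measurable : ∀ n, StronglyMeasurable[ℱ (n + 1)] (ζ n)
  one_le : 1 ≤ C
  bound : ∀ n ω, |ζ n ω| ≤ C
  mean : ∀ n (Y : Ω → ℝ), StronglyMeasurable[ℱ n] Y → (∃ K, ∀ ω, |Y ω| ≤ K) →
    ∫ ω, Y ω * ζ n ω ∂P = 0
  var : ∀ n (Y : Ω → ℝ), StronglyMeasurable[ℱ n] Y → (∃ K, ∀ ω, |Y ω| ≤ K) →
    ∫ ω, Y ω * ζ n ω ^ 2 ∂P = ∫ ω, Y ω ∂P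

/-- The weighted partial sums `∑_{j < n} c j * ζ j`. -/
def weightedSum {Ω : Type*} (c : ℕ → ℝ) (ζ : ℕ → Ω → ℝ) (n : ℕ) (ω : Ω) : ℝ :=
  ∑ j ∈ Finset.range n, c j * ζ j ω

/-- The partial sums `∑_{j < n} c j ^ 2`, the variance of `weightedSum c ζ n`. -/
def sumSq (c : ℕ → ℝ) (n : ℕ) : ℝ := ∑ j ∈ Finset.range n, c j ^ 2

lemma weightedSum_succ {Ω : Type*} (c : ℕ → ℝ) (ζ : ℕ → Ω → ℝ) (n : ℕ) (ω : Ω) :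
    weightedSum c ζ (n + 1) ω = weightedSum c ζ n ω + c n * ζ n ω :=
  Finset.sum_range_succ _ _

lemma sumSq_succ (c : ℕ → ℝ) (n : ℕ) : sumSq c (n + 1) = sumSq c n + c n ^ 2 :=
  Finset.sum_range_succ _ _

lemma sumSq_zero (c : ℕ → ℝ) : sumSq c 0 = 0 := Finset.sum_range_zero _

lemma sumSq_mono (c : ℕ → ℝ) : Monotone (sumSq c) :=
  monotone_nat_of_le_succ fun n => by rw [sumSq_succ]; nlinarith [sq_nonneg (c n)]

lemma sumSq_nonneg (c : ℕ → ℝ) (n : ℕ) : 0 ≤ sumSq c n :=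
  Finset.sum_nonneg fun _ _ => sq_nonneg _

lemma abs_exp_sub_quadratic_le {y δ : ℝ} (hy : |y| ≤ δ) (hδ : δ ≤ 1) :
    |Real.exp y - (1 + y + y ^ 2 / 2)| ≤ δ * y ^ 2 / 2 := by
  have h := Real.exp_bound (hy.trans hδ) (n := 3) (by norm_num)
  have h1 : ∑ m ∈ Finset.range 3, y ^ m / (m.factorial : ℝ) = 1 + y + y ^ 2 / 2 := by
    simp [Finset.sum_range_succ, Nat.factorial]
  rw [h1] at h
  refine h.trans ?_
  have h2 : |y| ^ 3 = |y| * y ^ 2 := by rw [pow_succ, sq_abs]; ring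
  rw [h2]
  have h3 : |y| * y ^ 2 ≤ δ * y ^ 2 := mul_le_mul_of_nonneg_right hy (sq_nonneg y)
  have h4 : 0 ≤ |y| * y ^ 2 := by positivity
  norm_num [Nat.factorial]
  linarith

lemma exp_mul_le_one_add {u δ : ℝ} (hu : 0 ≤ u) (huδ : u ≤ δ) :
    Real.exp ((1 - δ) * u) ≤ 1 + u := by
  have h1 : (0 : ℝ) < 1 + u := by linarith
  rw [← Real.le_log_iff_exp_le h1]
  refine le_trans ?_ (Real.one_sub_inv_le_log_of_pos h1)
  have : 1 - (1 + u)⁻¹ = u / (1 + u) := by field_simp; ring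
  rw [this, le_div_iff₀ h1]
  nlinarith [mul_nonneg hu hu, mul_nonneg hu (sub_nonneg.2 huδ),
    mul_nonneg (mul_nonneg hu hu) (hu.trans huδ)]

namespace IsNormalizedDiff

variable {Ω : Type*} {m : MeasurableSpace Ω} {P : Measure Ω}
  {ℱ : Filtration ℕ m} {ζ : ℕ → Ω → ℝ} {C : ℝ}

lemma neg (h : IsNormalizedDiff P ℱ ζ C) : IsNormalizedDiff P ℱ (fun n ω => -ζ n ω) C where
  measurable n := (h.measurable n).neg
  one_le := h.one_le
  bound n ω := by simpa using h.bound n ω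
  mean n Y hY hb := by simpa [integral_neg] using h.mean n Y hY hb
  var n Y hY hb := by simpa using h.var n Y hY hb

lemma stronglyMeasurable_weightedSum (h : IsNormalizedDiff P ℱ ζ C) (c : ℕ → ℝ) (n : ℕ) :
    StronglyMeasurable[ℱ n] (weightedSum c ζ n) := by
  have : weightedSum c ζ n = fun ω => ∑ j ∈ Finset.range n, c j * ζ j ω := rfl
  rw [this]
  refine Finset.stronglyMeasurable_fun_sum _ fun j hj => ?_
  exact ((h.measurable j).mono (ℱ.mono (Finset.mem_range.1 hj))).const_mul _

lemma abs_weightedSum_le (h : IsNormalizedDiff P ℱ ζ C) (c : ℕ → ℝ) (n : ℕ) (ω : Ω) :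
    |weightedSum c ζ n ω| ≤ ∑ j ∈ Finset.range n, |c j| * C := by
  refine (Finset.abs_sum_le_sum_abs _ _).trans (Finset.sum_le_sum fun j _ => ?_)
  rw [abs_mul]
  exact mul_le_mul_of_nonneg_left (h.bound j ω) (abs_nonneg _)

lemma integrable_of_bound [IsFiniteMeasure P] {Y : Ω → ℝ} {n : ℕ} (hY : StronglyMeasurable[ℱ n] Y)
    {K : ℝ} (hK : ∀ ω, |Y ω| ≤ K) : Integrable Y P :=
  Integrable.of_bound (hY.mono (ℱ.le n)).aestronglyMeasurable K (ae_of_all _ hK)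

lemma exp_increment (h : IsNormalizedDiff P ℱ ζ C) (c : ℕ → ℝ) {k n : ℕ} (hkn : k ≤ n)
    {A : Set Ω} (hA : MeasurableSet[ℱ k] A) (t : ℝ) :
    StronglyMeasurable[ℱ n] (A.indicator fun ω =>
      Real.exp (t * (weightedSum c ζ n ω - weightedSum c ζ k ω))) ∧
    (∃ K, ∀ ω, |A.indicator (fun ω =>
      Real.exp (t * (weightedSum c ζ n ω - weightedSum c ζ k ω))) ω| ≤ K) ∧
    ∀ ω, 0 ≤ A.indicator (fun ω =>
      Real.exp (t * (weightedSum c ζ n ω - weightedSum c ζ k ω))) ω := by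
  refine ⟨?_, ?_, ?_⟩
  · refine StronglyMeasurable.indicator ?_ (ℱ.mono hkn A hA)
    exact Real.continuous_exp.comp_stronglyMeasurable
      (((h.stronglyMeasurable_weightedSum c n).sub
        ((h.stronglyMeasurable_weightedSum c k).mono (ℱ.mono hkn))).const_mul t)
  · refine ⟨Real.exp (|t| * (∑ j ∈ Finset.range n, |c j| * C + ∑ j ∈ Finset.range k, |c j| * C)),
      fun ω => ?_⟩
    by_cases hω : ω ∈ A
    · rw [Set.indicator_of_mem hω]
      rw [Real.abs_exp]
      refine Real.exp_le_exp.2 ((le_abs_self _).trans ?_)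
      rw [abs_mul]
      refine mul_le_mul_of_nonneg_left ((abs_sub _ _).trans ?_) (abs_nonneg _)
      exact add_le_add (h.abs_weightedSum_le c n ω) (h.abs_weightedSum_le c k ω)
    · simpa [Set.indicator_of_notMem hω] using Real.exp_nonneg _
  · exact fun ω => Set.indicator_nonneg (fun _ _ => Real.exp_nonneg _) ω

lemma integral_exp_increment_succ (c : ℕ → ℝ) {k n : ℕ}
    {A : Set Ω} (hA : MeasurableSet[ℱ k] A) (t : ℝ) :
    ∫ ω in A, Real.exp (t * (weightedSum c ζ (n + 1) ω - weightedSum c ζ k ω)) ∂P =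
    ∫ ω, A.indicator (fun ω => Real.exp (t * (weightedSum c ζ n ω - weightedSum c ζ k ω))) ω
      * Real.exp (t * c n * ζ n ω) ∂P := by
  rw [← integral_indicator (ℱ.le k A hA)]
  congr 1
  ext ω
  by_cases hω : ω ∈ A
  · simp only [Set.indicator_of_mem hω, weightedSum_succ, ← Real.exp_add]
    congr 1; ring
  · simp [Set.indicator_of_notMem hω]

variable [IsFiniteMeasure P]

lemma integrable_mul_pow (h : IsNormalizedDiff P ℱ ζ C) {n : ℕ} {Y : Ω → ℝ}
    (hY : StronglyMeasurable[ℱ n] Y) {K : ℝ} (hK : ∀ ω, |Y ω| ≤ K) (i : ℕ) :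
    Integrable (fun ω => Y ω * ζ n ω ^ i) P := by
  refine integrable_of_bound (n := n + 1) (K := K * C ^ i)
    ((hY.mono (ℱ.mono n.le_succ)).mul ((h.measurable n).pow i)) fun ω => ?_
  rw [abs_mul, abs_pow]
  exact mul_le_mul (hK ω) (pow_le_pow_left₀ (abs_nonneg _) (h.bound n ω) _) (by positivity)
    ((abs_nonneg _).trans (hK ω))

lemma integral_mul_quadratic (h : IsNormalizedDiff P ℱ ζ C) {n : ℕ} {Y : Ω → ℝ}
    (hY : StronglyMeasurable[ℱ n] Y) {K : ℝ} (hK : ∀ ω, |Y ω| ≤ K) (t b : ℝ) :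
    Integrable (fun ω => Y ω * (1 + t * ζ n ω + b * (t * ζ n ω) ^ 2)) P ∧
    ∫ ω, Y ω * (1 + t * ζ n ω + b * (t * ζ n ω) ^ 2) ∂P = (1 + b * t ^ 2) * ∫ ω, Y ω ∂P := by
  have i0 := integrable_of_bound (P := P) hY hK
  have i1 := h.integrable_mul_pow hY hK 1
  have i2 := h.integrable_mul_pow hY hK 2
  simp only [pow_one] at i1
  have e : (fun ω => Y ω * (1 + t * ζ n ω + b * (t * ζ n ω) ^ 2)) =
      fun ω => Y ω + t * (Y ω * ζ n ω) + (b * t ^ 2) * (Y ω * ζ n ω ^ 2) := by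
    ext ω; ring
  rw [e]
  refine ⟨(i0.add (i1.const_mul _)).add (i2.const_mul _), ?_⟩
  have := integral_add (μ := P) (i0.add (i1.const_mul t)) (i2.const_mul (b * t ^ 2))
  simp only [Pi.add_apply] at this
  rw [this, integral_add i0 (i1.const_mul t), integral_const_mul, integral_const_mul,
    h.mean n Y hY ⟨K, hK⟩, h.var n Y hY ⟨K, hK⟩]
  ring

lemma integrable_mul_exp (h : IsNormalizedDiff P ℱ ζ C) {n : ℕ} {Y : Ω → ℝ}
    (hY : StronglyMeasurable[ℱ n] Y) {K : ℝ} (hK : ∀ ω, |Y ω| ≤ K) (t : ℝ) :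
    Integrable (fun ω => Y ω * Real.exp (t * ζ n ω)) P := by
  refine integrable_of_bound (n := n + 1) (K := K * Real.exp (|t| * C))
    ((hY.mono (ℱ.mono n.le_succ)).mul
      (Real.continuous_exp.comp_stronglyMeasurable ((h.measurable n).const_mul t))) fun ω => ?_
  rw [abs_mul, Real.abs_exp]
  refine mul_le_mul (hK ω) (Real.exp_le_exp.2 ?_) (Real.exp_nonneg _)
    ((abs_nonneg _).trans (hK ω))
  refine (le_abs_self _).trans ?_
  rw [abs_mul]
  exact mul_le_mul_of_nonneg_left (h.bound n ω) (abs_nonneg _)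

lemma integral_mul_exp_le (h : IsNormalizedDiff P ℱ ζ C) {n : ℕ} {Y : Ω → ℝ}
    (hY : StronglyMeasurable[ℱ n] Y) {K : ℝ} (hK : ∀ ω, |Y ω| ≤ K) (hY0 : ∀ ω, 0 ≤ Y ω)
    {t δ : ℝ} (ht : |t| * C ≤ δ) (hδ : δ ≤ 1) :
    ∫ ω, Y ω * Real.exp (t * ζ n ω) ∂P ≤ Real.exp ((1 + δ) * t ^ 2 / 2) * ∫ ω, Y ω ∂P := by
  obtain ⟨i1, e1⟩ := h.integral_mul_quadratic (P := P) hY hK t ((1 + δ) / 2)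
  calc ∫ ω, Y ω * Real.exp (t * ζ n ω) ∂P
      ≤ ∫ ω, Y ω * (1 + t * ζ n ω + (1 + δ) / 2 * (t * ζ n ω) ^ 2) ∂P := by
        refine integral_mono (h.integrable_mul_exp hY hK t) i1 fun ω => ?_
        refine mul_le_mul_of_nonneg_left ?_ (hY0 ω)
        have hb : |t * ζ n ω| ≤ δ := by
          rw [abs_mul]
          exact (mul_le_mul_of_nonneg_left (h.bound n ω) (abs_nonneg _)).trans ht
        have := (abs_le.1 (abs_exp_sub_quadratic_le hb hδ)).2
        linarith
    _ = (1 + (1 + δ) / 2 * t ^ 2) * ∫ ω, Y ω ∂P := e1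
    _ ≤ _ := by
        refine mul_le_mul_of_nonneg_right ?_ (integral_nonneg hY0)
        have := Real.add_one_le_exp ((1 + δ) * t ^ 2 / 2)
        linarith

lemma le_integral_mul_exp (h : IsNormalizedDiff P ℱ ζ C) {n : ℕ} {Y : Ω → ℝ}
    (hY : StronglyMeasurable[ℱ n] Y) {K : ℝ} (hK : ∀ ω, |Y ω| ≤ K) (hY0 : ∀ ω, 0 ≤ Y ω)
    {t δ : ℝ} (ht : |t| * C ≤ δ) (hδ : δ ≤ 1) :
    Real.exp ((1 - 2 * δ) * t ^ 2 / 2) * ∫ ω, Y ω ∂P ≤ ∫ ω, Y ω * Real.exp (t * ζ n ω) ∂P := by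
  obtain ⟨i1, e1⟩ := h.integral_mul_quadratic (P := P) hY hK t ((1 - δ) / 2)
  have hδ0 : 0 ≤ δ := le_trans (mul_nonneg (abs_nonneg _) (zero_le_one.trans h.one_le)) ht
  have htδ : |t| ≤ δ := le_trans (le_mul_of_one_le_right (abs_nonneg _) h.one_le) ht
  have ht2 : t ^ 2 ≤ δ := by
    rw [← sq_abs]
    nlinarith [abs_nonneg t]
  calc Real.exp ((1 - 2 * δ) * t ^ 2 / 2) * ∫ ω, Y ω ∂P
      ≤ (1 + (1 - δ) / 2 * t ^ 2) * ∫ ω, Y ω ∂P := by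
        refine mul_le_mul_of_nonneg_right ?_ (integral_nonneg hY0)
        refine le_trans (Real.exp_le_exp.2 ?_)
          (exp_mul_le_one_add (u := (1 - δ) / 2 * t ^ 2) (δ := δ) ?_ ?_)
        · nlinarith [mul_nonneg (sq_nonneg δ) (sq_nonneg t)]
        · exact mul_nonneg (by linarith) (sq_nonneg t)
        · nlinarith [sq_nonneg t, mul_nonneg hδ0 (sq_nonneg t)]
    _ = ∫ ω, Y ω * (1 + t * ζ n ω + (1 - δ) / 2 * (t * ζ n ω) ^ 2) ∂P := e1.symm
    _ ≤ _ := by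
        refine integral_mono i1 (h.integrable_mul_exp hY hK t) fun ω => ?_
        refine mul_le_mul_of_nonneg_left ?_ (hY0 ω)
        have hb : |t * ζ n ω| ≤ δ := by
          rw [abs_mul]
          exact (mul_le_mul_of_nonneg_left (h.bound n ω) (abs_nonneg _)).trans ht
        have := (abs_le.1 (abs_exp_sub_quadratic_le hb hδ)).1
        linarith

lemma integral_le_integral_mul_exp (h : IsNormalizedDiff P ℱ ζ C) {n : ℕ} {Y : Ω → ℝ}
    (hY : StronglyMeasurable[ℱ n] Y) {K : ℝ} (hK : ∀ ω, |Y ω| ≤ K) (hY0 : ∀ ω, 0 ≤ Y ω) (t : ℝ) :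
    ∫ ω, Y ω ∂P ≤ ∫ ω, Y ω * Real.exp (t * ζ n ω) ∂P := by
  obtain ⟨i1, e1⟩ := h.integral_mul_quadratic (P := P) hY hK t 0
  calc ∫ ω, Y ω ∂P = (1 + 0 * t ^ 2) * ∫ ω, Y ω ∂P := by ring
    _ = ∫ ω, Y ω * (1 + t * ζ n ω + 0 * (t * ζ n ω) ^ 2) ∂P := e1.symm
    _ ≤ _ := by
        refine integral_mono i1 (h.integrable_mul_exp hY hK t) fun ω => ?_
        refine mul_le_mul_of_nonneg_left ?_ (hY0 ω)
        have := Real.add_one_le_exp (t * ζ n ω)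
        linarith

lemma setIntegral_exp_increment_le (h : IsNormalizedDiff P ℱ ζ C) (c : ℕ → ℝ) {k n : ℕ}
    (hkn : k ≤ n) {A : Set Ω} (hA : MeasurableSet[ℱ k] A) {t δ : ℝ} (hδ : δ ≤ 1)
    (ht : ∀ j < n, |t * c j| * C ≤ δ) :
    ∫ ω in A, Real.exp (t * (weightedSum c ζ n ω - weightedSum c ζ k ω)) ∂P ≤
      Real.exp ((1 + δ) * t ^ 2 * (sumSq c n - sumSq c k) / 2) * P.real A := by
  induction n, hkn using Nat.le_induction with
  | base => simp
  | succ n hkn ih =>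
    obtain ⟨hm, ⟨K, hK⟩, h0⟩ := h.exp_increment c hkn hA t
    rw [integral_exp_increment_succ c hA t]
    refine (h.integral_mul_exp_le hm hK h0 (ht n n.lt_succ_self) hδ).trans ?_
    rw [integral_indicator (ℱ.le k A hA)]
    refine (mul_le_mul_of_nonneg_left (ih fun j hj => ht j (hj.trans n.lt_succ_self))
      (Real.exp_nonneg _)).trans (le_of_eq ?_)
    rw [← mul_assoc, ← Real.exp_add, sumSq_succ]
    congr 2; ring

lemma le_setIntegral_exp_increment (h : IsNormalizedDiff P ℱ ζ C) (c : ℕ → ℝ) {k n : ℕ}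
    (hkn : k ≤ n) {A : Set Ω} (hA : MeasurableSet[ℱ k] A) {t δ : ℝ} (hδ : δ ≤ 1)
    (ht : ∀ j < n, |t * c j| * C ≤ δ) :
    Real.exp ((1 - 2 * δ) * t ^ 2 * (sumSq c n - sumSq c k) / 2) * P.real A ≤
      ∫ ω in A, Real.exp (t * (weightedSum c ζ n ω - weightedSum c ζ k ω)) ∂P := by
  induction n, hkn using Nat.le_induction with
  | base => simp
  | succ n hkn ih =>
    obtain ⟨hm, ⟨K, hK⟩, h0⟩ := h.exp_increment c hkn hA t
    rw [integral_exp_increment_succ c hA t]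
    refine le_trans ?_ (h.le_integral_mul_exp hm hK h0 (ht n n.lt_succ_self) hδ)
    rw [integral_indicator (ℱ.le k A hA)]
    refine le_trans (le_of_eq ?_) (mul_le_mul_of_nonneg_left
      (ih fun j hj => ht j (hj.trans n.lt_succ_self)) (Real.exp_nonneg _))
    rw [← mul_assoc, ← Real.exp_add, sumSq_succ]
    congr 2; ring

lemma integrable_exp_weightedSum (h : IsNormalizedDiff P ℱ ζ C) (c : ℕ → ℝ) (n : ℕ) (t : ℝ) :
    Integrable (fun ω => Real.exp (t * weightedSum c ζ n ω)) P := by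
  obtain ⟨hm, ⟨K, hK⟩, -⟩ := h.exp_increment c (Nat.zero_le n) MeasurableSet.univ t
  simpa [weightedSum] using integrable_of_bound (P := P) hm hK

lemma integrable_exp_increment (h : IsNormalizedDiff P ℱ ζ C) (c : ℕ → ℝ) {k n : ℕ} (hkn : k ≤ n)
    (t : ℝ) :
    Integrable (fun ω => Real.exp (t * (weightedSum c ζ n ω - weightedSum c ζ k ω))) P := by
  obtain ⟨hm, ⟨K, hK⟩, -⟩ := h.exp_increment c hkn MeasurableSet.univ t
  simpa using integrable_of_bound (P := P) hm hK

lemma submartingale_exp_weightedSum (h : IsNormalizedDiff P ℱ ζ C) (c : ℕ → ℝ) (t : ℝ) :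
    Submartingale (fun n ω => Real.exp (t * weightedSum c ζ n ω)) ℱ P := by
  refine submartingale_of_setIntegral_le_succ
    (fun n => Real.continuous_exp.comp_stronglyMeasurable
      ((h.stronglyMeasurable_weightedSum c n).const_mul t))
    (fun n => h.integrable_exp_weightedSum c n t) fun n A hA => ?_
  have hm : StronglyMeasurable[ℱ n]
      (A.indicator fun ω => Real.exp (t * weightedSum c ζ n ω)) :=
    (Real.continuous_exp.comp_stronglyMeasurable
      ((h.stronglyMeasurable_weightedSum c n).const_mul t)).indicator hA
  have hK : ∀ ω, |A.indicator (fun ω => Real.exp (t * weightedSum c ζ n ω)) ω| ≤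
      Real.exp (|t| * ∑ j ∈ Finset.range n, |c j| * C) := fun ω => by
    by_cases hω : ω ∈ A
    · rw [Set.indicator_of_mem hω]
      rw [Real.abs_exp]
      refine Real.exp_le_exp.2 ((le_abs_self _).trans ?_)
      rw [abs_mul]
      exact mul_le_mul_of_nonneg_left (h.abs_weightedSum_le c n ω) (abs_nonneg _)
    · simpa [Set.indicator_of_notMem hω] using Real.exp_nonneg _
  have := h.integral_le_integral_mul_exp hm hK
    (fun ω => Set.indicator_nonneg (fun _ _ => Real.exp_nonneg _) ω) (t * c n)
  rw [integral_indicator (ℱ.le n A hA)] at this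
  refine this.trans (le_of_eq ?_)
  rw [← integral_indicator (ℱ.le n A hA)]
  congr 1
  ext ω
  by_cases hω : ω ∈ A
  · simp only [Set.indicator_of_mem hω, weightedSum_succ, ← Real.exp_add]
    congr 1; ring
  · simp [Set.indicator_of_notMem hω]

lemma measureReal_exists_le_weightedSum_le [IsProbabilityMeasure P] (h : IsNormalizedDiff P ℱ ζ C)
    (c : ℕ → ℝ) (N : ℕ) {t δ : ℝ} (ht0 : 0 ≤ t) (hδ : δ ≤ 1)
    (ht : ∀ j < N, |t * c j| * C ≤ δ) (x : ℝ) :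
    P.real {ω | ∃ n ≤ N, x ≤ weightedSum c ζ n ω} ≤
      Real.exp ((1 + δ) * t ^ 2 * sumSq c N / 2 - t * x) := by
  have hmax := maximal_ineq (h.submartingale_exp_weightedSum c t)
    (fun n ω => Real.exp_nonneg _) (ε := ⟨Real.exp (t * x), Real.exp_nonneg _⟩) N
  set B := {ω | ((⟨Real.exp (t * x), Real.exp_nonneg _⟩ : NNReal) : ℝ) ≤
    (Finset.range (N + 1)).sup' Finset.nonempty_range_add_one
      fun k => Real.exp (t * weightedSum c ζ k ω)} with hB
  have hsub : {ω | ∃ n ≤ N, x ≤ weightedSum c ζ n ω} ⊆ B := by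
    rintro ω ⟨n, hn, hx⟩
    simp only [hB, Set.mem_ofPred_eq, Finset.le_sup'_iff]
    refine ⟨n, Finset.mem_range.2 (Nat.lt_succ_of_le hn), ?_⟩
    exact Real.exp_le_exp.2 (mul_le_mul_of_nonneg_left hx ht0)
  have hinteg : ∫ ω in B, Real.exp (t * weightedSum c ζ N ω) ∂P ≤
      Real.exp ((1 + δ) * t ^ 2 * sumSq c N / 2) := by
    refine (setIntegral_le_integral (h.integrable_exp_weightedSum c N t)
      (ae_of_all _ fun ω => Real.exp_nonneg _)).trans ?_
    have := h.setIntegral_exp_increment_le c (Nat.zero_le N) MeasurableSet.univ hδ ht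
    simpa [weightedSum, sumSq] using this
  have h1 := ENNReal.toReal_mono ENNReal.ofReal_ne_top hmax
  rw [ENNReal.toReal_mul, ENNReal.toReal_ofReal (integral_nonneg fun ω => Real.exp_nonneg _)] at h1
  have h2 : Real.exp (t * x) * P.real B ≤ Real.exp ((1 + δ) * t ^ 2 * sumSq c N / 2) :=
    le_trans h1 hinteg
  rw [Real.exp_sub, le_div_iff₀ (Real.exp_pos _)]
  refine le_trans ?_ h2
  rw [mul_comm]
  exact mul_le_mul_of_nonneg_left (measureReal_mono hsub) (Real.exp_nonneg _)

end IsNormalizedDiff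

/-- A lower bound for a large deviation probability from two-sided Gaussian-type bounds on the
moment generating function, by exponential tilting. -/
lemma le_measureReal_of_mgf {Ω : Type*} {m : MeasurableSpace Ω} (μ : Measure Ω)
    [IsFiniteMeasure μ] {Z : Ω → ℝ} (hZ : Measurable Z)
    (hinteg : ∀ t, Integrable (fun ω => Real.exp (t * Z ω)) μ)
    {θ U δ : ℝ} (hθ : 0 ≤ θ) (hU : 0 ≤ U) (hδ0 : 0 < δ) (hδ1 : δ ≤ 1)
    (hlow : Real.exp ((1 - 2 * (δ ^ 2 / 10)) * θ ^ 2 * U / 2) * μ.real Set.univ ≤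
      ∫ ω, Real.exp (θ * Z ω) ∂μ)
    (hup : ∀ t, 0 ≤ t → t ≤ 2 * θ → ∫ ω, Real.exp (t * Z ω) ∂μ ≤
      Real.exp ((1 + δ ^ 2 / 10) * t ^ 2 * U / 2) * μ.real Set.univ)
    (hlarge : Real.exp (-(3 / 10 * δ ^ 2 * (θ ^ 2 * U / 2))) ≤ 1 / 4) :
    1 / 2 * Real.exp (-((1 + 3 * δ) * (θ ^ 2 * U / 2))) * μ.real Set.univ ≤
      μ.real {ω | (1 - δ) * (θ * U) ≤ Z ω} := by
  set Q := θ ^ 2 * U / 2 with hQ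
  set B := μ.real Set.univ with hB
  set E := {ω | (1 - δ) * (θ * U) ≤ Z ω} with hE
  have hQ0 : 0 ≤ Q := by positivity
  have hB0 : 0 ≤ B := measureReal_nonneg
  have hEm : MeasurableSet E := measurableSet_le measurable_const hZ
  have hpt : ∀ ω, Real.exp (θ * Z ω) ≤ Real.exp (2 * (1 + δ) * Q) * E.indicator 1 ω +
      Real.exp (-(δ * (1 + δ) * Q)) * Real.exp (θ * (1 + δ / 2) * Z ω) +
      Real.exp (δ * (1 - δ) * Q) * Real.exp (θ * (1 - δ / 2) * Z ω) := by
    intro ω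
    rw [← Real.exp_add, ← Real.exp_add]
    have p1 := Real.exp_pos (2 * (1 + δ) * Q)
    have p2 := Real.exp_pos (-(δ * (1 + δ) * Q) + θ * (1 + δ / 2) * Z ω)
    have p3 := Real.exp_pos (δ * (1 - δ) * Q + θ * (1 - δ / 2) * Z ω)
    by_cases h1 : ω ∈ E
    · rw [Set.indicator_of_mem h1, Pi.one_apply, mul_one]
      by_cases h2 : Z ω ≤ (1 + δ) * (θ * U)
      · have : Real.exp (θ * Z ω) ≤ Real.exp (2 * (1 + δ) * Q) := by
          refine Real.exp_le_exp.2 ?_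
          have := mul_le_mul_of_nonneg_left h2 hθ
          rw [hQ]; linarith
        linarith
      · have : Real.exp (θ * Z ω) ≤ Real.exp (-(δ * (1 + δ) * Q) + θ * (1 + δ / 2) * Z ω) := by
          refine Real.exp_le_exp.2 ?_
          have := mul_le_mul_of_nonneg_left (not_le.1 h2).le (mul_nonneg hθ hδ0.le)
          rw [hQ]; linarith
        linarith
    · rw [Set.indicator_of_notMem h1, mul_zero]
      have h2 : Z ω ≤ (1 - δ) * (θ * U) := (not_le.1 h1).le
      have : Real.exp (θ * Z ω) ≤ Real.exp (δ * (1 - δ) * Q + θ * (1 - δ / 2) * Z ω) := by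
        refine Real.exp_le_exp.2 ?_
        have := mul_le_mul_of_nonneg_left h2 (mul_nonneg hθ hδ0.le)
        rw [hQ]; linarith
      linarith
  have hi1 : Integrable (E.indicator (1 : Ω → ℝ)) μ := (integrable_const 1).indicator hEm
  have hsum := integral_mono (hinteg θ) (((hi1.const_mul _).add
    ((hinteg (θ * (1 + δ / 2))).const_mul _)).add ((hinteg (θ * (1 - δ / 2))).const_mul _)) hpt
  have e1 := integral_add (μ := μ) ((hi1.const_mul (Real.exp (2 * (1 + δ) * Q))).add
    ((hinteg (θ * (1 + δ / 2))).const_mul (Real.exp (-(δ * (1 + δ) * Q)))))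
    ((hinteg (θ * (1 - δ / 2))).const_mul (Real.exp (δ * (1 - δ) * Q)))
  have e2 := integral_add (μ := μ) (hi1.const_mul (Real.exp (2 * (1 + δ) * Q)))
    ((hinteg (θ * (1 + δ / 2))).const_mul (Real.exp (-(δ * (1 + δ) * Q))))
  simp only [Pi.add_apply] at e1 hsum
  rw [e1, e2, integral_const_mul, integral_const_mul, integral_const_mul,
    integral_indicator_one hEm] at hsum
  have hu1 := hup (θ * (1 + δ / 2)) (by positivity) (by nlinarith)
  have hu2 := hup (θ * (1 - δ / 2)) (mul_nonneg hθ (by linarith)) (by nlinarith)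
  set W := Real.exp ((1 - 2 * (δ ^ 2 / 10)) * θ ^ 2 * U / 2) with hW
  have hδ3 : δ ^ 3 ≤ δ ^ 2 := pow_le_pow_of_le_one hδ0.le hδ1 (by norm_num)
  have hδ4 : δ ^ 4 ≤ δ ^ 2 := pow_le_pow_of_le_one hδ0.le hδ1 (by norm_num)
  have hδ5 : 0 ≤ δ ^ 3 := by positivity
  have b1 : Real.exp (-(δ * (1 + δ) * Q)) *
      ∫ ω, Real.exp (θ * (1 + δ / 2) * Z ω) ∂μ ≤ 1 / 4 * W * B := by
    refine (mul_le_mul_of_nonneg_left hu1 (Real.exp_nonneg _)).trans ?_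
    rw [← mul_assoc, ← Real.exp_add]
    refine mul_le_mul_of_nonneg_right ?_ hB0
    refine le_trans ?_ (mul_le_mul_of_nonneg_right hlarge (Real.exp_nonneg _))
    rw [← Real.exp_add]
    refine Real.exp_le_exp.2 ?_
    have e : (1 + δ ^ 2 / 10) * (θ * (1 + δ / 2)) ^ 2 * U / 2 =
      (1 + δ ^ 2 / 10) * (1 + δ / 2) ^ 2 * Q := by rw [hQ]; ring
    have e' : (1 - 2 * (δ ^ 2 / 10)) * θ ^ 2 * U / 2 = (1 - 2 * (δ ^ 2 / 10)) * Q := by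
      rw [hQ]; ring
    rw [e, e']
    have key : -(δ * (1 + δ)) + (1 + δ ^ 2 / 10) * (1 + δ / 2) ^ 2 ≤
        -(3 / 10 * δ ^ 2) + (1 - 2 * (δ ^ 2 / 10)) := by ring_nf; linarith
    linarith [mul_le_mul_of_nonneg_right key hQ0]
  have b2 : Real.exp (δ * (1 - δ) * Q) *
      ∫ ω, Real.exp (θ * (1 - δ / 2) * Z ω) ∂μ ≤ 1 / 4 * W * B := by
    refine (mul_le_mul_of_nonneg_left hu2 (Real.exp_nonneg _)).trans ?_
    rw [← mul_assoc, ← Real.exp_add]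
    refine mul_le_mul_of_nonneg_right ?_ hB0
    refine le_trans ?_ (mul_le_mul_of_nonneg_right hlarge (Real.exp_nonneg _))
    rw [← Real.exp_add]
    refine Real.exp_le_exp.2 ?_
    have e : (1 + δ ^ 2 / 10) * (θ * (1 - δ / 2)) ^ 2 * U / 2 =
      (1 + δ ^ 2 / 10) * (1 - δ / 2) ^ 2 * Q := by rw [hQ]; ring
    have e' : (1 - 2 * (δ ^ 2 / 10)) * θ ^ 2 * U / 2 = (1 - 2 * (δ ^ 2 / 10)) * Q := by
      rw [hQ]; ring
    rw [e, e']
    have key : δ * (1 - δ) + (1 + δ ^ 2 / 10) * (1 - δ / 2) ^ 2 ≤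
        -(3 / 10 * δ ^ 2) + (1 - 2 * (δ ^ 2 / 10)) := by ring_nf; linarith [sq_nonneg δ]
    linarith [mul_le_mul_of_nonneg_right key hQ0]
  have hmain : 1 / 2 * W * B ≤ Real.exp (2 * (1 + δ) * Q) * μ.real E := by linarith
  have hWe : Real.exp (-((1 + 3 * δ) * Q)) ≤ Real.exp (-(2 * (1 + δ) * Q)) * W := by
    rw [hW, ← Real.exp_add]
    refine Real.exp_le_exp.2 ?_
    have e' : (1 - 2 * (δ ^ 2 / 10)) * θ ^ 2 * U / 2 = (1 - 2 * (δ ^ 2 / 10)) * Q := by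
      rw [hQ]; ring
    rw [e']
    have key : -(1 + 3 * δ) ≤ -(2 * (1 + δ)) + (1 - 2 * (δ ^ 2 / 10)) := by nlinarith
    linarith [mul_le_mul_of_nonneg_right key hQ0]
  calc 1 / 2 * Real.exp (-((1 + 3 * δ) * Q)) * B
      ≤ 1 / 2 * (Real.exp (-(2 * (1 + δ) * Q)) * W) * B := by gcongr
    _ = Real.exp (-(2 * (1 + δ) * Q)) * (1 / 2 * W * B) := by ring
    _ ≤ Real.exp (-(2 * (1 + δ) * Q)) * (Real.exp (2 * (1 + δ) * Q) * μ.real E) := by gcongr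
    _ = μ.real E := by rw [← mul_assoc, ← Real.exp_add]; simp

/-- A conditional second Borel–Cantelli lemma with deterministic lower bounds. -/
lemma ae_frequently_mem_of_le_measureReal_inter {Ω : Type*} {m : MeasurableSpace Ω}
    {P : Measure Ω} [IsProbabilityMeasure P] (ℱ : Filtration ℕ m) {N : ℕ → ℕ} (hN : Monotone N)
    {E : ℕ → Set Ω} (hE : ∀ k, MeasurableSet[ℱ (N (k + 1))] (E k)) {r : ℕ → ℝ}
    (hr0 : ∀ k, 0 ≤ r k) (hr : ¬ Summable r)
    (h : ∀ᶠ k in atTop, ∀ A, MeasurableSet[ℱ (N k)] A → r k * P.real A ≤ P.real (A ∩ E k)) :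
    ∀ᵐ ω ∂P, ∃ᶠ k in atTop, ω ∈ E k := by
  obtain ⟨K, hK⟩ := eventually_atTop.1 h
  have hnull : ∀ K' ≥ K, P {ω | ∀ k ≥ K', ω ∉ E k} = 0 := by
    intro K' hK'
    have hstep : ∀ L ≥ K', MeasurableSet[ℱ (N L)] {ω | ∀ k ≥ K', k < L → ω ∉ E k} ∧
        P.real {ω | ∀ k ≥ K', k < L → ω ∉ E k} ≤ Real.exp (-∑ k ∈ Finset.Ico K' L, r k) := by
      intro L hL
      induction L, hL using Nat.le_induction with
      | base =>
        have : {ω | ∀ k ≥ K', k < K' → ω ∉ E k} = Set.univ := by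
          ext ω
          simp only [Set.mem_ofPred_eq, Set.mem_univ, iff_true]
          intro k hk hk'
          omega
        rw [this]
        exact ⟨MeasurableSet.univ, by simp⟩
      | succ L hL ih =>
        have e : {ω | ∀ k ≥ K', k < L + 1 → ω ∉ E k} =
            {ω | ∀ k ≥ K', k < L → ω ∉ E k} \ E L := by
          ext ω
          simp only [Set.mem_ofPred_eq, Set.mem_sdiff]
          constructor
          · exact fun hω => ⟨fun k hk hkL => hω k hk (by omega), hω L hL L.lt_succ_self⟩
          · rintro ⟨h1, h2⟩ k hk hkL
            rcases Nat.lt_succ_iff_lt_or_eq.1 hkL with h3 | h3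
            · exact h1 k hk h3
            · exact h3 ▸ h2
        rw [e]
        refine ⟨(ℱ.mono (hN L.le_succ) _ ih.1).diff (hE L), ?_⟩
        have h1 := hK L (hK'.trans hL) _ ih.1
        have h2 := measureReal_inter_add_sdiff (μ := P)
          (s := {ω | ∀ k ≥ K', k < L → ω ∉ E k}) (ℱ.le _ _ (hE L))
        rw [Finset.sum_Ico_succ_top hL, neg_add, Real.exp_add]
        have h3 := Real.add_one_le_exp (-r L)
        have h4 : (0 : ℝ) ≤ P.real {ω | ∀ k ≥ K', k < L → ω ∉ E k} := measureReal_nonneg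
        calc P.real ({ω | ∀ k ≥ K', k < L → ω ∉ E k} \ E L)
            ≤ (-r L + 1) * P.real {ω | ∀ k ≥ K', k < L → ω ∉ E k} := by linarith
          _ ≤ Real.exp (-r L) * P.real {ω | ∀ k ≥ K', k < L → ω ∉ E k} := by gcongr
          _ ≤ _ := by rw [mul_comm]; gcongr; exact ih.2
    have hlim : Tendsto (fun L => Real.exp (-∑ k ∈ Finset.Ico K' L, r k)) atTop (nhds 0) := by
      refine Real.tendsto_exp_atBot.comp (tendsto_neg_atTop_atBot.comp ?_)
      have h1 := (not_summable_iff_tendsto_nat_atTop_of_nonneg hr0).1 hr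
      have h2 := tendsto_atTop_add_const_right atTop (-∑ k ∈ Finset.range K', r k) h1
      refine h2.congr' ?_
      filter_upwards [eventually_ge_atTop K'] with L hL
      rw [Finset.sum_Ico_eq_sub _ hL, sub_eq_add_neg]
    have hle : P.real {ω | ∀ k ≥ K', ω ∉ E k} ≤ 0 := by
      refine ge_of_tendsto hlim ?_
      filter_upwards [eventually_ge_atTop K'] with L hL
      have hsub : {ω | ∀ k ≥ K', ω ∉ E k} ⊆ {ω | ∀ k ≥ K', k < L → ω ∉ E k} :=
        fun ω hω k hk _ => hω k hk
      exact (measureReal_mono hsub).trans (hstep L hL).2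
    exact (measureReal_eq_zero_iff).1 (le_antisymm hle measureReal_nonneg)
  have hall : ∀ᵐ ω ∂P, ∀ K', K ≤ K' → ¬ ∀ k ≥ K', ω ∉ E k := by
    rw [ae_all_iff]
    intro K'
    by_cases hK' : K ≤ K'
    · have := hnull K' hK'
      filter_upwards [measure_eq_zero_iff_ae_notMem.1 this] with ω hω _
      exact hω
    · exact ae_of_all _ fun ω h' => absurd h' hK'
  filter_upwards [hall] with ω hω
  rw [frequently_atTop]
  intro a
  have := hω (max a K) (le_max_right _ _)
  push Not at this
  obtain ⟨k, hk, hk'⟩ := this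
  exact ⟨k, (le_max_left _ _).trans hk, hk'⟩

/-- The scale `√(2 v log log v)` of the law of the iterated logarithm. -/
def lilScale (v : ℝ) : ℝ := Real.sqrt (2 * v * Real.log (Real.log v))

lemma lilScale_nonneg (v : ℝ) : 0 ≤ lilScale v := Real.sqrt_nonneg _

lemma lilScale_mono {v w : ℝ} (hv : 1 ≤ v) (hvw : v ≤ w) : lilScale v ≤ lilScale w := by
  unfold lilScale
  have hlv : 0 ≤ Real.log v := Real.log_nonneg hv
  by_cases h : 1 ≤ Real.log v
  · have h1 : Real.log v ≤ Real.log w := Real.log_le_log (by linarith) hvw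
    have h2 : Real.log (Real.log v) ≤ Real.log (Real.log w) := Real.log_le_log (by linarith) h1
    have h3 : 0 ≤ Real.log (Real.log v) := Real.log_nonneg h
    refine Real.sqrt_le_sqrt ?_
    refine mul_le_mul (by linarith) h2 h3 (by linarith)
  · rw [Real.sqrt_eq_zero_of_nonpos]
    · exact Real.sqrt_nonneg _
    · exact mul_nonpos_of_nonneg_of_nonpos (by linarith)
        (Real.log_nonpos hlv (not_le.1 h).le)

lemma lilScale_sq {v : ℝ} (hv : 0 ≤ v) (h : 0 ≤ Real.log (Real.log v)) :
    lilScale v ^ 2 = 2 * v * Real.log (Real.log v) :=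
  Real.sq_sqrt (by positivity)

/-- Kolmogorov's condition on the weights in the law of the iterated logarithm. -/
def KolmogorovCondition (c : ℕ → ℝ) : Prop :=
  ∀ η > 0, ∀ᶠ v : ℝ in atTop, ∀ j, sumSq c (j + 1) ≤ v →
    c j ^ 2 * Real.log (Real.log v) ≤ η * v

lemma abs_mul_mul_le_of_sq_mul_le {t c C δ a v L : ℝ} (hv : 0 < v) (ha : 0 < a) (hC : 0 < C)
    (hδ : 0 ≤ δ) (h1 : t ^ 2 * v ≤ a * L) (h2 : c ^ 2 * L ≤ δ ^ 2 / (a * C ^ 2) * v) :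
    |t * c| * C ≤ δ := by
  refine le_of_sq_le_sq ?_ hδ
  rw [mul_pow, sq_abs, mul_pow]
  have h3 : (t ^ 2 * c ^ 2 * C ^ 2) * v ≤ δ ^ 2 * v := by
    calc (t ^ 2 * c ^ 2 * C ^ 2) * v = c ^ 2 * C ^ 2 * (t ^ 2 * v) := by ring
      _ ≤ c ^ 2 * C ^ 2 * (a * L) := by gcongr
      _ = a * C ^ 2 * (c ^ 2 * L) := by ring
      _ ≤ a * C ^ 2 * (δ ^ 2 / (a * C ^ 2) * v) := by gcongr
      _ = δ ^ 2 * v := by field_simp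
  exact le_of_mul_le_mul_right h3 hv

lemma exists_sumSq_le_lt {c : ℕ → ℝ} (hV : Tendsto (sumSq c) atTop atTop) {v : ℝ} (hv : 0 ≤ v) :
    ∃ n, sumSq c n ≤ v ∧ v < sumSq c (n + 1) := by
  classical
  have hex : ∃ n, v < sumSq c n := (hV.eventually_gt_atTop v).exists
  have h0 : Nat.find hex ≠ 0 := fun h => by
    have := Nat.find_spec hex
    rw [h, sumSq_zero] at this
    linarith
  obtain ⟨n, hn⟩ := Nat.exists_eq_succ_of_ne_zero h0
  refine ⟨n, not_lt.1 (Nat.find_min hex (by omega)), ?_⟩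
  have := Nat.find_spec hex
  rwa [hn] at this

lemma tendsto_log_log_pow {ρ : ℝ} (hρ : 1 < ρ) :
    Tendsto (fun k : ℕ => Real.log (Real.log (ρ ^ k))) atTop atTop :=
  Real.tendsto_log_atTop.comp (Real.tendsto_log_atTop.comp (tendsto_pow_atTop_atTop_of_one_lt hρ))

lemma eventually_exp_neg_log_log_le {ε : ℝ} (hε : 0 < ε) (hε1 : ε < 1) :
    ∀ᶠ v : ℝ in atTop, Real.exp (-(3 / 10 * (ε / 3) ^ 2 *
      ((1 - ε) ^ 2 * Real.log (Real.log v)))) ≤ 1 / 4 := by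
  have hpos : 0 < 3 / 10 * (ε / 3) ^ 2 * (1 - ε) ^ 2 := by
    have : 0 < 1 - ε := by linarith
    positivity
  have h1 := Real.tendsto_exp_neg_atTop_nhds_zero.comp ((Real.tendsto_log_atTop.comp
    Real.tendsto_log_atTop).const_mul_atTop hpos)
  filter_upwards [h1.eventually_le_const (by norm_num : (0 : ℝ) < 1 / 4)] with v hv
  rw [← mul_assoc]
  exact hv

namespace IsNormalizedDiff

variable {Ω : Type*} {m : MeasurableSpace Ω} {P : Measure Ω} [IsProbabilityMeasure P]
  {ℱ : Filtration ℕ m} {ζ : ℕ → Ω → ℝ} {C : ℝ} {c : ℕ → ℝ}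

/-- Upper half of the law of the iterated logarithm. -/
theorem ae_eventually_weightedSum_le (h : IsNormalizedDiff P ℱ ζ C)
    (hV : Tendsto (sumSq c) atTop atTop) (hK : KolmogorovCondition c) {ε : ℝ} (hε : 0 < ε) :
    ∀ᵐ ω ∂P, ∀ᶠ n in atTop, weightedSum c ζ n ω ≤ (1 + ε) * lilScale (sumSq c n) := by
  set ρ := 1 + ε with hρ
  have hρ1 : 1 < ρ := by linarith
  have hρ0 : 0 < ρ := by linarith
  have hC : 0 < C := zero_lt_one.trans_le h.one_le
  set δ := ε / 2 / ρ with hδ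
  have hδ0 : 0 < δ := by positivity
  have hδ1 : δ ≤ 1 := by rw [hδ, div_le_one hρ0]; linarith
  have hδρ : (1 - δ) * ρ = 1 + ε / 2 := by rw [hδ]; field_simp; rw [hρ]; ring
  choose N hN hN' using fun k : ℕ =>
    exists_sumSq_le_lt hV (v := ρ ^ k) (by positivity)
  have hbound : ∀ᶠ k : ℕ in atTop,
      P.real {ω | ∃ n ≤ N (k + 1), ρ * lilScale (ρ ^ k) ≤ weightedSum c ζ n ω} ≤
        (Real.log ρ) ^ (-(1 + ε / 2)) * (k : ℝ) ^ (-(1 + ε / 2)) := by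
    have hη : 0 < δ ^ 2 / (2 * ρ ^ 2 * C ^ 2) := by positivity
    have hpow := tendsto_pow_atTop_atTop_of_one_lt hρ1
    filter_upwards [(hpow.comp (tendsto_add_atTop_nat 1)).eventually (hK _ hη),
      (tendsto_log_log_pow hρ1).eventually_ge_atTop 0, eventually_gt_atTop 0,
      ((Real.tendsto_log_atTop.comp hpow).eventually_ge_atTop 1)] with k hk hL hk0 hk1
    simp only [Function.comp_apply] at hk hk1
    set v := ρ ^ k with hv
    set v' := ρ ^ (k + 1) with hv'
    have hv0 : 0 < v := by positivity
    have hv0' : 0 < v' := by positivity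
    have hvv : v' = v * ρ := pow_succ _ _
    set t := ρ * lilScale v / v' with ht
    have ht0 : 0 ≤ t := div_nonneg (mul_nonneg hρ0.le (lilScale_nonneg _)) hv0'.le
    have hsq := lilScale_sq hv0.le hL
    have hLL : Real.log (Real.log v) ≤ Real.log (Real.log v') :=
      Real.log_le_log (by linarith) (Real.log_le_log hv0 (by rw [hvv]; nlinarith))
    have ht2 : t ^ 2 * v' = ρ * (2 * Real.log (Real.log v)) := by
      rw [ht, div_pow, mul_pow, hsq, hvv]; field_simp
    have hcond : ∀ j < N (k + 1), |t * c j| * C ≤ δ := by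
      intro j hj
      refine abs_mul_mul_le_of_sq_mul_le (a := 2 * ρ ^ 2) hv0' (by positivity) hC hδ0.le ?_
        (hk j (((sumSq_mono c) hj).trans (hN (k + 1))))
      rw [ht2]
      nlinarith [mul_nonneg (mul_nonneg hρ0.le hL) (sub_nonneg.2 hρ1.le),
        mul_nonneg (sq_nonneg ρ) (sub_nonneg.2 hLL)]
    refine (h.measureReal_exists_le_weightedSum_le c (N (k + 1)) ht0 hδ1 hcond
      (ρ * lilScale v)).trans ?_
    have hlogv : Real.log v = k * Real.log ρ := by rw [hv, Real.log_pow]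
    have hlogρ : 0 < Real.log ρ := Real.log_pos hρ1
    rw [← Real.mul_rpow hlogρ.le (Nat.cast_nonneg k), mul_comm (Real.log ρ), ← hlogv,
      Real.rpow_def_of_pos (by linarith)]
    refine Real.exp_le_exp.2 ?_
    have hx : t * (ρ * lilScale v) = t ^ 2 * v' := by rw [ht]; field_simp
    have h1 : (1 + δ) * t ^ 2 * sumSq c (N (k + 1)) ≤ (1 + δ) * t ^ 2 * v' := by
      have := hN (k + 1)
      gcongr
    rw [hx]
    have h2 : (1 + δ) * t ^ 2 * v' / 2 - t ^ 2 * v' = -((1 - δ) * ρ * Real.log (Real.log v)) := by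
      rw [show (1 + δ) * t ^ 2 * v' = (1 + δ) * (t ^ 2 * v') by ring, ht2]; ring
    rw [hδρ] at h2
    linarith
  have hsum : Summable fun k : ℕ =>
      P.real {ω | ∃ n ≤ N (k + 1), ρ * lilScale (ρ ^ k) ≤ weightedSum c ζ n ω} := by
    refine Summable.of_norm_bounded_eventually_nat
      (g := fun k : ℕ => (Real.log ρ) ^ (-(1 + ε / 2)) * (k : ℝ) ^ (-(1 + ε / 2)))
      ((Real.summable_nat_rpow.2 (by linarith)).mul_left _) ?_
    filter_upwards [hbound] with k hk
    rwa [Real.norm_of_nonneg measureReal_nonneg]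
  have hne : ∑' k : ℕ, P {ω | ∃ n ≤ N (k + 1), ρ * lilScale (ρ ^ k) ≤ weightedSum c ζ n ω} ≠ ⊤ := by
    have := hsum.tsum_ofReal_ne_top
    refine fun htop => this (htop ▸ tsum_congr fun k => ?_)
    exact ofReal_measureReal (measure_ne_top P _)
  filter_upwards [ae_eventually_notMem hne] with ω hω
  obtain ⟨K, hK'⟩ := eventually_atTop.1 hω
  filter_upwards [hV.eventually_ge_atTop (ρ ^ K)] with n hn
  have h1 : 1 ≤ sumSq c n := (one_le_pow₀ hρ1.le).trans hn
  obtain ⟨k, hk1, hk2⟩ := exists_nat_pow_near h1 hρ1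
  have hKk : K ≤ k := by
    by_contra hlt
    have : ρ ^ (k + 1) ≤ ρ ^ K := pow_le_pow_right₀ hρ1.le (by omega)
    linarith
  have hnN : n ≤ N (k + 1) := by
    by_contra hlt
    have := sumSq_mono c (show N (k + 1) + 1 ≤ n by omega)
    linarith [hN' (k + 1)]
  have h2 := hK' k hKk
  simp only [not_exists, not_and, not_le] at h2
  refine (h2 n hnN).le.trans ?_
  exact mul_le_mul_of_nonneg_left (lilScale_mono (one_le_pow₀ hρ1.le) hk1) hρ0.le

/-- The conditional probability that an increment of variance at least `(1 - ε) v` reaches nearly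
the scale `lilScale v` is at least of order `1 / log v`. -/
lemma le_measureReal_increment (h : IsNormalizedDiff P ℱ ζ C) {k n : ℕ} (hkn : k ≤ n)
    {A : Set Ω} (hA : MeasurableSet[ℱ k] A) {ε v : ℝ} (hε : 0 < ε) (hε1 : ε < 1) (hv0 : 0 < v)
    (hv1 : 1 ≤ Real.log v) (hUv : sumSq c n - sumSq c k ≤ v)
    (hUl : (1 - ε) * v ≤ sumSq c n - sumSq c k)
    (hlarge : Real.exp (-(3 / 10 * (ε / 3) ^ 2 *
      ((1 - ε) ^ 2 * Real.log (Real.log v)))) ≤ 1 / 4)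
    (hc : ∀ j < n, c j ^ 2 * Real.log (Real.log v) ≤
      ((ε / 3) ^ 2 / 10) ^ 2 / (8 / (1 - ε) ^ 2 * C ^ 2) * v) :
    1 / 2 * (Real.log v)⁻¹ * P.real A ≤
      P.real (A ∩ {ω | (1 - ε / 3) * ((1 - ε) * lilScale v) ≤
        weightedSum c ζ n ω - weightedSum c ζ k ω}) := by
  have hC : 0 < C := zero_lt_one.trans_le h.one_le
  have hε' : 0 < 1 - ε := by linarith
  set δ := ε / 3 with hδ
  have hδ0 : 0 < δ := by positivity
  have hδ1 : δ ≤ 1 := by rw [hδ]; linarith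
  have hδ10 : δ ^ 2 / 10 ≤ 1 := by nlinarith
  set L := Real.log (Real.log v) with hLdef
  have hL : 0 ≤ L := Real.log_nonneg hv1
  set U := sumSq c n - sumSq c k with hU
  have hU0 : 0 < U := lt_of_lt_of_le (mul_pos hε' hv0) hUl
  set x := (1 - ε) * lilScale v with hx
  have hx0 : 0 ≤ x := mul_nonneg hε'.le (lilScale_nonneg v)
  have hx2 : x ^ 2 = (1 - ε) ^ 2 * (2 * v * L) := by
    rw [hx, mul_pow, lilScale_sq hv0.le hL]
  set θ := x / U with hθ
  have hθ0 : 0 ≤ θ := div_nonneg hx0 hU0.le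
  have hθU : θ * U = x := div_mul_cancel₀ _ hU0.ne'
  set y := v / U with hy
  have hQ : θ ^ 2 * U / 2 = (1 - ε) ^ 2 * L * y := by
    have : θ ^ 2 * U = x ^ 2 / U := by rw [hθ]; field_simp
    rw [this, hx2, hy]; ring
  have hy1 : 1 ≤ y := (one_le_div hU0).2 hUv
  have hy2 : (1 - ε) * y ≤ 1 := by
    rw [hy, ← mul_div_assoc, div_le_one hU0]; exact hUl
  have hy0 : 0 ≤ (1 - ε) * y := mul_nonneg hε'.le (zero_le_one.trans hy1)
  have hQl : (1 - ε) ^ 2 * L ≤ θ ^ 2 * U / 2 := by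
    rw [hQ]
    exact le_mul_of_one_le_right (by positivity) hy1
  have hQu : (1 + 3 * δ) * (θ ^ 2 * U / 2) ≤ L := by
    have h1 : (1 - ε) * (1 + ε) ≤ 1 := by nlinarith
    have h2 : (1 - ε) * (1 + ε) * ((1 - ε) * y) ≤ 1 := mul_le_one₀ h1 hy0 hy2
    rw [hQ, hδ]
    calc (1 + 3 * (ε / 3)) * ((1 - ε) ^ 2 * L * y)
        = (1 - ε) * (1 + ε) * ((1 - ε) * y) * L := by ring
      _ ≤ 1 * L := mul_le_mul_of_nonneg_right h2 hL
      _ = L := one_mul L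
  have hθv : θ ^ 2 * v ≤ 2 * L := by
    have h1 : θ ^ 2 * v = 2 * L * ((1 - ε) * y) ^ 2 := by
      have : θ ^ 2 * v = x ^ 2 * v / U ^ 2 := by rw [hθ, div_pow]; ring
      rw [this, hx2, hy]; ring_nf
    rw [h1]
    exact mul_le_of_le_one_right (by positivity) (pow_le_one₀ hy0 hy2)
  have htc : ∀ t, 0 ≤ t → t ≤ 2 * θ → ∀ j < n, |t * c j| * C ≤ δ ^ 2 / 10 := by
    intro t ht0 ht j hj
    refine abs_mul_mul_le_of_sq_mul_le (a := 8 / (1 - ε) ^ 2) hv0 (by positivity) hC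
      (by positivity) ?_ (hc j hj)
    have h1 : t ^ 2 ≤ (2 * θ) ^ 2 := pow_le_pow_left₀ ht0 ht 2
    have h4 : 8 ≤ 8 / (1 - ε) ^ 2 := by
      rw [le_div_iff₀ (by positivity)]; nlinarith
    calc t ^ 2 * v ≤ (2 * θ) ^ 2 * v := mul_le_mul_of_nonneg_right h1 hv0.le
      _ = 4 * (θ ^ 2 * v) := by ring
      _ ≤ 8 * L := by linarith
      _ ≤ _ := mul_le_mul_of_nonneg_right h4 hL
  have hZm : StronglyMeasurable fun ω => weightedSum c ζ n ω - weightedSum c ζ k ω :=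
    ((h.stronglyMeasurable_weightedSum c _).mono (ℱ.le _)).sub
      ((h.stronglyMeasurable_weightedSum c _).mono (ℱ.le _))
  have key := le_measureReal_of_mgf (P.restrict A) hZm.measurable
    (fun t => (h.integrable_exp_increment c hkn t).restrict)
    hθ0 hU0.le hδ0 hδ1
    (by
      rw [measureReal_restrict_apply MeasurableSet.univ, Set.univ_inter]
      exact h.le_setIntegral_exp_increment c hkn hA hδ10 (htc θ hθ0 (by linarith)))
    (fun t ht0 ht => by
      rw [measureReal_restrict_apply MeasurableSet.univ, Set.univ_inter]
      exact h.setIntegral_exp_increment_le c hkn hA hδ10 (htc t ht0 ht))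
    (le_trans (Real.exp_le_exp.2 (neg_le_neg
      (mul_le_mul_of_nonneg_left hQl (by positivity)))) hlarge)
  rw [measureReal_restrict_apply MeasurableSet.univ, Set.univ_inter, hθU,
    measureReal_restrict_apply (measurableSet_le measurable_const hZm.measurable),
    Set.inter_comm] at key
  refine le_trans (mul_le_mul_of_nonneg_right ?_ measureReal_nonneg) key
  have : (Real.log v)⁻¹ = Real.exp (-L) := by
    rw [Real.exp_neg, Real.exp_log (by linarith)]
  rw [this]
  exact mul_le_mul_of_nonneg_left (Real.exp_le_exp.2 (neg_le_neg hQu)) (by norm_num)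

/-- Lower half of the law of the iterated logarithm. -/
theorem ae_frequently_le_weightedSum (h : IsNormalizedDiff P ℱ ζ C)
    (hV : Tendsto (sumSq c) atTop atTop) (hK : KolmogorovCondition c) {ε : ℝ} (hε : 0 < ε)
    (hε1 : ε ≤ 1 / 3) :
    ∀ᵐ ω ∂P, ∃ᶠ n in atTop, (1 - 3 * ε) * lilScale (sumSq c n) ≤ weightedSum c ζ n ω := by
  set ρ := 4 / ε ^ 2 with hρ
  have hρ4 : 4 ≤ ρ := by rw [hρ, le_div_iff₀ (by positivity)]; nlinarith
  have hρ1 : 1 < ρ := by linarith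
  have hρ0 : 0 < ρ := by linarith
  have hρε : ρ * ε ^ 2 = 4 := by rw [hρ]; field_simp
  have hC : 0 < C := zero_lt_one.trans_le h.one_le
  choose N hN hN' using fun k : ℕ =>
    exists_sumSq_le_lt hV (v := ρ ^ k) (by positivity)
  have hNmono : Monotone N := by
    refine monotone_nat_of_le_succ fun k => ?_
    by_contra hlt
    have h1 := sumSq_mono c (show N (k + 1) + 1 ≤ N k by omega)
    have h2 : ρ ^ k ≤ ρ ^ (k + 1) := pow_le_pow_right₀ hρ1.le k.le_succ
    linarith [hN k, hN' (k + 1)]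
  have hpow := tendsto_pow_atTop_atTop_of_one_lt hρ1
  have hNtop : Tendsto N atTop atTop := by
    refine tendsto_atTop.2 fun b => ?_
    filter_upwards [hpow.eventually_ge_atTop (sumSq c b)] with k hk
    by_contra hlt
    have h1 := sumSq_mono c (show N k + 1 ≤ b by omega)
    linarith [hN' k]
  have hratio : ∀ᶠ v : ℝ in atTop, ∀ j, sumSq c (j + 1) = v → c j ^ 2 ≤ ε / 2 * v := by
    filter_upwards [hK (ε / 2) (by positivity),
      (Real.tendsto_log_atTop.comp Real.tendsto_log_atTop).eventually_ge_atTop 1] with v hv hL j hj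
    simp only [Function.comp_apply] at hL
    have := hv j hj.le
    nlinarith [sq_nonneg (c j)]
  have hratio' : ∀ᶠ k : ℕ in atTop, (1 - ε / 2) * ρ ^ k ≤ sumSq c (N k) := by
    have hT : Tendsto (fun k => sumSq c (N k + 1)) atTop atTop :=
      hV.comp ((tendsto_add_atTop_nat 1).comp hNtop)
    filter_upwards [hT.eventually hratio] with k hk
    have h1 := hk (N k) rfl
    have h2 := sumSq_succ c (N k)
    have h3 := hN' k
    nlinarith
  set E : ℕ → Set Ω := fun k => {ω | (1 - ε / 3) * ((1 - ε) * lilScale (ρ ^ (k + 1))) ≤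
    weightedSum c ζ (N (k + 1)) ω - weightedSum c ζ (N k) ω} with hE
  have hEm : ∀ k, MeasurableSet[ℱ (N (k + 1))] (E k) := by
    intro k
    have h1 := h.stronglyMeasurable_weightedSum c (N (k + 1))
    have h2 := (h.stronglyMeasurable_weightedSum c (N k)).mono (ℱ.mono (hNmono k.le_succ))
    exact measurableSet_le measurable_const (h1.sub h2).measurable
  set r : ℕ → ℝ := fun k => 1 / 2 * (((k + 1 : ℕ) : ℝ) * Real.log ρ)⁻¹ with hr
  have hlogρ : 0 < Real.log ρ := Real.log_pos hρ1
  have hr0 : ∀ k, 0 ≤ r k := fun k => by positivity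
  have hrs : ¬ Summable r := by
    intro hs
    have h1 := hs.mul_left (2 * Real.log ρ)
    have h2 : (fun k : ℕ => 2 * Real.log ρ * r k) = fun k : ℕ => (((k + 1 : ℕ) : ℝ))⁻¹ := by
      ext k; simp only [hr]; field_simp
    rw [h2] at h1
    exact Real.not_summable_natCast_inv ((summable_nat_add_iff 1).1 h1)
  have hcond : ∀ᶠ k in atTop, ∀ A, MeasurableSet[ℱ (N k)] A →
      r k * P.real A ≤ P.real (A ∩ E k) := by
    have hη : 0 < ((ε / 3) ^ 2 / 10) ^ 2 / (8 / (1 - ε) ^ 2 * C ^ 2) := by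
      have : 0 < 1 - ε := by linarith
      positivity
    have hsucc := tendsto_add_atTop_nat 1
    filter_upwards [(hpow.comp hsucc).eventually (hK _ hη),
      (hpow.comp hsucc).eventually (eventually_exp_neg_log_log_le hε (by linarith)),
      hsucc.eventually hratio', ((tendsto_log_log_pow hρ1).comp hsucc).eventually_ge_atTop 0,
      (((Real.tendsto_log_atTop.comp hpow).comp hsucc).eventually_ge_atTop 1)]
      with k hk hlk hVk hL hk1 A hA
    simp only [Function.comp_apply] at hk hlk hL hk1
    have hlogv : Real.log (ρ ^ (k + 1)) = ((k + 1 : ℕ) : ℝ) * Real.log ρ := Real.log_pow _ _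
    simp only [hr]
    rw [← hlogv]
    have hv0 : 0 < ρ ^ (k + 1) := by positivity
    refine h.le_measureReal_increment (hNmono k.le_succ) hA hε (by linarith) hv0 hk1 ?_ ?_ hlk
      fun j hj => hk j (((sumSq_mono c) hj).trans (hN (k + 1)))
    · linarith [sumSq_nonneg c (N k), hN (k + 1)]
    · have h2 : ρ ^ k * 4 ≤ ε * ρ ^ (k + 1) := by
        rw [pow_succ]
        have : 4 ≤ ε * ρ := by
          rw [hρ]
          have : ε * (4 / ε ^ 2) = 4 / ε := by field_simp
          rw [this, le_div_iff₀ hε]; linarith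
        nlinarith [pow_pos hρ0 k]
      have h3 : (1 - ε / 2) * ρ ^ (k + 1) ≤ sumSq c (N (k + 1)) := hVk
      change (1 - ε) * ρ ^ (k + 1) ≤ sumSq c (N (k + 1)) - sumSq c (N k)
      linarith [hN k, mul_pos hε hv0]
  have hBC := ae_frequently_mem_of_le_measureReal_inter ℱ hNmono hEm hr0 hrs hcond
  have hup := h.neg.ae_eventually_weightedSum_le hV hK one_pos
  filter_upwards [hBC, hup] with ω hω hω'
  have hev := hNtop.eventually hω'
  have hL := (tendsto_log_log_pow hρ1).eventually_ge_atTop 0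
  have hL1 := (Real.tendsto_log_atTop.comp hpow).eventually_ge_atTop 1
  have hV1 := (hV.comp hNtop).eventually_ge_atTop 1
  have hV1' := ((hV.comp hNtop).comp (tendsto_add_atTop_nat 1)).eventually_ge_atTop 1
  have hcomb : ∃ᶠ k in atTop, (1 - 3 * ε) * lilScale (sumSq c (N (k + 1))) ≤
      weightedSum c ζ (N (k + 1)) ω := by
    refine (hω.and_eventually (hev.and (hL.and (hL1.and (hV1.and hV1'))))).mono ?_
    rintro k ⟨hk, hk1, hLk, hLk1, hVk, hVk'⟩
    simp only [Function.comp_apply] at hVk hVk' hLk1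
    have hneg : weightedSum c (fun n ω => -ζ n ω) (N k) ω = -weightedSum c ζ (N k) ω := by
      simp [weightedSum]
    rw [hneg] at hk1
    have hvk : 0 < ρ ^ k := by positivity
    have hs1 : lilScale (sumSq c (N k)) ≤ lilScale (ρ ^ k) := lilScale_mono hVk (hN k)
    have hs2 : lilScale (sumSq c (N (k + 1))) ≤ lilScale (ρ ^ (k + 1)) :=
      lilScale_mono hVk' (hN (k + 1))
    have hvv : ρ ^ (k + 1) = ρ ^ k * ρ := pow_succ _ _
    have hLL : Real.log (Real.log (ρ ^ k)) ≤ Real.log (Real.log (ρ ^ (k + 1))) :=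
      Real.log_le_log (by linarith) (Real.log_le_log hvk (by rw [hvv]; nlinarith))
    have hs3 : 2 * lilScale (ρ ^ k) ≤ ε * lilScale (ρ ^ (k + 1)) := by
      refine le_of_sq_le_sq ?_ (mul_nonneg hε.le (lilScale_nonneg _))
      rw [mul_pow, mul_pow, lilScale_sq hvk.le hLk,
        lilScale_sq (by positivity) (hLk.trans hLL), hvv]
      calc 2 ^ 2 * (2 * ρ ^ k * Real.log (Real.log (ρ ^ k)))
          = 4 * (2 * ρ ^ k * Real.log (Real.log (ρ ^ k))) := by ring
        _ ≤ 4 * (2 * ρ ^ k * Real.log (Real.log (ρ ^ (k + 1)))) := by gcongr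
        _ = (ρ * ε ^ 2) * (2 * ρ ^ k * Real.log (Real.log (ρ ^ (k + 1)))) := by rw [hρε]
        _ = _ := by rw [hvv]; ring
    have hk' : (1 - ε / 3) * ((1 - ε) * lilScale (ρ ^ (k + 1))) ≤
      weightedSum c ζ (N (k + 1)) ω - weightedSum c ζ (N k) ω := hk
    set F := lilScale (ρ ^ (k + 1)) with hF
    have hF0 : 0 ≤ F := lilScale_nonneg _
    have h4 : (1 - 2 * ε) * F ≤ (1 - ε / 3) * ((1 - ε) * F) := by
      rw [← mul_assoc]
      refine mul_le_mul_of_nonneg_right ?_ hF0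
      nlinarith
    have h5 : (1 - 3 * ε) * lilScale (sumSq c (N (k + 1))) ≤ (1 - 3 * ε) * F :=
      mul_le_mul_of_nonneg_left hs2 (by linarith)
    linarith
  exact (hNtop.comp (tendsto_add_atTop_nat 1)).frequently hcomb

end IsNormalizedDiff

lemma limsup_eq_of_forall_pos {f : ℕ → ℝ} {c : ℝ}
    (hu : ∀ ε > 0, ∀ᶠ n in atTop, f n ≤ c + ε) (hl : ∀ ε > 0, ∃ᶠ n in atTop, c - ε ≤ f n) :
    limsup f atTop = c := by
  have hb : IsBoundedUnder (· ≤ ·) atTop f := ⟨c + 1, eventually_map.2 (hu 1 one_pos)⟩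
  have hcb : IsCoboundedUnder (· ≤ ·) atTop f :=
    IsCoboundedUnder.of_frequently_ge (hl 1 one_pos)
  refine le_antisymm (le_of_forall_pos_le_add fun ε hε => limsup_le_of_le hcb (hu ε hε))
    (le_of_forall_pos_le_add fun ε hε => ?_)
  linarith [le_limsup_of_frequently_le (hl ε hε) hb]

/-- If `M` oscillates up to order `L`, then `a * M`, perturbed by `o(L)`, oscillates up to `a * r`
relative to any scale `w` with `L / w → r`. -/
lemma limsup_div_eq_of_oscillation {M L w D : ℕ → ℝ} {a r : ℝ} (ha : 0 < a) (hr : 0 < r)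
    (hu : ∀ ε > 0, ∀ᶠ n in atTop, M n ≤ (1 + ε) * L n)
    (hl : ∀ ε > 0, ∃ᶠ n in atTop, (1 - ε) * L n ≤ M n)
    (hL : ∀ᶠ n in atTop, 0 < L n)
    (hD : Tendsto (fun n => (D n - a * M n) / L n) atTop (nhds 0))
    (hLw : Tendsto (fun n => L n / w n) atTop (nhds r)) :
    limsup (fun n => D n / w n) atTop = a * r := by
  have hlim : ∀ δ : ℝ, Tendsto (fun n => L n / w n * (a * (1 + δ) + (D n - a * M n) / L n)) atTop
      (nhds (a * r + a * r * δ)) := fun δ => by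
    have := hLw.mul (hD.const_add (a * (1 + δ)))
    rwa [add_zero, show r * (a * (1 + δ)) = a * r + a * r * δ by ring] at this
  have hid : ∀ᶠ n in atTop, 0 < L n / w n ∧
      D n / w n = L n / w n * (a * (M n / L n) + (D n - a * M n) / L n) := by
    filter_upwards [hL, hLw.eventually_const_lt hr] with n hn hn'
    refine ⟨hn', ?_⟩
    have hw : w n ≠ 0 := fun h => by simp [h] at hn'
    field_simp
    ring
  have hcancel : ∀ ε : ℝ, a * r * (ε / (2 * (a * r))) = ε / 2 := fun ε => by field_simp
  refine limsup_eq_of_forall_pos (fun ε hε => ?_) fun ε hε => ?_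
  · have hδ : 0 < ε / (2 * (a * r)) := by positivity
    have h1 := (hlim (ε / (2 * (a * r)))).eventually_lt_const
      (show _ < a * r + ε by rw [hcancel]; linarith)
    filter_upwards [h1, hid, hL, hu _ hδ] with n h1 hid hL hu
    rw [hid.2]
    refine le_trans ?_ h1.le
    have := (div_le_iff₀ hL).2 hu
    have h0 := hid.1.le
    gcongr
  · have hδ : 0 < ε / (2 * (a * r)) := by positivity
    have h1 := (hlim (-(ε / (2 * (a * r))))).eventually_const_lt
      (show a * r - ε < _ by rw [mul_neg, hcancel]; linarith)
    refine ((hl _ hδ).and_eventually (h1.and (hid.and hL))).mono ?_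
    rintro n ⟨hl, h1, hid, hL⟩
    rw [hid.2]
    refine h1.le.trans ?_
    have := (le_div_iff₀ hL).2 hl
    rw [← sub_eq_add_neg]
    have h0 := hid.1.le
    gcongr

lemma tendsto_lilScale_atTop : Tendsto lilScale atTop atTop := by
  have h : Tendsto (fun v : ℝ => Real.log (Real.log v)) atTop atTop :=
    Real.tendsto_log_atTop.comp Real.tendsto_log_atTop
  exact Real.tendsto_sqrt_atTop.comp
    (((tendsto_id.const_mul_atTop two_pos).atTop_mul_atTop₀ h))

namespace IsNormalizedDiff

variable {Ω : Type*} {m : MeasurableSpace Ω} {P : Measure Ω} [IsProbabilityMeasure P]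
  {ℱ : Filtration ℕ m} {ζ : ℕ → Ω → ℝ} {C : ℝ} {c : ℕ → ℝ}

/-- The law of the iterated logarithm for weighted sums of normalized martingale differences. -/
theorem ae_forall_oscillation (h : IsNormalizedDiff P ℱ ζ C)
    (hV : Tendsto (sumSq c) atTop atTop) (hK : KolmogorovCondition c) :
    ∀ᵐ ω ∂P,
      (∀ ε > 0, ∀ᶠ n in atTop, weightedSum c ζ n ω ≤ (1 + ε) * lilScale (sumSq c n)) ∧
      ∀ ε > 0, ∃ᶠ n in atTop, (1 - ε) * lilScale (sumSq c n) ≤ weightedSum c ζ n ω := by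
  have hpos : ∀ k : ℕ, (0 : ℝ) < 1 / (3 * ((k : ℝ) + 1)) := fun k => by positivity
  have h1 : ∀ᵐ ω ∂P, ∀ k : ℕ, ∀ᶠ n in atTop,
      weightedSum c ζ n ω ≤ (1 + 1 / (3 * ((k : ℝ) + 1))) * lilScale (sumSq c n) :=
    ae_all_iff.2 fun k => h.ae_eventually_weightedSum_le hV hK (hpos k)
  have h2 : ∀ᵐ ω ∂P, ∀ k : ℕ, ∃ᶠ n in atTop,
      (1 - 3 * (1 / (3 * ((k : ℝ) + 1)))) * lilScale (sumSq c n) ≤ weightedSum c ζ n ω :=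
    ae_all_iff.2 fun k => h.ae_frequently_le_weightedSum hV hK (hpos k) (by
      rw [div_le_div_iff₀ (by positivity) (by norm_num)]
      linarith [k.cast_nonneg (α := ℝ)])
  filter_upwards [h1, h2] with ω h1 h2
  have key : ∀ ε > (0 : ℝ), ∃ k : ℕ, 3 * (1 / (3 * ((k : ℝ) + 1))) ≤ ε := fun ε hε => by
    obtain ⟨k, hk⟩ := exists_nat_one_div_lt hε
    refine ⟨k, le_trans (le_of_eq ?_) hk.le⟩
    field_simp
  refine ⟨fun ε hε => ?_, fun ε hε => ?_⟩
  · obtain ⟨k, hk⟩ := key ε hε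
    filter_upwards [h1 k] with n hn
    refine hn.trans ?_
    have := lilScale_nonneg (sumSq c n)
    have := hpos k
    gcongr
    linarith
  · obtain ⟨k, hk⟩ := key ε hε
    refine (h2 k).mono fun n hn => le_trans ?_ hn
    have := lilScale_nonneg (sumSq c n)
    gcongr

end IsNormalizedDiff

/-- Sequences of signs agreeing with `ε` up to time `n`. -/
def signCylinder (n : ℕ) (ε : ℕ → ℤ) : Set (ℕ → ℤ) := {x | ∀ i ≤ n, x i = ε i}

lemma measurableSet_signCylinder (n : ℕ) (ε : ℕ → ℤ) : MeasurableSet (signCylinder n ε) := by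
  have : signCylinder n ε = ⋂ i ∈ Set.Iic n, (fun x : ℕ → ℤ => x i) ⁻¹' {ε i} := by
    ext x; simp [signCylinder]
  rw [this]
  exact MeasurableSet.biInter (Set.to_countable _) fun i _ =>
    measurable_pi_apply i (measurableSet_singleton _)

namespace IsERW

variable {Ω : Type*} [MeasurableSpace Ω] {P : Measure Ω} {p q : ℝ}
  {X : ℕ → Ω → ℤ}

lemma measurable_path (hX : IsERW P p q X) : Measurable fun ω n => X n ω :=
  measurable_pi_iff.2 hX.1

lemma measureReal_signCylinder_succ (hX : IsERW P p q X) (n : ℕ) {ε : ℕ → ℤ}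
    (hε : ∀ i, ε i = 1 ∨ ε i = -1) {x : ℤ} (hx : x = 1 ∨ x = -1) :
    P.real {ω | (∀ i ≤ n, X i ω = ε i) ∧ X (n + 1) ω = x} =
      P.real {ω | ∀ i ≤ n, X i ω = ε i} * ((1 : ℝ) / (n + 1) *
        ∑ i ∈ Finset.range (n + 1), (p * (if ε i = x then 1 else 0) +
          (1 - p) * (if ε i = -x then 1 else 0))) := by
  set ε' : ℕ → ℤ := Function.update ε (n + 1) x with hε'
  have hlt : ∀ i ≤ n, ε' i = ε i := fun i hi => Function.update_of_ne (by omega) _ _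
  have hlast : ε' (n + 1) = x := Function.update_self _ _ _
  have hpm : ∀ i, ε' i = 1 ∨ ε' i = -1 := fun i => by
    rcases eq_or_ne i (n + 1) with rfl | hi
    · rw [hlast]; exact hx
    · rw [hε', Function.update_of_ne hi]; exact hε i
  have hset : {ω | (∀ i ≤ n, X i ω = ε i) ∧ X (n + 1) ω = x} =
      {ω | ∀ i ≤ n + 1, X i ω = ε' i} := by
    ext ω
    constructor
    · rintro ⟨h1, h2⟩ i hi
      rcases Nat.le_succ_iff.1 hi with hi | rfl
      · rw [hlt i hi, h1 i hi]
      · rw [h2, hlast]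
    · intro h
      exact ⟨fun i hi => by rw [h i (by omega), hlt i hi], by rw [h _ le_rfl, hlast]⟩
  have hset' : {ω | ∀ i ≤ n, X i ω = ε i} = {ω | ∀ i ≤ n, X i ω = ε' i} := by
    ext ω
    exact forall₂_congr fun i hi => by rw [hlt i hi]
  rw [hset, hset', Measure.real, Measure.real, hX.2.2 (n + 1) ε' hpm, hX.2.2 n ε' hpm,
    Finset.prod_range_succ, ← mul_assoc, hlast]
  congr 2
  refine Finset.sum_congr rfl fun i hi => ?_
  rw [hlt i (by simpa [Nat.lt_succ_iff] using hi)]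

/-- On each sign cylinder the next step has conditional mean `(2 p - 1) / (n + 1)` times the current
position. -/
lemma integral_indicator_signCylinder_step [IsFiniteMeasure P] (hX : IsERW P p q X) (n : ℕ)
    {ε : ℕ → ℤ} (hε : ∀ i, ε i = 1 ∨ ε i = -1) :
    ∫ ω, (signCylinder n ε).indicator (fun x => (x (n + 1) : ℝ)) (fun i => X i ω) ∂P =
      ∫ ω, (signCylinder n ε).indicator (fun x => (2 * p - 1) / (n + 1) *
        ∑ i ∈ Finset.range (n + 1), (x i : ℝ)) (fun i => X i ω) ∂P := by
  have hA : MeasurableSet {ω | ∀ i ≤ n, X i ω = ε i} :=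
    hX.measurable_path (measurableSet_signCylinder n ε)
  have hAx : ∀ x, MeasurableSet {ω | (∀ i ≤ n, X i ω = ε i) ∧ X (n + 1) ω = x} := fun x =>
    hA.inter (hX.1 (n + 1) (measurableSet_singleton x))
  have h1 : ∀ ω, (signCylinder n ε).indicator (fun x => (x (n + 1) : ℝ)) (fun i => X i ω) =
      {ω | (∀ i ≤ n, X i ω = ε i) ∧ X (n + 1) ω = 1}.indicator (fun _ => (1 : ℝ)) ω -
      {ω | (∀ i ≤ n, X i ω = ε i) ∧ X (n + 1) ω = -1}.indicator (fun _ => (1 : ℝ)) ω := by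
    intro ω
    by_cases h : ∀ i ≤ n, X i ω = ε i
    · rw [Set.indicator_of_mem (show (fun i => X i ω) ∈ signCylinder n ε from h)]
      rcases hX.2.1 (n + 1) ω with h' | h' <;> simpa [Set.indicator, h'] using h
    · rw [Set.indicator_of_notMem (show (fun i => X i ω) ∉ signCylinder n ε from h)]
      simp [Set.indicator, h]
  have h2 : ∀ ω, (signCylinder n ε).indicator (fun x => (2 * p - 1) / (n + 1) *
        ∑ i ∈ Finset.range (n + 1), (x i : ℝ)) (fun i => X i ω) =
      {ω | ∀ i ≤ n, X i ω = ε i}.indicator (fun _ => (2 * p - 1) / (n + 1) *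
        ∑ i ∈ Finset.range (n + 1), (ε i : ℝ)) ω := by
    intro ω
    by_cases h : ∀ i ≤ n, X i ω = ε i
    · rw [Set.indicator_of_mem (show (fun i => X i ω) ∈ signCylinder n ε from h),
        Set.indicator_of_mem (show ω ∈ {ω | ∀ i ≤ n, X i ω = ε i} from h)]
      congr 1
      refine Finset.sum_congr rfl fun i hi => ?_
      exact congrArg _ (h i (by simpa [Nat.lt_succ_iff] using hi))
    · rw [Set.indicator_of_notMem (show (fun i => X i ω) ∉ signCylinder n ε from h),
        Set.indicator_of_notMem (show ω ∉ {ω | ∀ i ≤ n, X i ω = ε i} from h)]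
  simp_rw [h1, h2]
  rw [integral_sub ((integrable_const _).indicator (hAx _))
      ((integrable_const _).indicator (hAx _)),
    integral_indicator_const _ (hAx _), integral_indicator_const _ (hAx _),
    integral_indicator_const _ hA, hX.measureReal_signCylinder_succ n hε (Or.inl rfl),
    hX.measureReal_signCylinder_succ n hε (Or.inr rfl)]
  simp only [smul_eq_mul, mul_one]
  rw [← mul_sub, ← mul_sub, ← Finset.sum_sub_distrib]
  congr 1
  rw [Finset.sum_congr rfl fun i _ => show _ = (2 * p - 1) * (ε i : ℝ) by
    rcases hε i with h | h <;> simp [h] <;> ring, ← Finset.mul_sum]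
  ring

end IsERW

/-- The filtration of the first `n + 1` terms of a sequence of random variables. -/
def pathFiltration {Ω : Type*} [MeasurableSpace Ω] (Z : ℕ → Ω → ℤ × ℤ)
    (hZ : ∀ n, Measurable (Z n)) : Filtration ℕ ‹MeasurableSpace Ω› where
  seq n := MeasurableSpace.comap (fun ω (i : Fin (n + 1)) => Z i ω) inferInstance
  mono' := by
    intro n k hnk
    refine Measurable.comap_le ?_
    refine @measurable_pi_lambda _ _ _ (_) _ _ fun i => ?_
    have h := @comap_measurable Ω (Fin (k + 1) → ℤ × ℤ) inferInstance fun ω i => Z i ω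
    exact (measurable_pi_apply (⟨i, by omega⟩ : Fin (k + 1))).comp h
  le' n := Measurable.comap_le (measurable_pi_iff.2 fun i => hZ i)

lemma measurable_pathFiltration {Ω : Type*} [MeasurableSpace Ω] (Z : ℕ → Ω → ℤ × ℤ)
    (hZ : ∀ n, Measurable (Z n)) {i n : ℕ} (hi : i ≤ n) :
    Measurable[pathFiltration Z hZ n] (Z i) := by
  have h := @comap_measurable Ω (Fin (n + 1) → ℤ × ℤ) inferInstance fun ω i => Z i ω
  exact (measurable_pi_apply (⟨i, by omega⟩ : Fin (n + 1))).comp h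

/-- Identities between conditional expectations given the first `n + 1` steps of two independent
sequences of signs factorize and can be checked on cylinders. -/
lemma integral_mul_eq_of_signCylinder {Ω : Type*} [MeasurableSpace Ω] {P : Measure Ω}
    [IsProbabilityMeasure P] {X X' : ℕ → Ω → ℤ} (hX : ∀ n, Measurable (X n))
    (hX' : ∀ n, Measurable (X' n)) (hX1 : ∀ n ω, X n ω = 1 ∨ X n ω = -1)
    (hX'1 : ∀ n ω, X' n ω = 1 ∨ X' n ω = -1)
    (hindep : IndepFun (fun ω n => X n ω) (fun ω n => X' n ω) P) (n : ℕ)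
    {U W U' W' : (ℕ → ℤ) → ℝ} (hU : Measurable U) (hW : Measurable W) (hU' : Measurable U')
    (hW' : Measurable W')
    (hUb : ∃ K, ∀ ω, |U (fun i => X i ω)| ≤ K) (hWb : ∃ K, ∀ ω, |W (fun i => X i ω)| ≤ K)
    (hUb' : ∃ K, ∀ ω, |U' (fun i => X' i ω)| ≤ K) (hWb' : ∃ K, ∀ ω, |W' (fun i => X' i ω)| ≤ K)
    (h : ∀ ε : ℕ → ℤ, (∀ i, ε i = 1 ∨ ε i = -1) →
      ∫ ω, (signCylinder n ε).indicator U (fun i => X i ω) ∂P =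
      ∫ ω, (signCylinder n ε).indicator W (fun i => X i ω) ∂P)
    (h' : ∀ ε : ℕ → ℤ, (∀ i, ε i = 1 ∨ ε i = -1) →
      ∫ ω, (signCylinder n ε).indicator U' (fun i => X' i ω) ∂P =
      ∫ ω, (signCylinder n ε).indicator W' (fun i => X' i ω) ∂P)
    {Y : Ω → ℝ} (hY : StronglyMeasurable[pathFiltration (fun i ω => (X i ω, X' i ω))
      (fun i => (hX i).prodMk (hX' i)) n] Y) :
    ∫ ω, Y ω * (U (fun i => X i ω) * U' (fun i => X' i ω)) ∂P =
      ∫ ω, Y ω * (W (fun i => X i ω) * W' (fun i => X' i ω)) ∂P := by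
  classical
  have mX : Measurable fun ω n => X n ω := measurable_pi_iff.2 hX
  have mX' : Measurable fun ω n => X' n ω := measurable_pi_iff.2 hX'
  obtain ⟨φ, -, rfl⟩ := hY.exists_eq_measurable_comp
  set F : Finset (Fin (n + 1) → ℤ × ℤ) :=
    Fintype.piFinset fun _ => ({1, -1} : Finset ℤ) ×ˢ ({1, -1} : Finset ℤ) with hF
  set e : (Fin (n + 1) → ℤ × ℤ) → ℕ → ℤ := fun a i =>
    if hi : i < n + 1 then (a ⟨i, hi⟩).1 else 1 with he
  set e' : (Fin (n + 1) → ℤ × ℤ) → ℕ → ℤ := fun a i =>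
    if hi : i < n + 1 then (a ⟨i, hi⟩).2 else 1 with he'
  have heF : ∀ a ∈ F, ∀ i, e a i = 1 ∨ e a i = -1 := fun a ha i => by
    simp only [he]
    split_ifs with hi
    · have := Fintype.mem_piFinset.1 ha ⟨i, hi⟩
      simpa using (Finset.mem_product.1 this).1
    · exact Or.inl rfl
  have heF' : ∀ a ∈ F, ∀ i, e' a i = 1 ∨ e' a i = -1 := fun a ha i => by
    simp only [he']
    split_ifs with hi
    · have := Fintype.mem_piFinset.1 ha ⟨i, hi⟩
      simpa using (Finset.mem_product.1 this).2
    · exact Or.inl rfl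
  have decomp : ∀ G G' : (ℕ → ℤ) → ℝ, ∀ ω,
      φ (fun i : Fin (n + 1) => (X i ω, X' i ω)) * (G (fun i => X i ω) * G' (fun i => X' i ω)) =
      ∑ a ∈ F, φ a * ((signCylinder n (e a)).indicator G (fun i => X i ω) *
        (signCylinder n (e' a)).indicator G' (fun i => X' i ω)) := by
    intro G G' ω
    have hmem : (fun i : Fin (n + 1) => (X i ω, X' i ω)) ∈ F := by
      refine Fintype.mem_piFinset.2 fun i => Finset.mem_product.2 ⟨?_, ?_⟩
      · simpa using hX1 i ω
      · simpa using hX'1 i ω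
    rw [Finset.sum_eq_single_of_mem _ hmem]
    · rw [Set.indicator_of_mem, Set.indicator_of_mem]
      · intro i hi; simp only [he']; rw [dif_pos (Nat.lt_succ_iff.2 hi)]
      · intro i hi; simp only [he]; rw [dif_pos (Nat.lt_succ_iff.2 hi)]
    · intro a _ hne
      by_cases h1 : (fun i => X i ω) ∈ signCylinder n (e a)
      · by_cases h2 : (fun i => X' i ω) ∈ signCylinder n (e' a)
        · refine absurd ?_ hne
          funext i
          have hi := h1 i (Nat.lt_succ_iff.1 i.2)
          have hi' := h2 i (Nat.lt_succ_iff.1 i.2)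
          simp only [he, he', i.2, dif_pos, Fin.eta] at hi hi'
          exact Prod.ext hi.symm hi'.symm
        · rw [Set.indicator_of_notMem h2, mul_zero, mul_zero]
      · rw [Set.indicator_of_notMem h1, zero_mul, mul_zero]
  have meas : ∀ {Z : ℕ → Ω → ℤ} {G : (ℕ → ℤ) → ℝ} (ε : ℕ → ℤ), Measurable (fun ω n => Z n ω) →
      Measurable G → Measurable fun ω => (signCylinder n ε).indicator G (fun i => Z i ω) :=
    fun ε hZ hG => (hG.indicator (measurableSet_signCylinder n ε)).comp hZ
  have bdd : ∀ {Z : ℕ → Ω → ℤ} {G : (ℕ → ℤ) → ℝ} {K : ℝ} (ε : ℕ → ℤ),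
      (∀ ω, |G (fun i => Z i ω)| ≤ K) →
      ∀ ω, ‖(signCylinder n ε).indicator G (fun i => Z i ω)‖ ≤ K := fun ε hK ω => by
    refine (norm_indicator_le_norm_self _ _).trans ?_
    exact hK ω
  have int : ∀ {G G' : (ℕ → ℤ) → ℝ}, Measurable G → Measurable G' →
      (∃ K, ∀ ω, |G (fun i => X i ω)| ≤ K) → (∃ K, ∀ ω, |G' (fun i => X' i ω)| ≤ K) →
      ∀ a, Integrable (fun ω => (signCylinder n (e a)).indicator G (fun i => X i ω) *
        (signCylinder n (e' a)).indicator G' (fun i => X' i ω)) P := by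
    rintro G G' hG hG' ⟨K, hK⟩ ⟨K', hK'⟩ a
    refine Integrable.of_bound ((meas _ mX hG).mul (meas _ mX' hG')).aestronglyMeasurable
      (K * K') (ae_of_all _ fun ω => ?_)
    rw [norm_mul]
    exact mul_le_mul (bdd _ hK ω) (bdd _ hK' ω) (norm_nonneg _)
      ((norm_nonneg _).trans (bdd (e a) hK ω))
  have fact : ∀ {G G' : (ℕ → ℤ) → ℝ}, Measurable G → Measurable G' → ∀ a,
      ∫ ω, (signCylinder n (e a)).indicator G (fun i => X i ω) *
        (signCylinder n (e' a)).indicator G' (fun i => X' i ω) ∂P =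
      (∫ ω, (signCylinder n (e a)).indicator G (fun i => X i ω) ∂P) *
        ∫ ω, (signCylinder n (e' a)).indicator G' (fun i => X' i ω) ∂P := fun hG hG' a =>
    (hindep.comp (hG.indicator (measurableSet_signCylinder n (e a)))
      (hG'.indicator (measurableSet_signCylinder n (e' a)))).integral_fun_mul_eq_mul_integral
      (meas _ mX hG).aestronglyMeasurable (meas _ mX' hG').aestronglyMeasurable
  simp only [Function.comp_apply, decomp]
  rw [integral_finsetSum _ fun a _ => (int hU hU' hUb hUb' a).const_mul _,
    integral_finsetSum _ fun a _ => (int hW hW' hWb hWb' a).const_mul _]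
  refine Finset.sum_congr rfl fun a ha => ?_
  rw [integral_const_mul, integral_const_mul, fact hU hU', fact hW hW', h _ (heF a ha),
    h' _ (heF' a ha)]

/-- The position after `n` steps. -/
def position {Ω : Type*} (X : ℕ → Ω → ℤ) (n : ℕ) (ω : Ω) : ℝ := ∑ i ∈ Finset.range n, (X i ω : ℝ)

lemma position_succ {Ω : Type*} (X : ℕ → Ω → ℤ) (n : ℕ) (ω : Ω) :
    position X (n + 1) ω = position X n ω + X n ω := Finset.sum_range_succ _ _

/-- The conditional variance of the increment of `S - S'` after its martingale centering. -/
def diffVar {Ω : Type*} (α : ℝ) (X X' : ℕ → Ω → ℤ) (n : ℕ) (ω : Ω) : ℝ :=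
  2 - (α / (n + 1)) ^ 2 * (position X (n + 1) ω ^ 2 + position X' (n + 1) ω ^ 2)

/-- The centered and normalized increments of the difference of two elephant random walks. -/
def normDiff {Ω : Type*} (α : ℝ) (X X' : ℕ → Ω → ℤ) (n : ℕ) (ω : Ω) : ℝ :=
  (X (n + 1) ω - X' (n + 1) ω - α / (n + 1) * (position X (n + 1) ω - position X' (n + 1) ω)) /
    √(diffVar α X X' n ω)

namespace IsERW

variable {Ω : Type*} [MeasurableSpace Ω] {P : Measure Ω} {p q q' : ℝ} {X X' : ℕ → Ω → ℤ}

lemma abs_step (hX : IsERW P p q X) (n : ℕ) (ω : Ω) : |(X n ω : ℝ)| = 1 := by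
  rcases hX.2.1 n ω with h | h <;> simp [h]

lemma abs_position_le (hX : IsERW P p q X) (n : ℕ) (ω : Ω) : |position X n ω| ≤ n := by
  refine (Finset.abs_sum_le_sum_abs _ _).trans ?_
  simp [hX.abs_step]

lemma measurable_step (hX : IsERW P p q X) (n : ℕ) : Measurable fun ω => (X n ω : ℝ) :=
  measurable_from_top.comp (hX.1 n)

lemma measurable_position (hX : IsERW P p q X) (n : ℕ) : Measurable (position X n) :=
  Finset.measurable_fun_sum _ fun i _ => hX.measurable_step i

/-- The joint history of two elephant random walks. -/
abbrev history (hX : IsERW P p q X) (hX' : IsERW P p q' X') : Filtration ℕ ‹MeasurableSpace Ω› :=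
  pathFiltration (fun i ω => (X i ω, X' i ω)) fun i => (hX.1 i).prodMk (hX'.1 i)

lemma stronglyMeasurable_step_fst (hX : IsERW P p q X) (hX' : IsERW P p q' X') {i n : ℕ}
    (hi : i ≤ n) : StronglyMeasurable[history hX hX' n] fun ω => (X i ω : ℝ) :=
  Measurable.stronglyMeasurable ((measurable_from_top (f := fun z : ℤ => (z : ℝ))).comp
    (measurable_fst.comp (measurable_pathFiltration _ _ hi)))

lemma stronglyMeasurable_step_snd (hX : IsERW P p q X) (hX' : IsERW P p q' X') {i n : ℕ}
    (hi : i ≤ n) : StronglyMeasurable[history hX hX' n] fun ω => (X' i ω : ℝ) :=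
  Measurable.stronglyMeasurable ((measurable_from_top (f := fun z : ℤ => (z : ℝ))).comp
    (measurable_snd.comp (measurable_pathFiltration _ _ hi)))

lemma stronglyMeasurable_position_fst (hX : IsERW P p q X) (hX' : IsERW P p q' X') {k n : ℕ}
    (hk : k ≤ n + 1) : StronglyMeasurable[history hX hX' n] (position X k) :=
  Finset.stronglyMeasurable_fun_sum _ fun i hi =>
    stronglyMeasurable_step_fst hX hX' (by have := Finset.mem_range.1 hi; omega)

lemma stronglyMeasurable_position_snd (hX : IsERW P p q X) (hX' : IsERW P p q' X') {k n : ℕ}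
    (hk : k ≤ n + 1) : StronglyMeasurable[history hX hX' n] (position X' k) :=
  Finset.stronglyMeasurable_fun_sum _ fun i hi =>
    stronglyMeasurable_step_snd hX hX' (by have := Finset.mem_range.1 hi; omega)

lemma measurable_path_step (n : ℕ) : Measurable fun x : ℕ → ℤ => (x n : ℝ) :=
  measurable_from_top.comp (measurable_pi_apply n)

lemma measurable_path_drift (a : ℝ) (n : ℕ) :
    Measurable fun x : ℕ → ℤ => a * ∑ i ∈ Finset.range n, (x i : ℝ) :=
  (Finset.measurable_fun_sum _ fun i _ => measurable_path_step i).const_mul a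

lemma abs_drift_le (hX : IsERW P p q X) (a : ℝ) (n : ℕ) (ω : Ω) :
    |a * position X n ω| ≤ |a| * n := by
  rw [abs_mul]
  exact mul_le_mul_of_nonneg_left (hX.abs_position_le n ω) (abs_nonneg a)

variable [IsProbabilityMeasure P]

lemma integral_mul_step_fst (hX : IsERW P p q X) (hX' : IsERW P p q' X')
    (hindep : IndepFun (fun ω n => X n ω) (fun ω n => X' n ω) P) (n : ℕ) {Y : Ω → ℝ}
    (hY : StronglyMeasurable[history hX hX' n] Y) :
    ∫ ω, Y ω * X (n + 1) ω ∂P =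
      ∫ ω, Y ω * ((2 * p - 1) / (n + 1) * position X (n + 1) ω) ∂P := by
  simpa [position] using integral_mul_eq_of_signCylinder hX.1 hX'.1 hX.2.1 hX'.2.1 hindep n
    (U' := fun _ => 1) (W' := fun _ => 1)
    (measurable_path_step (n + 1)) (measurable_path_drift _ (n + 1)) measurable_const
    measurable_const ⟨1, fun ω => (hX.abs_step _ ω).le⟩ ⟨_, fun ω => hX.abs_drift_le _ _ ω⟩
    ⟨1, by simp⟩ ⟨1, by simp⟩ (fun _ hε => hX.integral_indicator_signCylinder_step n hε)
    (fun _ _ => rfl) hY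

lemma integral_mul_step_snd (hX : IsERW P p q X) (hX' : IsERW P p q' X')
    (hindep : IndepFun (fun ω n => X n ω) (fun ω n => X' n ω) P) (n : ℕ) {Y : Ω → ℝ}
    (hY : StronglyMeasurable[history hX hX' n] Y) :
    ∫ ω, Y ω * X' (n + 1) ω ∂P =
      ∫ ω, Y ω * ((2 * p - 1) / (n + 1) * position X' (n + 1) ω) ∂P := by
  simpa [position] using integral_mul_eq_of_signCylinder hX.1 hX'.1 hX.2.1 hX'.2.1 hindep n
    (U := fun _ => 1) (W := fun _ => 1) measurable_const measurable_const
    (measurable_path_step (n + 1)) (measurable_path_drift _ (n + 1)) ⟨1, by simp⟩ ⟨1, by simp⟩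
    ⟨1, fun ω => (hX'.abs_step _ ω).le⟩ ⟨_, fun ω => hX'.abs_drift_le _ _ ω⟩
    (fun _ _ => rfl) (fun _ hε => hX'.integral_indicator_signCylinder_step n hε) hY

lemma integral_mul_step_mul_step (hX : IsERW P p q X) (hX' : IsERW P p q' X')
    (hindep : IndepFun (fun ω n => X n ω) (fun ω n => X' n ω) P) (n : ℕ) {Y : Ω → ℝ}
    (hY : StronglyMeasurable[history hX hX' n] Y) :
    ∫ ω, Y ω * (X (n + 1) ω * X' (n + 1) ω) ∂P =
      ∫ ω, Y ω * (((2 * p - 1) / (n + 1) * position X (n + 1) ω) *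
        ((2 * p - 1) / (n + 1) * position X' (n + 1) ω)) ∂P :=
  integral_mul_eq_of_signCylinder hX.1 hX'.1 hX.2.1 hX'.2.1 hindep n
    (measurable_path_step (n + 1)) (measurable_path_drift _ (n + 1))
    (measurable_path_step (n + 1)) (measurable_path_drift _ (n + 1))
    ⟨1, fun ω => (hX.abs_step _ ω).le⟩ ⟨_, fun ω => hX.abs_drift_le _ _ ω⟩
    ⟨1, fun ω => (hX'.abs_step _ ω).le⟩ ⟨_, fun ω => hX'.abs_drift_le _ _ ω⟩
    (fun _ hε => hX.integral_indicator_signCylinder_step n hε)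
    (fun _ hε => hX'.integral_indicator_signCylinder_step n hε) hY

end IsERW

namespace IsERW

variable {Ω : Type*} [MeasurableSpace Ω] {P : Measure Ω} {p q q' : ℝ} {X X' : ℕ → Ω → ℤ}

lemma sq_drift_le (hX : IsERW P p q X) (α : ℝ) (n : ℕ) (ω : Ω) :
    (α / (n + 1)) ^ 2 * position X (n + 1) ω ^ 2 ≤ α ^ 2 := by
  have h := sq_le_sq' (abs_le.1 (hX.abs_position_le (n + 1) ω)).1
    (abs_le.1 (hX.abs_position_le (n + 1) ω)).2
  push_cast at h
  have hn : (0 : ℝ) < ((n : ℝ) + 1) ^ 2 := by positivity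
  rw [div_pow, div_mul_eq_mul_div, div_le_iff₀ hn]
  exact mul_le_mul_of_nonneg_left h (sq_nonneg α)

lemma le_diffVar (hX : IsERW P p q X) (hX' : IsERW P p q' X') (α : ℝ) (n : ℕ) (ω : Ω) :
    2 * (1 - α ^ 2) ≤ diffVar α X X' n ω := by
  have h1 := hX.sq_drift_le α n ω
  have h2 := hX'.sq_drift_le α n ω
  rw [diffVar, mul_add]
  linarith

lemma stronglyMeasurable_diffVar (hX : IsERW P p q X) (hX' : IsERW P p q' X') (α : ℝ) (n : ℕ) :
    StronglyMeasurable[history hX hX' n] (diffVar α X X' n) :=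
  stronglyMeasurable_const.sub
    ((((stronglyMeasurable_position_fst hX hX' le_rfl).pow 2).add
      ((stronglyMeasurable_position_snd hX hX' le_rfl).pow 2)).const_mul _)

lemma stronglyMeasurable_sqrt_diffVar (hX : IsERW P p q X) (hX' : IsERW P p q' X') (α : ℝ)
    (n : ℕ) : StronglyMeasurable[history hX hX' n] fun ω => √(diffVar α X X' n ω) :=
  Real.continuous_sqrt.comp_stronglyMeasurable (stronglyMeasurable_diffVar hX hX' α n)

lemma integral_sub_eq_zero_of_eq {f g : Ω → ℝ} (hf : Integrable f P) (hg : Integrable g P)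
    (h : ∫ ω, f ω ∂P = ∫ ω, g ω ∂P) : ∫ ω, (f ω - g ω) ∂P = 0 := by
  rw [integral_sub hf hg, h, sub_self]

variable [IsProbabilityMeasure P]

theorem isNormalizedDiff (hX : IsERW P p q X) (hX' : IsERW P p q' X')
    (hindep : IndepFun (fun ω n => X n ω) (fun ω n => X' n ω) P) (hp : |2 * p - 1| < 1) :
    IsNormalizedDiff P (history hX hX') (normDiff (2 * p - 1) X X')
      (max 1 (4 / √(2 * (1 - (2 * p - 1) ^ 2)))) := by
  set α := 2 * p - 1 with hα
  have hα2 : 0 < 2 * (1 - α ^ 2) := by nlinarith [abs_lt.1 hp]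
  have hσ : ∀ n ω, √(2 * (1 - α ^ 2)) ≤ √(diffVar α X X' n ω) := fun n ω =>
    Real.sqrt_le_sqrt (hX.le_diffVar hX' α n ω)
  have hσ0 : ∀ n ω, 0 < √(diffVar α X X' n ω) := fun n ω =>
    (Real.sqrt_pos.2 hα2).trans_le (hσ n ω)
  have drift : ∀ {q : ℝ} {Z : ℕ → Ω → ℤ}, IsERW P p q Z → ∀ (n : ℕ) ω,
      |α / ((n : ℝ) + 1) * position Z (n + 1) ω| ≤ 1 := fun hZ n ω => by
    have h1 := hZ.sq_drift_le α n ω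
    rw [← mul_pow] at h1
    exact (sq_le_sq.1 h1).trans hp.le
  have integrable_of : ∀ {f : Ω → ℝ} {K : ℝ}, Measurable f → (∀ ω, |f ω| ≤ K) → Integrable f P :=
    fun hf hK => Integrable.of_bound hf.aestronglyMeasurable _ (ae_of_all _ hK)
  refine ⟨fun n => ?_, le_max_left _ _, fun n ω => ?_, fun n Y hY ⟨K, hK⟩ => ?_,
    fun n Y hY ⟨K, hK⟩ => ?_⟩
  · exact (((stronglyMeasurable_step_fst hX hX' le_rfl).sub
      (stronglyMeasurable_step_snd hX hX' le_rfl)).sub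
      (((stronglyMeasurable_position_fst hX hX' (by omega)).sub
      (stronglyMeasurable_position_snd hX hX' (by omega))).const_mul _)).div
      ((stronglyMeasurable_sqrt_diffVar hX hX' α n).mono ((history hX hX').mono n.le_succ))
  · refine le_max_of_le_right ?_
    rw [normDiff, abs_div, abs_of_pos (hσ0 n ω)]
    refine div_le_div₀ (by norm_num) ?_ (Real.sqrt_pos.2 hα2) (hσ n ω)
    have h1 := abs_le.1 (hX.abs_step (n + 1) ω).le
    have h2 := abs_le.1 (hX'.abs_step (n + 1) ω).le
    have h3 := abs_le.1 (drift hX n ω)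
    have h4 := abs_le.1 (drift hX' n ω)
    rw [mul_sub]
    exact abs_le.2 ⟨by linarith, by linarith⟩
  · have hY' : StronglyMeasurable[history hX hX' n] fun ω => Y ω / √(diffVar α X X' n ω) :=
      hY.div (stronglyMeasurable_sqrt_diffVar hX hX' α n)
    have mY := (hY'.mono ((history hX hX').le n)).measurable
    have bY : ∀ ω, |Y ω / √(diffVar α X X' n ω)| ≤ K / √(2 * (1 - α ^ 2)) := fun ω => by
      rw [abs_div, abs_of_pos (hσ0 n ω)]
      exact div_le_div₀ ((abs_nonneg _).trans (hK ω)) (hK ω) (Real.sqrt_pos.2 hα2) (hσ n ω)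
    have int : ∀ {Z : Ω → ℝ}, Measurable Z → (∀ ω, |Z ω| ≤ 1) →
        Integrable (fun ω => Y ω / √(diffVar α X X' n ω) * Z ω) P := fun hZ hZ1 =>
      integrable_of (mY.mul hZ) fun ω => by
        rw [abs_mul]
        exact mul_le_mul (bY ω) (hZ1 ω) (abs_nonneg _) ((abs_nonneg _).trans (bY ω))
    have i1 := int (hX.measurable_step (n + 1)) fun ω => (hX.abs_step _ ω).le
    have i2 := int (hX'.measurable_step (n + 1)) fun ω => (hX'.abs_step _ ω).le
    have i3 := int ((hX.measurable_position (n + 1)).const_mul (α / (n + 1))) (drift hX n)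
    have i4 := int ((hX'.measurable_position (n + 1)).const_mul (α / (n + 1))) (drift hX' n)
    have z1 := integral_sub_eq_zero_of_eq i1 i3 (integral_mul_step_fst hX hX' hindep n hY')
    have z2 := integral_sub_eq_zero_of_eq i2 i4 (integral_mul_step_snd hX hX' hindep n hY')
    calc ∫ ω, Y ω * normDiff α X X' n ω ∂P = ∫ ω, ((Y ω / √(diffVar α X X' n ω) * X (n + 1) ω -
          Y ω / √(diffVar α X X' n ω) * (α / (n + 1) * position X (n + 1) ω)) -
          (Y ω / √(diffVar α X X' n ω) * X' (n + 1) ω -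
          Y ω / √(diffVar α X X' n ω) * (α / (n + 1) * position X' (n + 1) ω))) ∂P := by
          congr 1; ext ω; rw [normDiff]; ring
      _ = 0 := integral_sub_eq_zero_of_eq (i1.sub i3) (i2.sub i4) (z1.trans z2.symm)
  · set T : Ω → ℝ := fun ω => Y ω / diffVar α X X' n ω with hT
    set B : Ω → ℝ := fun ω => α / (n + 1) * position X (n + 1) ω with hB
    set B' : Ω → ℝ := fun ω => α / (n + 1) * position X' (n + 1) ω with hB'
    have hσ2 : ∀ ω, 0 < diffVar α X X' n ω := fun ω => hα2.trans_le (hX.le_diffVar hX' α n ω)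
    have sT : StronglyMeasurable[history hX hX' n] T :=
      hY.div (stronglyMeasurable_diffVar hX hX' α n)
    have sB : StronglyMeasurable[history hX hX' n] B :=
      (stronglyMeasurable_position_fst hX hX' le_rfl).const_mul _
    have sB' : StronglyMeasurable[history hX hX' n] B' :=
      (stronglyMeasurable_position_snd hX hX' le_rfl).const_mul _
    have sU : StronglyMeasurable[history hX hX' n] fun ω => T ω * (B ω - B' ω) :=
      sT.mul (sB.sub sB')
    have mT := (sT.mono ((history hX hX').le n)).measurable
    have mB := (sB.mono ((history hX hX').le n)).measurable
    have mB' := (sB'.mono ((history hX hX').le n)).measurable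
    have mU := (sU.mono ((history hX hX').le n)).measurable
    have bT : ∀ ω, |T ω| ≤ K / (2 * (1 - α ^ 2)) := fun ω => by
      rw [hT, abs_div, abs_of_pos (hσ2 ω)]
      exact div_le_div₀ ((abs_nonneg _).trans (hK ω)) (hK ω) hα2 (hX.le_diffVar hX' α n ω)
    have bB : ∀ ω, |B ω| ≤ 1 := drift hX n
    have bB' : ∀ ω, |B' ω| ≤ 1 := drift hX' n
    have bU : ∀ ω, |T ω * (B ω - B' ω)| ≤ K / (2 * (1 - α ^ 2)) * 2 := fun ω => by
      rw [abs_mul]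
      refine mul_le_mul (bT ω) ?_ (abs_nonneg _) ((abs_nonneg _).trans (bT ω))
      have := abs_le.1 (bB ω)
      have := abs_le.1 (bB' ω)
      exact abs_le.2 ⟨by linarith, by linarith⟩
    have int : ∀ {W Z : Ω → ℝ} {L : ℝ}, Measurable W → (∀ ω, |W ω| ≤ L) → Measurable Z →
        (∀ ω, |Z ω| ≤ 1) → Integrable (fun ω => W ω * Z ω) P := fun hW hL hZ hZ1 =>
      integrable_of (hW.mul hZ) fun ω => by
        rw [abs_mul]
        exact mul_le_mul (hL ω) (hZ1 ω) (abs_nonneg _) ((abs_nonneg _).trans (hL ω))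
    have x1 : ∀ ω, |(X (n + 1) ω : ℝ)| ≤ 1 := fun ω => (hX.abs_step _ ω).le
    have x1' : ∀ ω, |(X' (n + 1) ω : ℝ)| ≤ 1 := fun ω => (hX'.abs_step _ ω).le
    have prod1 : ∀ {a b : ℝ}, |a| ≤ 1 → |b| ≤ 1 → |a * b| ≤ 1 := fun ha hb => by
      rw [abs_mul]; exact mul_le_one₀ ha (abs_nonneg _) hb
    have i1 := int mT bT ((hX.measurable_step (n + 1)).mul (hX'.measurable_step (n + 1)))
      fun ω => prod1 (x1 ω) (x1' ω)
    have j1 := int mT bT (mB.mul mB') fun ω => prod1 (bB ω) (bB' ω)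
    simp only [Pi.mul_apply] at i1 j1
    have i2 := int mU bU (hX.measurable_step (n + 1)) x1
    have j2 := int mU bU mB bB
    have i3 := int mU bU (hX'.measurable_step (n + 1)) x1'
    have j3 := int mU bU mB' bB'
    have z1 := integral_sub_eq_zero_of_eq i1 j1 (integral_mul_step_mul_step hX hX' hindep n sT)
    have z2 := integral_sub_eq_zero_of_eq i2 j2 (integral_mul_step_fst hX hX' hindep n sU)
    have z3 := integral_sub_eq_zero_of_eq i3 j3 (integral_mul_step_snd hX hX' hindep n sU)
    have iY : Integrable Y P := integrable_of (hY.mono ((history hX hX').le n)).measurable hK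
    have hpt : ∀ ω, Y ω * normDiff α X X' n ω ^ 2 = Y ω +
        ((-2) * (T ω * (X (n + 1) ω * X' (n + 1) ω) - T ω * (B ω * B' ω)) +
        ((-2) * (T ω * (B ω - B' ω) * X (n + 1) ω - T ω * (B ω - B' ω) * B ω) +
        2 * (T ω * (B ω - B' ω) * X' (n + 1) ω - T ω * (B ω - B' ω) * B' ω))) := fun ω => by
      have hY1 : Y ω = T ω * diffVar α X X' n ω := (div_mul_cancel₀ _ (hσ2 ω).ne').symm
      have hx : (X (n + 1) ω : ℝ) ^ 2 = 1 := by rw [← sq_abs, hX.abs_step, one_pow]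
      have hx' : (X' (n + 1) ω : ℝ) ^ 2 = 1 := by rw [← sq_abs, hX'.abs_step, one_pow]
      have hv : diffVar α X X' n ω = 2 - (B ω ^ 2 + B' ω ^ 2) := by
        simp only [diffVar, hB, hB']; ring
      have hnd : Y ω * normDiff α X X' n ω ^ 2 =
          T ω * (X (n + 1) ω - X' (n + 1) ω - (B ω - B' ω)) ^ 2 := by
        rw [normDiff, div_pow, Real.sq_sqrt (hσ2 ω).le, hT, mul_sub (α / _)]
        ring
      rw [hnd, hY1, hv]
      linear_combination T ω * hx + T ω * hx'
    simp_rw [hpt]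
    have k1 := (i1.sub j1).const_mul (-2)
    have k2 := (i2.sub j2).const_mul (-2)
    have k3 := (i3.sub j3).const_mul 2
    simp only [Pi.sub_apply] at k1 k2 k3
    rw [integral_add iY, integral_add k1, integral_add k2 k3, integral_const_mul,
      integral_const_mul, integral_const_mul, z1, z2, z3]
    · ring
    · exact k2.add k3
    · exact k1.add (k2.add k3)

end IsERW

lemma ae_summable_of_summable_integral {Ω : Type*} [MeasurableSpace Ω] {P : Measure Ω}
    {f : ℕ → Ω → ℝ} (hf0 : ∀ n ω, 0 ≤ f n ω) (hf : ∀ n, Integrable (f n) P)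
    (hs : Summable fun n => ∫ ω, f n ω ∂P) : ∀ᵐ ω ∂P, Summable fun n => f n ω := by
  have hm : ∀ n, AEMeasurable (fun ω => ENNReal.ofReal (f n ω)) P := fun n =>
    (hf n).aestronglyMeasurable.aemeasurable.ennreal_ofReal
  have h1 : ∫⁻ ω, ∑' n, ENNReal.ofReal (f n ω) ∂P ≠ ⊤ := by
    rw [lintegral_tsum hm]
    simp_rw [← ofReal_integral_eq_lintegral_ofReal (hf _) (ae_of_all _ (hf0 _))]
    rw [← ENNReal.ofReal_tsum_of_nonneg (fun n => integral_nonneg (hf0 n)) hs]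
    exact ENNReal.ofReal_ne_top
  filter_upwards [ae_lt_top' (AEMeasurable.tsum hm) h1] with ω hω
  have := ENNReal.summable_toReal hω.ne
  simpa [ENNReal.toReal_ofReal (hf0 _ ω)] using this

namespace IsERW

variable {Ω : Type*} [MeasurableSpace Ω] {P : Measure Ω} [IsProbabilityMeasure P] {p q q' : ℝ}
  {X X' : ℕ → Ω → ℤ}

lemma integrable_position_sq (hX : IsERW P p q X) (n : ℕ) :
    Integrable (fun ω => position X n ω ^ 2) P :=
  Integrable.of_bound ((hX.measurable_position n).pow_const 2).aestronglyMeasurable ((n : ℝ) ^ 2)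
    (ae_of_all _ fun ω => by
      rw [Real.norm_eq_abs, abs_pow]
      exact pow_le_pow_left₀ (abs_nonneg _) (hX.abs_position_le n ω) 2)

lemma integral_position_sq_succ (hX : IsERW P p q X) (hX' : IsERW P p q' X')
    (hindep : IndepFun (fun ω n => X n ω) (fun ω n => X' n ω) P) (n : ℕ) :
    ∫ ω, position X (n + 2) ω ^ 2 ∂P =
      (1 + 2 * ((2 * p - 1) / (n + 1))) * ∫ ω, position X (n + 1) ω ^ 2 ∂P + 1 := by
  have h := integral_mul_step_fst hX hX' hindep n
    (stronglyMeasurable_position_fst hX hX' (k := n + 1) le_rfl)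
  have hpt : ∀ ω, position X (n + 2) ω ^ 2 =
      position X (n + 1) ω ^ 2 + (2 * (position X (n + 1) ω * X (n + 1) ω) + 1) := fun ω => by
    have hx : (X (n + 1) ω : ℝ) ^ 2 = 1 := by rw [← sq_abs, hX.abs_step, one_pow]
    rw [position_succ X (n + 1)]
    linear_combination hx
  have hi : Integrable (fun ω => position X (n + 1) ω * X (n + 1) ω) P :=
    Integrable.of_bound ((hX.measurable_position _).mul
      (hX.measurable_step _)).aestronglyMeasurable ((n + 1 : ℕ) : ℝ) (ae_of_all _ fun ω => by
      rw [Real.norm_eq_abs, abs_mul, hX.abs_step, mul_one]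
      exact hX.abs_position_le _ ω)
  have h2 : ∀ ω, position X (n + 1) ω * ((2 * p - 1) / (n + 1) * position X (n + 1) ω) =
      (2 * p - 1) / (n + 1) * position X (n + 1) ω ^ 2 := fun ω => by ring
  simp_rw [h2] at h
  rw [integral_const_mul] at h
  simp_rw [hpt]
  have hi2 : Integrable (fun ω => 2 * (position X (n + 1) ω * X (n + 1) ω) + 1) P :=
    (hi.const_mul 2).add (integrable_const _)
  rw [integral_add (hX.integrable_position_sq _) hi2,
    integral_add (hi.const_mul 2) (integrable_const _), integral_const_mul, h, integral_const,
    probReal_univ, one_smul]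
  ring

lemma integral_position_sq_le (hX : IsERW P p q X) (hX' : IsERW P p q' X')
    (hindep : IndepFun (fun ω n => X n ω) (fun ω n => X' n ω) P) (hp : p ≤ 3 / 4) (n : ℕ) :
    ∫ ω, position X (n + 1) ω ^ 2 ∂P ≤ (n + 1) * (harmonic (n + 1) : ℝ) := by
  induction n with
  | zero =>
    have : ∀ ω, position X (0 + 1) ω ^ 2 = 1 := fun ω => by
      simp [position, ← sq_abs, hX.abs_step]
    simp_rw [this]
    simp [harmonic]
  | succ n ih =>
    rw [hX.integral_position_sq_succ hX' hindep, harmonic_succ]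
    have h0 : 0 ≤ ∫ ω, position X (n + 1) ω ^ 2 ∂P := integral_nonneg fun ω => sq_nonneg _
    have hn : (0 : ℝ) < (n : ℝ) + 1 := by positivity
    have h1 : 1 + 2 * ((2 * p - 1) / ((n : ℝ) + 1)) ≤ 1 + 1 / ((n : ℝ) + 1) := by
      rw [← mul_div_assoc]
      gcongr
      linarith
    calc (1 + 2 * ((2 * p - 1) / ((n : ℝ) + 1))) * ∫ ω, position X (n + 1) ω ^ 2 ∂P + 1
        ≤ (1 + 1 / ((n : ℝ) + 1)) * ((n + 1) * (harmonic (n + 1) : ℝ)) + 1 := by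
          have h2 : 0 ≤ 1 + 1 / ((n : ℝ) + 1) := by positivity
          have := mul_le_mul h1 ih h0 h2
          linarith
      _ = _ := by
          push_cast
          field_simp

lemma integral_position_sq_le_rpow (hX : IsERW P p q X) (hX' : IsERW P p q' X')
    (hindep : IndepFun (fun ω n => X n ω) (fun ω n => X' n ω) P) (hp : p ≤ 3 / 4) (n : ℕ) :
    ∫ ω, position X (n + 1) ω ^ 2 ∂P ≤ 5 * ((n + 1 : ℕ) : ℝ) ^ (5 / 4 : ℝ) := by
  have hn : (1 : ℝ) ≤ ((n + 1 : ℕ) : ℝ) := by exact_mod_cast Nat.le_add_left 1 n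
  have h1 := hX.integral_position_sq_le hX' hindep hp n
  have h2 := harmonic_le_one_add_log (n + 1)
  have h3 := Real.log_le_rpow_div (zero_le_one.trans hn) (show (0 : ℝ) < 1 / 4 by norm_num)
  have h4 : (1 : ℝ) ≤ ((n + 1 : ℕ) : ℝ) ^ (1 / 4 : ℝ) := Real.one_le_rpow hn (by norm_num)
  have h5 : ((n + 1 : ℕ) : ℝ) ^ (5 / 4 : ℝ) =
      ((n + 1 : ℕ) : ℝ) * ((n + 1 : ℕ) : ℝ) ^ (1 / 4 : ℝ) := by
    rw [show (5 / 4 : ℝ) = 1 + 1 / 4 by norm_num, Real.rpow_add (by positivity), Real.rpow_one]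
  rw [h5]
  refine h1.trans ?_
  calc ((n : ℝ) + 1) * (harmonic (n + 1) : ℝ)
      ≤ ((n + 1 : ℕ) : ℝ) * (5 * ((n + 1 : ℕ) : ℝ) ^ (1 / 4 : ℝ)) := by
        push_cast at h2 h3 h4 ⊢
        gcongr
        linarith
    _ = _ := by ring

theorem ae_summable_position_sq (hX : IsERW P p q X) (hX' : IsERW P p q' X')
    (hindep : IndepFun (fun ω n => X n ω) (fun ω n => X' n ω) P) (hp : p ≤ 3 / 4) :
    ∀ᵐ ω ∂P, Summable fun n : ℕ =>
      ((n + 1 : ℕ) : ℝ) ^ (-5 / 2 : ℝ) * position X (n + 1) ω ^ 2 := by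
  refine ae_summable_of_summable_integral (fun n ω => by positivity)
    (fun n => (hX.integrable_position_sq _).const_mul _) ?_
  have hs : Summable fun n : ℕ => 5 * ((n + 1 : ℕ) : ℝ) ^ (-5 / 4 : ℝ) :=
    ((summable_nat_add_iff 1).2 (Real.summable_nat_rpow.2 (by norm_num))).mul_left 5
  refine Summable.of_nonneg_of_le (fun n => integral_nonneg fun ω => by positivity)
    (fun n => ?_) hs
  rw [integral_const_mul]
  have h := hX.integral_position_sq_le_rpow hX' hindep hp n
  have hn : (0 : ℝ) < ((n + 1 : ℕ) : ℝ) := by positivity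
  calc _ ≤ ((n + 1 : ℕ) : ℝ) ^ (-5 / 2 : ℝ) * (5 * ((n + 1 : ℕ) : ℝ) ^ (5 / 4 : ℝ)) := by gcongr
    _ = 5 * (((n + 1 : ℕ) : ℝ) ^ (-5 / 2 : ℝ) * ((n + 1 : ℕ) : ℝ) ^ (5 / 4 : ℝ)) := by ring
    _ = _ := by rw [← Real.rpow_add hn]; norm_num

end IsERW

/-- The factor turning an elephant random walk into a martingale. -/
def erwWeight (α : ℝ) (n : ℕ) : ℝ := ∏ i ∈ Finset.range n, (1 + α / (i + 1))⁻¹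

lemma one_add_div_pos {α : ℝ} (hα : -1 < α) (n : ℕ) : 0 < 1 + α / ((n : ℝ) + 1) := by
  have hn : (0 : ℝ) < (n : ℝ) + 1 := by positivity
  rw [one_add_div hn.ne']
  exact div_pos (by linarith [n.cast_nonneg (α := ℝ)]) hn

lemma erwWeight_pos {α : ℝ} (hα : -1 < α) (n : ℕ) : 0 < erwWeight α n :=
  Finset.prod_pos fun i _ => inv_pos.2 (one_add_div_pos hα i)

lemma erwWeight_succ_mul {α : ℝ} (hα : -1 < α) (n : ℕ) :
    erwWeight α (n + 1) * (1 + α / (n + 1)) = erwWeight α n := by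
  rw [erwWeight, Finset.prod_range_succ, mul_assoc, inv_mul_cancel₀ (one_add_div_pos hα n).ne',
    mul_one, erwWeight]

lemma tendsto_const_add_mul_sqrt_div_lilScale (a b : ℝ) :
    Tendsto (fun v => (a + b * √v) / lilScale v) atTop (nhds 0) := by
  have hLL : Tendsto (fun v : ℝ => √(2 * Real.log (Real.log v))) atTop atTop :=
    Real.tendsto_sqrt_atTop.comp
      ((Real.tendsto_log_atTop.comp Real.tendsto_log_atTop).const_mul_atTop two_pos)
  have h1 : Tendsto (fun v => a / lilScale v + b / √(2 * Real.log (Real.log v))) atTop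
      (nhds (0 + 0)) :=
    (tendsto_lilScale_atTop.const_div_atTop a).add (hLL.const_div_atTop b)
  rw [add_zero] at h1
  refine h1.congr' ?_
  filter_upwards [eventually_gt_atTop 0] with v hv
  have h2 : lilScale v = √v * √(2 * Real.log (Real.log v)) := by
    rw [lilScale, ← Real.sqrt_mul hv.le]
    congr 1
    ring
  rw [add_div, h2, mul_comm b, mul_div_mul_left _ _ (Real.sqrt_pos.2 hv).ne']

namespace IsERW

variable {Ω : Type*} [MeasurableSpace Ω] {P : Measure Ω} {p q q' : ℝ} {X X' : ℕ → Ω → ℤ}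

lemma erwWeight_mul_position_sub (hX : IsERW P p q X) (hX' : IsERW P p q' X')
    {α : ℝ} (hα : |α| < 1) (n : ℕ) (ω : Ω) :
    erwWeight α n * (position X (n + 1) ω - position X' (n + 1) ω) =
      (position X 1 ω - position X' 1 ω) + ∑ j ∈ Finset.range n,
        erwWeight α (j + 1) * (√(diffVar α X X' j ω) * normDiff α X X' j ω) := by
  induction n with
  | zero => simp [erwWeight]
  | succ n ih =>
    have hα2 : 0 < 2 * (1 - α ^ 2) := by nlinarith [abs_lt.1 hα]
    have hσ : 0 < √(diffVar α X X' n ω) :=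
      Real.sqrt_pos.2 (hα2.trans_le (hX.le_diffVar hX' α n ω))
    rw [Finset.sum_range_succ, ← add_assoc, ← ih, normDiff, mul_div_cancel₀ _ hσ.ne',
      position_succ X, position_succ X', ← erwWeight_succ_mul (abs_lt.1 hα).1 n]
    ring

lemma abs_sqrt_diffVar_sub_le (hX : IsERW P p q X) (hX' : IsERW P p q' X') {α : ℝ}
    (hα : |α| < 1) (n : ℕ) (ω : Ω) :
    |√(diffVar α X X' n ω) - √2| ≤
      (position X (n + 1) ω ^ 2 + position X' (n + 1) ω ^ 2) / ((n + 1 : ℕ) : ℝ) ^ 2 := by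
  have hα2 : 0 < 2 * (1 - α ^ 2) := by nlinarith [abs_lt.1 hα]
  have hσ2 : 0 < diffVar α X X' n ω := hα2.trans_le (hX.le_diffVar hX' α n ω)
  set s := position X (n + 1) ω ^ 2 + position X' (n + 1) ω ^ 2 with hs
  have hs0 : 0 ≤ s := by positivity
  have hn : (0 : ℝ) < ((n : ℝ) + 1) ^ 2 := by positivity
  have hdv : 2 - diffVar α X X' n ω ≤ s / ((n + 1 : ℕ) : ℝ) ^ 2 := by
    rw [diffVar, sub_sub_cancel, div_pow, div_mul_eq_mul_div]
    push_cast
    gcongr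
    nlinarith [abs_lt.1 hα]
  have hdv0 : diffVar α X X' n ω ≤ 2 := by
    rw [diffVar, sub_le_self_iff]; positivity
  have h1 : 1 ≤ √2 := Real.one_le_sqrt.2 one_le_two
  have h2 := Real.sq_sqrt hσ2.le
  have h3 := Real.sq_sqrt (zero_le_two (α := ℝ))
  have h4 := Real.sqrt_le_sqrt hdv0
  have h5 := Real.sqrt_nonneg (diffVar α X X' n ω)
  rw [abs_sub_comm, abs_of_nonneg (by linarith)]
  refine le_trans ?_ hdv
  nlinarith

/-- Reduction of the law of the iterated logarithm for the difference of two elephant random walks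
to deterministic asymptotics of the weights. -/
theorem ae_limsup_position_sub_div [IsProbabilityMeasure P] (hX : IsERW P p q X)
    (hX' : IsERW P p q' X') (hindep : IndepFun (fun ω n => X n ω) (fun ω n => X' n ω) P)
    (hp0 : 0 < p) (hp : p ≤ 3 / 4) {w : ℕ → ℝ} {r : ℝ} (hr : 0 < r)
    (hV : Tendsto (sumSq fun j => erwWeight (2 * p - 1) (j + 1)) atTop atTop)
    (hK : KolmogorovCondition fun j => erwWeight (2 * p - 1) (j + 1))
    (hc : ∃ K, ∀ j : ℕ, erwWeight (2 * p - 1) (j + 1) ^ 2 * ((j + 1 : ℕ) : ℝ) ≤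
      K * sumSq (fun j => erwWeight (2 * p - 1) (j + 1)) (j + 1))
    (hw : Tendsto (fun n => lilScale (sumSq (fun j => erwWeight (2 * p - 1) (j + 1)) n) /
      (erwWeight (2 * p - 1) n * w (n + 1))) atTop (nhds r)) :
    ∀ᵐ ω ∂P, limsup (fun n => (position X n ω - position X' n ω) / w n) atTop = √2 * r := by
  set α := 2 * p - 1 with hαdef
  have hα : |α| < 1 := abs_lt.2 ⟨by linarith, by linarith⟩
  set c : ℕ → ℝ := fun j => erwWeight α (j + 1) with hcdef
  have hND := isNormalizedDiff hX hX' hindep hα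
  rw [← hαdef] at hND
  set C := max 1 (4 / √(2 * (1 - α ^ 2))) with hC
  obtain ⟨K, hcK⟩ := hc
  have hc0 : ∀ j, 0 < c j := fun j => erwWeight_pos (abs_lt.1 hα).1 (j + 1)
  filter_upwards [hND.ae_forall_oscillation hV hK, hX.ae_summable_position_sq hX' hindep hp,
    hX'.ae_summable_position_sq hX hindep.symm hp] with ω hosc hs hs'
  have hsum := hs.add hs'
  set g : ℕ → ℝ := fun n => ((n + 1 : ℕ) : ℝ) ^ (-5 / 2 : ℝ) * position X (n + 1) ω ^ 2 +
    ((n + 1 : ℕ) : ℝ) ^ (-5 / 2 : ℝ) * position X' (n + 1) ω ^ 2 with hg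
  have hg0 : ∀ n, 0 ≤ g n := fun n => by positivity
  have hterm : ∀ n, ∀ j ∈ Finset.range n, |c j * normDiff α X X' j ω *
      (√(diffVar α X X' j ω) - √2)| ≤ (C * √(K * sumSq c n)) * g j := by
    intro n j hj
    have hj' : j + 1 ≤ n := Finset.mem_range.1 hj
    have hj0 : (0 : ℝ) < ((j + 1 : ℕ) : ℝ) := by positivity
    have hK0 : 0 ≤ K := by
      by_contra hneg
      have h1 := hcK j
      have h2 : 0 < c j ^ 2 * ((j + 1 : ℕ) : ℝ) := mul_pos (pow_pos (hc0 j) 2) hj0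
      have h3 : K * sumSq c (j + 1) ≤ 0 :=
        mul_nonpos_of_nonpos_of_nonneg (not_le.1 hneg).le (sumSq_nonneg _ _)
      exact absurd (h2.trans_le h1) (not_lt.2 h3)
    have hcj : c j * √((j + 1 : ℕ) : ℝ) ≤ √(K * sumSq c n) := by
      refine Real.le_sqrt_of_sq_le ?_
      rw [mul_pow, Real.sq_sqrt hj0.le]
      exact (hcK j).trans (mul_le_mul_of_nonneg_left (sumSq_mono c hj') hK0)
    have hcj' : c j ≤ √(K * sumSq c n) * ((j + 1 : ℕ) : ℝ) ^ (-1 / 2 : ℝ) := by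
      rw [neg_div, Real.rpow_neg hj0.le, ← Real.sqrt_eq_rpow, ← div_eq_mul_inv,
        le_div_iff₀ (Real.sqrt_pos.2 hj0)]
      exact hcj
    have hpow : ((j + 1 : ℕ) : ℝ) ^ (-1 / 2 : ℝ) / ((j + 1 : ℕ) : ℝ) ^ 2 =
        ((j + 1 : ℕ) : ℝ) ^ (-5 / 2 : ℝ) := by
      rw [← Real.rpow_natCast _ 2, ← Real.rpow_sub hj0]
      norm_num
    rw [abs_mul, abs_mul, abs_of_pos (hc0 j)]
    calc c j * |normDiff α X X' j ω| * |√(diffVar α X X' j ω) - √2|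
        ≤ (√(K * sumSq c n) * ((j + 1 : ℕ) : ℝ) ^ (-1 / 2 : ℝ)) * C *
          ((position X (j + 1) ω ^ 2 + position X' (j + 1) ω ^ 2) / ((j + 1 : ℕ) : ℝ) ^ 2) := by
          have h1 := hX.abs_sqrt_diffVar_sub_le hX' hα j ω
          have h2 := hND.bound j ω
          have := hc0 j
          gcongr
      _ = (C * √(K * sumSq c n)) * ((((j + 1 : ℕ) : ℝ) ^ (-1 / 2 : ℝ) / ((j + 1 : ℕ) : ℝ) ^ 2) *
          (position X (j + 1) ω ^ 2 + position X' (j + 1) ω ^ 2)) := by ring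
      _ = _ := by rw [hpow, hg, mul_add]
  have herr : ∀ n, |erwWeight α n * (position X (n + 1) ω - position X' (n + 1) ω) -
      √2 * weightedSum c (normDiff α X X') n ω| ≤
      2 + (C * √K * ∑' j, g j) * √(sumSq c n) := by
    intro n
    have hid : erwWeight α n * (position X (n + 1) ω - position X' (n + 1) ω) -
        √2 * weightedSum c (normDiff α X X') n ω = (position X 1 ω - position X' 1 ω) +
        ∑ j ∈ Finset.range n, c j * normDiff α X X' j ω * (√(diffVar α X X' j ω) - √2) := by
      rw [hX.erwWeight_mul_position_sub hX' hα, weightedSum, Finset.mul_sum, add_sub_assoc,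
        ← Finset.sum_sub_distrib]
      congr 1
      exact Finset.sum_congr rfl fun j _ => by simp only [hcdef]; ring
    rw [hid]
    refine (abs_add_le _ _).trans (add_le_add ?_ ?_)
    · have h1 := abs_le.1 (hX.abs_position_le 1 ω)
      have h2 := abs_le.1 (hX'.abs_position_le 1 ω)
      push_cast at h1 h2
      exact abs_le.2 ⟨by linarith, by linarith⟩
    · refine (Finset.abs_sum_le_sum_abs _ _).trans ((Finset.sum_le_sum (hterm n)).trans ?_)
      rw [← Finset.mul_sum, Real.sqrt_mul' _ (sumSq_nonneg c n)]
      calc C * (√K * √(sumSq c n)) * ∑ j ∈ Finset.range n, g j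
          ≤ C * (√K * √(sumSq c n)) * ∑' j, g j := by
            have hC0 : 0 ≤ C := zero_le_one.trans (le_max_left _ _)
            have := hsum.sum_le_tsum (Finset.range n) fun j _ => hg0 j
            gcongr
        _ = _ := by ring
  have hLtop : Tendsto (fun n => lilScale (sumSq c n)) atTop atTop :=
    tendsto_lilScale_atTop.comp hV
  have hlim := limsup_div_eq_of_oscillation (a := √2) (r := r)
    (D := fun n => erwWeight α n * (position X (n + 1) ω - position X' (n + 1) ω))
    (w := fun n => erwWeight α n * w (n + 1)) (by positivity) hr hosc.1 hosc.2
    (hLtop.eventually_gt_atTop 0) ?_ hw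
  · rw [← hlim, ← limsup_nat_add _ 1]
    congr 1
    funext n
    exact (mul_div_mul_left _ _ (erwWeight_pos (abs_lt.1 hα).1 n).ne').symm
  · refine squeeze_zero_norm' ?_ ((tendsto_const_add_mul_sqrt_div_lilScale 2
      (C * √K * ∑' j, g j)).comp hV)
    filter_upwards [hLtop.eventually_gt_atTop 0] with n hn
    rw [Real.norm_eq_abs, abs_div, abs_of_pos hn, Function.comp_apply]
    have := herr n
    gcongr

end IsERW

lemma erwWeight_eq_factorial_div {α : ℝ} (hα : -1 < α) (n : ℕ) :
    erwWeight α n = n.factorial / ∏ i ∈ Finset.range n, (1 + α + i) := by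
  induction n with
  | zero => simp [erwWeight]
  | succ n ih =>
    have hn : (0 : ℝ) < (n : ℝ) + 1 := by positivity
    have hs : 0 < 1 + α + n := by linarith [n.cast_nonneg (α := ℝ)]
    rw [erwWeight, Finset.prod_range_succ, ← erwWeight, ih, Finset.prod_range_succ,
      Nat.factorial_succ, one_add_div hn.ne', inv_div, div_mul_div_comm]
    push_cast
    congr 1 <;> ring

lemma tendsto_erwWeight_mul_rpow {α : ℝ} (hα : -1 < α) :
    Tendsto (fun n : ℕ => erwWeight α n * (n : ℝ) ^ α) atTop (nhds (Real.Gamma (1 + α))) := by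
  have h1 : Tendsto (fun n : ℕ => 1 + (1 + α) / (n : ℝ)) atTop (nhds (1 + 0)) :=
    tendsto_const_nhds.add (tendsto_natCast_atTop_atTop.const_div_atTop _)
  have h2 := (Real.GammaSeq_tendsto_Gamma (1 + α)).mul h1
  rw [add_zero, mul_one] at h2
  refine h2.congr' ?_
  filter_upwards [eventually_gt_atTop 0] with n hn
  have hn' : (0 : ℝ) < n := Nat.cast_pos.2 hn
  have hs : 0 < 1 + α + n := by linarith
  have hprod : 0 < ∏ i ∈ Finset.range n, (1 + α + (i : ℝ)) :=
    Finset.prod_pos fun i _ => by linarith [i.cast_nonneg (α := ℝ)]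
  rw [erwWeight_eq_factorial_div hα, Real.GammaSeq, Finset.prod_range_succ, Real.rpow_add hn',
    Real.rpow_one]
  field_simp
  ring

lemma tendsto_erwWeight_succ_mul_rpow {α : ℝ} (hα : -1 < α) :
    Tendsto (fun n : ℕ => erwWeight α (n + 1) * ((n : ℝ) + 1) ^ α) atTop
      (nhds (Real.Gamma (1 + α))) := by
  simpa [Function.comp_def] using (tendsto_erwWeight_mul_rpow hα).comp (tendsto_add_atTop_nat 1)

lemma tendsto_natCast_add_one_atTop : Tendsto (fun n : ℕ => (n : ℝ) + 1) atTop atTop :=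
  tendsto_atTop_add_const_right _ _ tendsto_natCast_atTop_atTop

lemma tendsto_erwWeight_mul_succ_rpow {α : ℝ} (hα : -1 < α) :
    Tendsto (fun n : ℕ => erwWeight α n * ((n : ℝ) + 1) ^ α) atTop
      (nhds (Real.Gamma (1 + α))) := by
  have h1 : Tendsto (fun n : ℕ => 1 + α / ((n : ℝ) + 1)) atTop (nhds (1 + 0)) :=
    tendsto_const_nhds.add (tendsto_natCast_add_one_atTop.const_div_atTop _)
  have h2 := (tendsto_erwWeight_succ_mul_rpow hα).mul h1
  rw [add_zero, mul_one] at h2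
  refine h2.congr fun n => ?_
  rw [← erwWeight_succ_mul hα n]
  ring

/-- The Stolz–Cesàro theorem for partial sums. -/
lemma tendsto_sum_range_div {f G : ℕ → ℝ} {l : ℝ} (hG : Tendsto G atTop atTop)
    (hmono : StrictMono G) (h : Tendsto (fun j => f j / (G (j + 1) - G j)) atTop (nhds l)) :
    Tendsto (fun n => (∑ j ∈ Finset.range n, f j) / G n) atTop (nhds l) := by
  have hpos : ∀ j, 0 < G (j + 1) - G j := fun j => sub_pos.2 (hmono j.lt_succ_self)
  have hsum : ∀ n, ∑ j ∈ Finset.range n, (G (j + 1) - G j) = G n - G 0 := Finset.sum_range_sub G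
  have hinf : Tendsto (fun n => G n - G 0) atTop atTop := tendsto_atTop_add_const_right _ _ hG
  have h1 : (fun j => f j - l * (G (j + 1) - G j)) =o[atTop] fun j => G (j + 1) - G j := by
    rw [isLittleO_iff_tendsto fun j hj => absurd hj (hpos j).ne']
    have h2 := h.sub_const l
    rw [sub_self] at h2
    refine h2.congr fun j => ?_
    rw [sub_div, mul_div_cancel_right₀ _ (hpos j).ne']
  have h2 := h1.sum_range (fun j => (hpos j).le) (by simpa only [hsum] using hinf)
  simp only [Finset.sum_sub_distrib, ← Finset.mul_sum, hsum] at h2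
  have h3 : (fun n => G n - G 0) =O[atTop] G := by
    refine (isBigO_refl G atTop).sub (IsLittleO.isBigO ?_)
    exact isLittleO_const_left.2 (Or.inr (tendsto_norm_atTop_atTop.comp hG))
  have h4 := (h2.trans_isBigO h3).tendsto_div_nhds_zero
  have h5 := (h4.add_const l).sub (hG.const_div_atTop (l * G 0))
  rw [zero_add, sub_zero] at h5
  refine h5.congr' ?_
  filter_upwards [hG.eventually_gt_atTop 0] with n hn
  field_simp
  ring

lemma tendsto_mul_one_add_inv_rpow_sub_one (b : ℝ) :
    Tendsto (fun x : ℝ => x * ((1 + x⁻¹) ^ b - 1)) atTop (nhds b) := by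
  have h1 :=
    (Real.hasDerivAt_rpow_const (x := 1) (p := b) (Or.inl one_ne_zero)).tendsto_slope_zero_right
  have h2 := h1.comp tendsto_inv_atTop_nhdsGT_zero
  simpa [Function.comp_def] using h2

lemma tendsto_sumSq_div_rpow {α : ℝ} (hα : -1 < α) (hα' : α < 1 / 2) :
    Tendsto (fun n : ℕ => sumSq (fun j => erwWeight α (j + 1)) n / ((n : ℝ) + 1) ^ (1 - 2 * α))
      atTop (nhds (Real.Gamma (1 + α) ^ 2 / (1 - 2 * α))) := by
  have hb : 0 < 1 - 2 * α := by linarith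
  refine tendsto_sum_range_div ((tendsto_rpow_atTop hb).comp tendsto_natCast_add_one_atTop) ?_ ?_
  · intro m n hmn
    have : (m : ℝ) < n := Nat.cast_lt.2 hmn
    exact Real.rpow_lt_rpow (by positivity) (by linarith) hb
  · refine (((tendsto_erwWeight_succ_mul_rpow hα).pow 2).div
      ((tendsto_mul_one_add_inv_rpow_sub_one (1 - 2 * α)).comp tendsto_natCast_add_one_atTop)
      hb.ne').congr fun n => ?_
    have hn : (0 : ℝ) < (n : ℝ) + 1 := by positivity
    have h1 : ((n : ℝ) + 1) ^ (1 - 2 * α) * (((n : ℝ) + 1) ^ α) ^ 2 = (n : ℝ) + 1 := by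
      rw [← Real.rpow_natCast, ← Real.rpow_mul hn.le, ← Real.rpow_add hn]
      norm_num [mul_comm α]
    have h2 : (((n + 1 : ℕ) : ℝ) + 1) ^ (1 - 2 * α) - ((n : ℝ) + 1) ^ (1 - 2 * α)
        = ((n : ℝ) + 1) ^ (1 - 2 * α) * ((1 + ((n : ℝ) + 1)⁻¹) ^ (1 - 2 * α) - 1) := by
      rw [mul_sub, ← Real.mul_rpow hn.le (by positivity), mul_add, mul_inv_cancel₀ hn.ne']
      push_cast
      simp
    simp only [Pi.div_apply, Function.comp_apply]
    rw [h2]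
    nth_rw 2 [← h1]
    rw [mul_pow, mul_right_comm, mul_div_mul_right _ _ (by positivity)]

lemma tendsto_sumSq_div_log :
    Tendsto (fun n : ℕ => sumSq (fun j => erwWeight (1 / 2) (j + 1)) n / Real.log ((n : ℝ) + 1))
      atTop (nhds (Real.Gamma (1 + 1 / 2) ^ 2)) := by
  refine tendsto_sum_range_div (Real.tendsto_log_atTop.comp tendsto_natCast_add_one_atTop) ?_ ?_
  · intro m n hmn
    have : (m : ℝ) < n := Nat.cast_lt.2 hmn
    exact Real.log_lt_log (by positivity) (by linarith)
  · have h0 := ((tendsto_erwWeight_succ_mul_rpow (α := 1 / 2) (by norm_num)).pow 2).div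
      ((Real.tendsto_mul_log_one_add_div_atTop 1).comp tendsto_natCast_add_one_atTop) one_ne_zero
    rw [div_one] at h0
    refine h0.congr fun n => ?_
    have hn : (0 : ℝ) < (n : ℝ) + 1 := by positivity
    have h1 : (((n : ℝ) + 1) ^ (1 / 2 : ℝ)) ^ 2 = (n : ℝ) + 1 := by
      rw [← Real.sqrt_eq_rpow, Real.sq_sqrt hn.le]
    have h2 : Real.log (((n + 1 : ℕ) : ℝ) + 1) - Real.log ((n : ℝ) + 1)
        = Real.log (1 + 1 / ((n : ℝ) + 1)) := by
      rw [← Real.log_div (by positivity) hn.ne']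
      congr 1
      push_cast
      field_simp
    simp only [Pi.div_apply, Function.comp_apply]
    rw [h2, mul_pow, h1, mul_comm, mul_div_mul_left _ _ hn.ne']

lemma tendsto_log_div_log_of_tendsto_div {u t : ℕ → ℝ} {l : ℝ} (hl : 0 < l)
    (ht : Tendsto t atTop atTop) (h : Tendsto (fun n => u n / t n) atTop (nhds l)) :
    Tendsto (fun n => Real.log (u n) / Real.log (t n)) atTop (nhds 1) := by
  have hlog := Real.tendsto_log_atTop.comp ht
  have h1 := ((h.log hl.ne').div_atTop hlog).add_const 1
  rw [zero_add] at h1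
  refine h1.congr' ?_
  filter_upwards [ht.eventually_gt_atTop 0, hlog.eventually_gt_atTop 0,
    h.eventually_const_lt hl] with n hn hn' hu
  have hu' : u n ≠ 0 := fun h0 => by simp [h0] at hu
  simp only [Function.comp_apply] at hn' ⊢
  rw [Real.log_div hu' hn.ne', sub_div, div_self hn'.ne', sub_add_cancel]

lemma kolmogorovCondition_of_le {c : ℕ → ℝ} {K K' : ℝ}
    (h1 : ∀ j : ℕ, c j ^ 2 * ((j + 1 : ℕ) : ℝ) ≤ K * sumSq c (j + 1))
    (h2 : ∀ j : ℕ, c j ^ 2 ≤ K' * ((j + 1 : ℕ) : ℝ) ^ 2) : KolmogorovCondition c := by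
  intro η hη
  have hlog := Real.tendsto_log_atTop
  have hA : ∀ᶠ v : ℝ in atTop, |K| * Real.log (Real.log v) ≤ η * Real.log v := by
    have h := ((Real.isLittleO_log_id_atTop.comp_tendsto hlog).const_mul_left |K|).def hη
    filter_upwards [h, hlog.eventually_ge_atTop 0] with v hv hv0
    simpa [abs_of_nonneg hv0] using (le_abs_self _).trans hv
  have hB : ∀ᶠ v : ℝ in atTop, |K'| * Real.log v ^ 3 ≤ η * v := by
    have h := ((Real.isLittleO_pow_log_id_atTop (n := 3)).const_mul_left |K'|).def hη
    filter_upwards [h, eventually_ge_atTop 0] with v hv hv0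
    simpa [abs_of_nonneg hv0] using (le_abs_self _).trans hv
  filter_upwards [hA, hB, hlog.eventually_ge_atTop 1, eventually_gt_atTop 0]
    with v hA hB hv1 hv0 j hj
  have hLL : 0 ≤ Real.log (Real.log v) := Real.log_nonneg hv1
  have hLL' : Real.log (Real.log v) ≤ Real.log v := Real.log_le_self (by linarith)
  have hc := sq_nonneg (c j)
  have hlv : 0 < Real.log v := by linarith
  rcases le_total (Real.log v) ((j + 1 : ℕ) : ℝ) with hcase | hcase
  · have h3 : c j ^ 2 * Real.log v ≤ |K| * v :=
      calc c j ^ 2 * Real.log v ≤ c j ^ 2 * ((j + 1 : ℕ) : ℝ) := by gcongr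
        _ ≤ K * sumSq c (j + 1) := h1 j
        _ ≤ |K| * v := mul_le_mul (le_abs_self K) hj (sumSq_nonneg _ _) (abs_nonneg K)
    refine le_of_mul_le_mul_right ?_ hlv
    calc c j ^ 2 * Real.log (Real.log v) * Real.log v
        = c j ^ 2 * Real.log v * Real.log (Real.log v) := by ring
      _ ≤ |K| * v * Real.log (Real.log v) := by gcongr
      _ = |K| * Real.log (Real.log v) * v := by ring
      _ ≤ η * Real.log v * v := by gcongr
      _ = η * v * Real.log v := by ring
  · calc c j ^ 2 * Real.log (Real.log v)
        ≤ |K'| * Real.log v ^ 2 * Real.log v := by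
          refine mul_le_mul ((h2 j).trans ?_) hLL' hLL (by positivity)
          exact mul_le_mul (le_abs_self K') (by gcongr) (by positivity) (abs_nonneg K')
      _ = |K'| * Real.log v ^ 3 := by ring
      _ ≤ η * v := hB

lemma exists_erwWeight_sq_le {α : ℝ} (hα : -1 < α) :
    ∃ K, ∀ j : ℕ, erwWeight α (j + 1) ^ 2 ≤ K * ((j + 1 : ℕ) : ℝ) ^ 2 := by
  obtain ⟨K, hK⟩ := ((tendsto_erwWeight_succ_mul_rpow hα).pow 2).bddAbove_range
  refine ⟨K, fun j => ?_⟩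
  have hj : (1 : ℝ) ≤ (j : ℝ) + 1 := by linarith [j.cast_nonneg (α := ℝ)]
  have hKj := hK (Set.mem_range_self j)
  have h1 : 1 ≤ (((j : ℝ) + 1) ^ α) ^ 2 * ((j : ℝ) + 1) ^ 2 := by
    rw [← mul_pow, ← Real.rpow_add_one (by positivity)]
    exact one_le_pow₀ (Real.one_le_rpow hj (by linarith))
  push_cast
  calc erwWeight α (j + 1) ^ 2
      ≤ erwWeight α (j + 1) ^ 2 * ((((j : ℝ) + 1) ^ α) ^ 2 * ((j : ℝ) + 1) ^ 2) :=
        le_mul_of_one_le_right (sq_nonneg _) h1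
    _ = (erwWeight α (j + 1) * ((j : ℝ) + 1) ^ α) ^ 2 * ((j : ℝ) + 1) ^ 2 := by ring
    _ ≤ K * ((j : ℝ) + 1) ^ 2 := by gcongr

lemma exists_erwWeight_sq_mul_le {α l : ℝ} (hα : -1 < α)
    (h : Tendsto (fun n : ℕ => erwWeight α n ^ 2 * ((n : ℝ) + 1) /
      sumSq (fun j => erwWeight α (j + 1)) n) atTop (nhds l)) :
    ∃ K, ∀ j : ℕ, erwWeight α (j + 1) ^ 2 * ((j + 1 : ℕ) : ℝ) ≤
      K * sumSq (fun j => erwWeight α (j + 1)) (j + 1) := by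
  obtain ⟨K, hK⟩ := h.bddAbove_range
  refine ⟨K, fun j => ?_⟩
  have hpos : 0 < sumSq (fun j => erwWeight α (j + 1)) (j + 1) := by
    rw [sumSq_succ]
    exact add_pos_of_nonneg_of_pos (sumSq_nonneg _ _) (pow_pos (erwWeight_pos hα _) 2)
  refine le_trans ?_ ((div_le_iff₀ hpos).1 (hK (Set.mem_range_self (j + 1))))
  gcongr
  linarith

lemma tendsto_lilScale_div {V c m s : ℕ → ℝ} {l : ℝ} (hc : ∀ n, 0 < c n)
    (hm : ∀ᶠ n in atTop, 0 < m n) (hs : ∀ᶠ n in atTop, 0 < s n)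
    (hV : Tendsto (fun n => V n / (c n ^ 2 * m n)) atTop (nhds l))
    (hL : Tendsto (fun n => Real.log (Real.log (V n)) / s n) atTop (nhds 1)) :
    Tendsto (fun n => lilScale (V n) / (c n * √(2 * m n * s n))) atTop (nhds √l) := by
  have h1 := (hV.mul hL).sqrt
  rw [mul_one] at h1
  refine h1.congr' ?_
  filter_upwards [hm, hs] with n hm hs
  have hcn := hc n
  rw [lilScale, ← Real.sqrt_sq hcn.le, ← Real.sqrt_mul (sq_nonneg _),
    ← Real.sqrt_div' _ (by positivity), Real.sqrt_sq hcn.le]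
  congr 1
  field_simp

lemma tendsto_sumSq_div_sq_mul {α : ℝ} (hα : -1 < α) (hα' : α < 1 / 2) :
    Tendsto (fun n : ℕ => sumSq (fun j => erwWeight α (j + 1)) n /
      (erwWeight α n ^ 2 * ((n : ℝ) + 1))) atTop (nhds (1 / (1 - 2 * α))) := by
  have hΓ : Real.Gamma (1 + α) ^ 2 ≠ 0 := (pow_pos (Real.Gamma_pos_of_pos (by linarith)) 2).ne'
  have h := (tendsto_sumSq_div_rpow hα hα').div ((tendsto_erwWeight_mul_succ_rpow hα).pow 2) hΓ
  rw [div_right_comm, div_self hΓ] at h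
  refine h.congr fun n => ?_
  have hn : (0 : ℝ) < (n : ℝ) + 1 := by positivity
  have h1 : ((n : ℝ) + 1) ^ (1 - 2 * α) * (((n : ℝ) + 1) ^ α) ^ 2 = (n : ℝ) + 1 := by
    rw [← Real.rpow_natCast, ← Real.rpow_mul hn.le, ← Real.rpow_add hn]
    norm_num [mul_comm α]
  simp only [Pi.div_apply]
  rw [div_div, mul_pow, mul_left_comm, h1]

lemma tendsto_sumSq_div_sq_mul_log :
    Tendsto (fun n : ℕ => sumSq (fun j => erwWeight (1 / 2) (j + 1)) n /
      (erwWeight (1 / 2) n ^ 2 * (((n : ℝ) + 1) * Real.log ((n : ℝ) + 1)))) atTop (nhds 1) := by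
  have hΓ : Real.Gamma (1 + 1 / 2) ^ 2 ≠ 0 :=
    (pow_pos (Real.Gamma_pos_of_pos (by norm_num)) 2).ne'
  have h := tendsto_sumSq_div_log.div
    ((tendsto_erwWeight_mul_succ_rpow (α := 1 / 2) (by norm_num)).pow 2) hΓ
  rw [div_self hΓ] at h
  refine h.congr fun n => ?_
  have hn : (0 : ℝ) < (n : ℝ) + 1 := by positivity
  simp only [Pi.div_apply]
  rw [div_div, mul_pow, ← Real.sqrt_eq_rpow, Real.sq_sqrt hn.le]
  congr 1
  ring

namespace IsERW

variable {Ω : Type*} [MeasurableSpace Ω] {P : Measure Ω} {p q q' : ℝ} {X X' : ℕ → Ω → ℤ}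

theorem ae_limsup_of_lt [IsProbabilityMeasure P] (hX : IsERW P p q X) (hX' : IsERW P p q' X')
    (hindep : IndepFun (fun ω n => X n ω) (fun ω n => X' n ω) P) (hp0 : 0 < p) (hp : p < 3 / 4) :
    ∀ᵐ ω ∂P, limsup (fun n : ℕ => (position X n ω - position X' n ω) /
      √(2 * n * Real.log (Real.log n))) atTop = √2 / √(3 - 4 * p) := by
  have hα : -1 < 2 * p - 1 := by linarith
  have hα' : 2 * p - 1 < 1 / 2 := by linarith
  have hb : 0 < 1 - 2 * (2 * p - 1) := by linarith
  have hratio := tendsto_sumSq_div_sq_mul hα hα'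
  have hgrow := tendsto_sumSq_div_rpow hα hα'
  have hΓ : 0 < Real.Gamma (1 + (2 * p - 1)) ^ 2 / (1 - 2 * (2 * p - 1)) :=
    div_pos (pow_pos (Real.Gamma_pos_of_pos (by linarith)) 2) hb
  have hpow : Tendsto (fun n : ℕ => ((n : ℝ) + 1) ^ (1 - 2 * (2 * p - 1))) atTop atTop :=
    (tendsto_rpow_atTop hb).comp tendsto_natCast_add_one_atTop
  have hV : Tendsto (sumSq fun j => erwWeight (2 * p - 1) (j + 1)) atTop atTop := by
    refine (hgrow.pos_mul_atTop hΓ hpow).congr fun n => ?_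
    rw [div_mul_cancel₀ _ (by positivity)]
  have hinv := hratio.inv₀ (one_div_pos.2 hb).ne'
  simp only [inv_div] at hinv
  obtain ⟨K, hK⟩ := exists_erwWeight_sq_mul_le hα hinv
  obtain ⟨K', hK'⟩ := exists_erwWeight_sq_le hα
  have hlog : Tendsto (fun n : ℕ => Real.log ((n : ℝ) + 1)) atTop atTop :=
    Real.tendsto_log_atTop.comp tendsto_natCast_add_one_atTop
  have hlogV : Tendsto (fun n : ℕ => Real.log (sumSq (fun j => erwWeight (2 * p - 1) (j + 1)) n) /
      Real.log ((n : ℝ) + 1)) atTop (nhds (1 - 2 * (2 * p - 1))) := by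
    have h := (tendsto_log_div_log_of_tendsto_div hΓ hpow hgrow).const_mul (1 - 2 * (2 * p - 1))
    rw [mul_one] at h
    refine h.congr fun n => ?_
    rw [Real.log_rpow (by positivity), ← mul_div_assoc, mul_div_mul_left _ _ hb.ne']
  have hw := tendsto_lilScale_div (erwWeight_pos hα) (Eventually.of_forall fun n => by positivity)
    ((Real.tendsto_log_atTop.comp hlog).eventually_gt_atTop 0) hratio
    (tendsto_log_div_log_of_tendsto_div hb hlog hlogV)
  have h := hX.ae_limsup_position_sub_div hX' hindep hp0 hp.le
    (w := fun n : ℕ => √(2 * n * Real.log (Real.log n)))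
    (Real.sqrt_pos.2 (one_div_pos.2 hb)) hV (kolmogorovCondition_of_le hK hK') ⟨K, hK⟩
    (by simpa using hw)
  filter_upwards [h] with ω hω
  rw [hω, Real.sqrt_div zero_le_one, Real.sqrt_one, mul_one_div]
  congr 2
  ring

theorem ae_limsup_of_eq [IsProbabilityMeasure P] (hX : IsERW P (3 / 4) q X)
    (hX' : IsERW P (3 / 4) q' X')
    (hindep : IndepFun (fun ω n => X n ω) (fun ω n => X' n ω) P) :
    ∀ᵐ ω ∂P, limsup (fun n : ℕ => (position X n ω - position X' n ω) /
      √(2 * n * Real.log n * Real.log (Real.log (Real.log n)))) atTop = √2 := by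
  have hα : (-1 : ℝ) < 1 / 2 := by norm_num
  have hlog : Tendsto (fun n : ℕ => Real.log ((n : ℝ) + 1)) atTop atTop :=
    Real.tendsto_log_atTop.comp tendsto_natCast_add_one_atTop
  have hloglog := Real.tendsto_log_atTop.comp hlog
  have hratio := tendsto_sumSq_div_sq_mul_log
  have hgrow := tendsto_sumSq_div_log
  have hΓ : 0 < Real.Gamma (1 + 1 / 2) ^ 2 := pow_pos (Real.Gamma_pos_of_pos (by norm_num)) 2
  have hV : Tendsto (sumSq fun j => erwWeight (1 / 2) (j + 1)) atTop atTop := by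
    refine (hgrow.pos_mul_atTop hΓ hlog).congr' ?_
    filter_upwards [hlog.eventually_gt_atTop 0] with n hn
    rw [div_mul_cancel₀ _ hn.ne']
  have hinv : Tendsto (fun n : ℕ => erwWeight (1 / 2) n ^ 2 * ((n : ℝ) + 1) /
      sumSq (fun j => erwWeight (1 / 2) (j + 1)) n) atTop (nhds 0) := by
    refine ((hratio.inv₀ one_ne_zero).div_atTop hlog).congr' ?_
    filter_upwards [hlog.eventually_gt_atTop 0] with n hn
    rw [inv_div, ← mul_assoc, div_right_comm, mul_div_cancel_right₀ _ hn.ne']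
  obtain ⟨K, hK⟩ := exists_erwWeight_sq_mul_le hα hinv
  obtain ⟨K', hK'⟩ := exists_erwWeight_sq_le hα
  have hw := tendsto_lilScale_div (erwWeight_pos hα)
    ((tendsto_natCast_add_one_atTop.atTop_mul_atTop₀ hlog).eventually_gt_atTop 0)
    ((Real.tendsto_log_atTop.comp hloglog).eventually_gt_atTop 0) hratio
    (tendsto_log_div_log_of_tendsto_div one_pos hloglog
      (tendsto_log_div_log_of_tendsto_div hΓ hlog hgrow))
  have hhalf : (2 * (3 / 4) - 1 : ℝ) = 1 / 2 := by norm_num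
  have h := hX.ae_limsup_position_sub_div hX' hindep (by norm_num) le_rfl
    (w := fun n : ℕ => √(2 * n * Real.log n * Real.log (Real.log (Real.log n)))) one_pos
  rw [hhalf] at h
  have h' := h hV (kolmogorovCondition_of_le hK hK') ⟨K, hK⟩
    (by simpa [mul_assoc] using hw)
  simpa using h'

end IsERW

/-- Theorem 1 (Roy–Takei–Tanemura): for two independent ERWs with the same memory
parameter `p`, (a) if `0 < p < 3/4` then a.s.
`limsup_{n→∞} ±(S_n - S'_n)/√(2 n log log n) = √2/√(3-4p)`;
(b) if `p = 3/4` then a.s.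
`limsup_{n→∞} ±(S_n - S'_n)/√(2 n log n log log log n) = √2`. -/
theorem lil_two_erw_same_parameter {Ω : Type*} [MeasurableSpace Ω]
    (P : Measure Ω) [IsProbabilityMeasure P] (p q q' : ℝ)
    (hq0 : 0 ≤ q) (hq1 : q ≤ 1) (hq'0 : 0 ≤ q') (hq'1 : q' ≤ 1)
    (hp0 : 0 ≤ p) (hp1 : p ≤ 1)
    (X X' : ℕ → Ω → ℤ) (hX : IsERW P p q X) (hX' : IsERW P p q' X')
    (hindep : IndepFun (fun ω n => X n ω) (fun ω n => X' n ω) P)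
    (S S' : ℕ → Ω → ℤ)
    (hS : ∀ n ω, S n ω = ∑ i ∈ Finset.range n, X i ω)
    (hS' : ∀ n ω, S' n ω = ∑ i ∈ Finset.range n, X' i ω) :
    ((0 < p ∧ p < 3 / 4) →
      ∀ᵐ ω ∂P,
        limsup (fun n : ℕ =>
            ((S n ω - S' n ω : ℤ) : ℝ)
              / Real.sqrt (2 * n * Real.log (Real.log n))) atTop
          = Real.sqrt 2 / Real.sqrt (3 - 4 * p) ∧
        limsup (fun n : ℕ =>
            ((S' n ω - S n ω : ℤ) : ℝ)
              / Real.sqrt (2 * n * Real.log (Real.log n))) atTop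
          = Real.sqrt 2 / Real.sqrt (3 - 4 * p)) ∧
    (p = 3 / 4 →
      ∀ᵐ ω ∂P,
        limsup (fun n : ℕ =>
            ((S n ω - S' n ω : ℤ) : ℝ)
              / Real.sqrt (2 * n * Real.log n
                  * Real.log (Real.log (Real.log n)))) atTop
          = Real.sqrt 2 ∧
        limsup (fun n : ℕ =>
            ((S' n ω - S n ω : ℤ) : ℝ)
              / Real.sqrt (2 * n * Real.log n
                  * Real.log (Real.log (Real.log n)))) atTop
          = Real.sqrt 2) := by
  have hpos : ∀ n ω, ((S n ω - S' n ω : ℤ) : ℝ) = position X n ω - position X' n ω := by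
    intro n ω
    rw [hS, hS', position, position]
    push_cast
    rfl
  have hpos' : ∀ n ω, ((S' n ω - S n ω : ℤ) : ℝ) = position X' n ω - position X n ω := by
    intro n ω
    rw [hS, hS', position, position]
    push_cast
    rfl
  simp only [hpos, hpos']
  constructor
  · rintro ⟨h0, h1⟩
    exact (hX.ae_limsup_of_lt hX' hindep h0 h1).and (hX'.ae_limsup_of_lt hX hindep.symm h0 h1)
  · rintro rfl
    exact (hX.ae_limsup_of_eq hX' hindep).and (hX'.ae_limsup_of_eq hX hindep.symm)
end
end

section
/- Let {X(s)}_{s≥0} be a centered, sample-path continuous Gaussian process with covariance kernel R(s,t) satisfying assumption (i) (self-similarity of the kernel with exponent ρ > 0). Then almost surely limsup_{s→∞} X(s)/√(2 s^{2ρ} log log s) ≤ σ, where σ = R(1,1)^{1/2}. -/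
open MeasureTheory ProbabilityTheory Filter Asymptotics

noncomputable section

/-- A centered Gaussian process on `[0,∞)`: every finite linear combination of the
values of the process at nonnegative times has a centered Gaussian distribution. -/
def IsCenteredGaussianProcess {Ω : Type*} [MeasurableSpace Ω] (P : Measure Ω)
    (X : ℝ → Ω → ℝ) : Prop :=
  (∀ s : ℝ, Measurable (X s)) ∧
    ∀ (k : ℕ) (t : Fin k → ℝ) (c : Fin k → ℝ), (∀ i, 0 ≤ t i) →
      ∃ v : NNReal,
        Measure.map (fun ω => ∑ i, c i * X (t i) ω) P = gaussianReal 0 v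

open scoped ENNReal NNReal

lemma StrongDual.apply_pi_eq_sum {k : ℕ} (L : StrongDual ℝ (Fin k → ℝ)) (y : Fin k → ℝ) :
    L y = ∑ i, L (Pi.single i 1) * y i := by
  conv_lhs => rw [← Finset.univ_sum_single y, map_sum]
  refine Finset.sum_congr rfl fun i _ => ?_
  have : Pi.single i (y i) = y i • (Pi.single i 1 : Fin k → ℝ) := by
    rw [← Pi.single_smul]; simp
  rw [this, map_smul, smul_eq_mul, mul_comm]

/-- Fernique's tail bound with constants that do not depend on the Gaussian measure. -/
lemma exists_norm_tail_bound :
    ∃ κ : ℝ, 0 < κ ∧ ∃ C : ℝ≥0∞, C ≠ ∞ ∧ ∀ {k : ℕ} (μ : Measure (Fin k → ℝ)) [IsGaussian μ],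
      (∀ L : StrongDual ℝ (Fin k → ℝ), ∫ y, L y ∂μ = 0) → ∀ a : ℝ,
      3 / 4 ≤ μ {y | ‖y‖ ≤ a} → ∀ u : ℝ, 0 ≤ u →
      μ {y | u ≤ ‖y‖} ≤ C * ENNReal.ofReal (Real.exp (-(κ * a⁻¹ ^ 2 * u ^ 2))) := by
  have hgt : (2 : ℝ≥0∞)⁻¹ < 3 / 4 := by
    rw [← ENNReal.toReal_lt_toReal (by simp) (by finiteness)]; norm_num
  have hlt : (3 / 4 : ℝ≥0∞) < 1 := by
    rw [← ENNReal.toReal_lt_toReal (by finiteness) (by simp)]; norm_num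
  have hκ := Fernique.logRatio_pos hgt hlt
  refine ⟨Fernique.logRatio (3 / 4), hκ, ENNReal.ofReal (Real.exp (Fernique.logRatio (3 / 4)))
    + ∑' n, ENNReal.ofReal
      (Real.exp (-2⁻¹ * Real.log ((3 / 4) / (1 - 3 / 4) : ℝ≥0∞).toReal * 2 ^ n)), ?_, ?_⟩
  · refine (ENNReal.add_lt_top.mpr ⟨ENNReal.ofReal_lt_top, ?_⟩).ne
    refine Summable.tsum_ofReal_lt_top <|
      Real.summable_exp_nat_mul_of_ge ?_ (fun i ↦ mod_cast (Nat.lt_pow_self (by simp)).le)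
    refine mul_neg_of_neg_of_pos (by simp) (Real.log_pos ?_)
    rw [ENNReal.toReal_div, ENNReal.toReal_sub_of_le hlt.le (by simp)]
    norm_num
  · intro k μ _ hμ a h u hu
    have hrot := IsGaussian.map_rotation_eq_self_of_forall_strongDual_eq_zero hμ
      (-(Real.pi / 4))
    have hint := lintegral_exp_mul_sq_norm_le_of_map_rotation_eq_self hrot h hgt
    have hmarkov := (mul_meas_ge_le_lintegral (μ := μ) (f := fun y : Fin k → ℝ => ENNReal.ofReal
      (Real.exp (Fernique.logRatio (3 / 4) * a⁻¹ ^ 2 * ‖y‖ ^ 2))) (by fun_prop)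
      (ENNReal.ofReal (Real.exp (Fernique.logRatio (3 / 4) * a⁻¹ ^ 2 * u ^ 2)))).trans hint
    have hsub : {y : Fin k → ℝ | u ≤ ‖y‖} ⊆ {y | ENNReal.ofReal
        (Real.exp (Fernique.logRatio (3 / 4) * a⁻¹ ^ 2 * u ^ 2)) ≤ ENNReal.ofReal
        (Real.exp (Fernique.logRatio (3 / 4) * a⁻¹ ^ 2 * ‖y‖ ^ 2))} := by
      intro y hy
      have hy : u ≤ ‖y‖ := hy
      apply ENNReal.ofReal_le_ofReal
      gcongr
    refine (measure_mono hsub).trans ?_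
    rw [Real.exp_neg, ENNReal.ofReal_inv_of_pos (Real.exp_pos _), ← div_eq_mul_inv,
      ENNReal.le_div_iff_mul_le (Or.inl (by positivity)) (Or.inl (by simp)), mul_comm]
    exact hmarkov

section

variable {Ω : Type*} [MeasurableSpace Ω] {P : Measure Ω} {X : ℝ → Ω → ℝ}

namespace IsCenteredGaussianProcess

lemma exists_map_eq_gaussianReal (h : IsCenteredGaussianProcess P X) {t : ℝ} (ht : 0 ≤ t) :
    ∃ v : ℝ≥0, P.map (X t) = gaussianReal 0 v := by
  simpa using h.2 1 (fun _ => t) (fun _ => 1) (fun _ => ht)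

lemma memLp_two (h : IsCenteredGaussianProcess P X) {t : ℝ} (ht : 0 ≤ t) : MemLp (X t) 2 P := by
  obtain ⟨v, hv⟩ := h.exists_map_eq_gaussianReal ht
  have : HasLaw (X t) (gaussianReal 0 v) P := ⟨(h.1 t).aemeasurable, hv⟩
  exact this.hasGaussianLaw.memLp_two

/-- The law of a linear combination is determined by the covariance kernel. -/
lemma map_sum_eq (h : IsCenteredGaussianProcess P X) {R : ℝ → ℝ → ℝ}
    (hR : ∀ s t : ℝ, 0 ≤ s → 0 ≤ t → R s t = ∫ ω, X s ω * X t ω ∂P)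
    {k : ℕ} (t c : Fin k → ℝ) (ht : ∀ i, 0 ≤ t i) :
    P.map (fun ω => ∑ i, c i * X (t i) ω) =
      gaussianReal 0 (∑ i, ∑ j, c i * c j * R (t i) (t j)).toNNReal := by
  obtain ⟨v, hv⟩ := h.2 k t c ht
  rw [hv]
  congr 1
  have hm : Measurable (fun ω => ∑ i, c i * X (t i) ω) :=
    Finset.measurable_sum _ fun i _ => (h.1 _).const_mul _
  have hsq : ∫ x, x ^ 2 ∂(gaussianReal 0 v) = v := by
    have := variance_fun_id_gaussianReal (μ := 0) (v := v)
    rw [variance_of_integral_eq_zero (by fun_prop) (by simp)] at this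
    exact this
  rw [← hv, integral_map hm.aemeasurable (by fun_prop)] at hsq
  have hexp : ∫ ω, (∑ i, c i * X (t i) ω) ^ 2 ∂P = ∑ i, ∑ j, c i * c j * R (t i) (t j) := by
    have hint : ∀ i j, Integrable (fun ω => c i * X (t i) ω * (c j * X (t j) ω)) P := fun i j =>
      ((h.memLp_two (ht i)).const_mul (c i)).integrable_mul ((h.memLp_two (ht j)).const_mul (c j))
    simp_rw [pow_two, Finset.sum_mul_sum]
    rw [integral_finsetSum _ fun i _ => integrable_finsetSum _ fun j _ => hint i j]
    refine Finset.sum_congr rfl fun i _ => ?_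
    rw [integral_finsetSum _ fun j _ => hint i j]
    refine Finset.sum_congr rfl fun j _ => ?_
    rw [hR _ _ (ht i) (ht j), ← integral_const_mul]
    refine integral_congr_ae (ae_of_all _ fun ω => ?_)
    simp only
    ring
  rw [← hexp, hsq, Real.toNNReal_coe]

/-- Self-similarity of the covariance kernel gives self-similarity of the finite-dimensional
laws. -/
lemma map_scale_eq [IsProbabilityMeasure P] (h : IsCenteredGaussianProcess P X)
    {R : ℝ → ℝ → ℝ} {ρ : ℝ}
    (hR : ∀ s t : ℝ, 0 ≤ s → 0 ≤ t → R s t = ∫ ω, X s ω * X t ω ∂P)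
    (hss : ∀ c > (0 : ℝ), ∀ s > (0 : ℝ), ∀ t > (0 : ℝ), R (c * s) (c * t) = c ^ (2 * ρ) * R s t)
    {k : ℕ} (t : Fin k → ℝ) (ht : ∀ i, 0 < t i) {c : ℝ} (hc : 0 < c) :
    P.map (fun ω i => X (c * t i) ω) = P.map (fun ω i => c ^ ρ * X (t i) ω) := by
  have hm₁ : Measurable (fun ω (i : Fin k) => X (c * t i) ω) :=
    measurable_pi_lambda _ fun i => h.1 _
  have hm₂ : Measurable (fun ω (i : Fin k) => c ^ ρ * X (t i) ω) :=
    measurable_pi_lambda _ fun i => (h.1 _).const_mul _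
  have := Measure.isProbabilityMeasure_map (μ := P) hm₁.aemeasurable
  have := Measure.isProbabilityMeasure_map (μ := P) hm₂.aemeasurable
  refine Measure.ext_of_charFunDual ?_
  ext L
  rw [charFunDual_eq_charFun_map_one, charFunDual_eq_charFun_map_one]
  congr 1
  rw [Measure.map_map (by fun_prop) hm₁, Measure.map_map (by fun_prop) hm₂]
  have h₁ := h.map_sum_eq hR (fun i => c * t i) (fun i => L (Pi.single i 1))
    fun i => (mul_pos hc (ht i)).le
  have h₂ := h.map_sum_eq hR t (fun i => L (Pi.single i 1) * c ^ ρ) fun i => (ht i).le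
  convert h₁.trans (Eq.trans ?_ h₂.symm) using 2
  · funext ω
    simp only [Function.comp_apply]
    rw [L.apply_pi_eq_sum]
  · funext ω
    simp only [Function.comp_apply]
    rw [L.apply_pi_eq_sum]
    exact Finset.sum_congr rfl fun i _ => by ring
  · congr 2
    refine Finset.sum_congr rfl fun i _ => Finset.sum_congr rfl fun j _ => ?_
    rw [hss c hc _ (ht i) _ (ht j), two_mul, Real.rpow_add hc]
    ring

/-- The vector of increments from a base time is a centered Gaussian vector. -/
lemma isGaussian_map_sub [IsProbabilityMeasure P] (h : IsCenteredGaussianProcess P X)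
    {k : ℕ} (t : Fin k → ℝ) (ht : ∀ i, 0 ≤ t i) {s : ℝ} (hs : 0 ≤ s) :
    IsGaussian (P.map (fun ω i => X (t i) ω - X s ω)) ∧
      ∀ L : StrongDual ℝ (Fin k → ℝ), ∫ y, L y ∂(P.map (fun ω i => X (t i) ω - X s ω)) = 0 := by
  have hm : Measurable (fun ω (i : Fin k) => X (t i) ω - X s ω) :=
    measurable_pi_lambda _ fun i => (h.1 _).sub (h.1 _)
  have key : ∀ L : StrongDual ℝ (Fin k → ℝ), ∃ v : ℝ≥0,
      (P.map (fun ω i => X (t i) ω - X s ω)).map L = gaussianReal 0 v := by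
    intro L
    obtain ⟨v, hv⟩ := h.2 (k + 1) (Fin.cons s t)
      (Fin.cons (-∑ i, L (Pi.single i 1)) fun i => L (Pi.single i 1))
      (fun i => Fin.cases hs ht i)
    refine ⟨v, ?_⟩
    rw [Measure.map_map (by fun_prop) hm, ← hv]
    congr 1
    funext ω
    simp only [Function.comp_apply, Fin.sum_univ_succ, Fin.cons_zero, Fin.cons_succ]
    rw [L.apply_pi_eq_sum]
    simp only [mul_sub, Finset.sum_sub_distrib]
    rw [neg_mul, Finset.sum_mul]
    ring
  refine ⟨isGaussian_of_map_eq_gaussianReal fun L => ⟨0, key L⟩, fun L => ?_⟩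
  obtain ⟨v, hv⟩ := key L
  have := integral_id_gaussianReal (μ := 0) (v := v)
  rwa [← hv, integral_map (by fun_prop) (by fun_prop)] at this

/-- The tail of a single value of a self-similar centered Gaussian process. -/
lemma measure_value_tail_le [IsProbabilityMeasure P] (h : IsCenteredGaussianProcess P X)
    {R : ℝ → ℝ → ℝ} {ρ : ℝ}
    (hR : ∀ s t : ℝ, 0 ≤ s → 0 ≤ t → R s t = ∫ ω, X s ω * X t ω ∂P)
    (hss : ∀ c > (0 : ℝ), ∀ s > (0 : ℝ), ∀ t > (0 : ℝ), R (c * s) (c * t) = c ^ (2 * ρ) * R s t)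
    {v : ℝ≥0} (hv : R 1 1 ≤ v) {c : ℝ} (hc : 0 < c) {u : ℝ} (hu : 0 ≤ u) :
    P {ω | c ^ ρ * u ≤ X c ω} ≤ ENNReal.ofReal (Real.exp (-u ^ 2 / (2 * v))) := by
  have hlaw : P.map (X c) = gaussianReal 0 (c ^ (2 * ρ) * R 1 1).toNNReal := by
    have := h.map_sum_eq hR (k := 1) (fun _ => c) (fun _ => 1) (fun _ => hc.le)
    have hcc := hss c hc 1 one_pos 1 one_pos
    rw [mul_one] at hcc
    simpa [hcc] using this
  have hcρ : 0 < c ^ ρ := Real.rpow_pos_of_pos hc ρ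
  have hsub : HasSubgaussianMGF (X c) ((c ^ (2 * ρ)).toNNReal * v) P := by
    constructor
    · intro t
      have : Integrable (fun x => Real.exp (t * x)) (P.map (X c)) := by
        rw [hlaw]; exact integrable_exp_mul_gaussianReal t
      exact this.comp_measurable (h.1 c)
    · intro t
      rw [mgf_gaussianReal hlaw, zero_mul, zero_add]
      gcongr
      rw [Real.toNNReal_mul (by positivity)]
      gcongr
      exact Real.toNNReal_le_iff_le_coe.2 hv
  have hmain := hsub.measure_ge_le (ε := c ^ ρ * u) (by positivity)
  rw [← ENNReal.ofReal_toReal (measure_ne_top P {ω | c ^ ρ * u ≤ X c ω})]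
  refine ENNReal.ofReal_le_ofReal (hmain.trans_eq ?_)
  congr 1
  have : ((c ^ (2 * ρ)).toNNReal : ℝ) = (c ^ ρ) ^ 2 := by
    rw [Real.coe_toNNReal _ (by positivity), two_mul, Real.rpow_add hc, pow_two]
  rw [NNReal.coe_mul, this]
  field_simp

/-- Continuous paths oscillate little near time `1`, with large probability. -/
lemma exists_oscillation_le [IsProbabilityMeasure P]
    (hcont : ∀ᵐ ω ∂P, ContinuousOn (fun s : ℝ => X s ω) (Set.Ici (0 : ℝ))) {a : ℝ} (ha : 0 < a) :
    ∃ l : ℝ, 1 < l ∧ 3 / 4 ≤ P {ω | ∀ s ∈ Set.Icc 1 l, |X s ω - X 1 ω| ≤ a} := by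
  let A : ℕ → Set Ω := fun m => {ω | ∀ s ∈ Set.Icc 1 (1 + 1 / ((m : ℝ) + 1)), |X s ω - X 1 ω| ≤ a}
  have hA : Monotone A := by
    intro m n hmn ω hω s hs
    refine hω s ⟨hs.1, hs.2.trans ?_⟩
    gcongr
  have hU : P (⋃ m, A m) = 1 := by
    refine le_antisymm prob_le_one ?_
    rw [← measure_univ (μ := P)]
    refine measure_mono_ae (t := ⋃ m, A m) ?_
    filter_upwards [hcont] with ω hω _
    obtain ⟨δ, hδ, hδa⟩ := Metric.continuousOn_iff.1 hω 1 (Set.mem_Ici.2 zero_le_one) a ha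
    obtain ⟨m, hm⟩ := exists_nat_one_div_lt hδ
    refine Set.mem_iUnion.2 ⟨m, fun s hs => (hδa s (zero_le_one.trans hs.1) ?_).le⟩
    rw [Real.dist_eq, abs_of_nonneg (by linarith [hs.1])]
    linarith [hs.2]
  have hlt : (3 / 4 : ℝ≥0∞) < 1 := by
    rw [← ENNReal.toReal_lt_toReal (by finiteness) (by simp)]; norm_num
  rw [hA.measure_iUnion] at hU
  rw [← hU] at hlt
  obtain ⟨m, hm⟩ := lt_iSup_iff.1 hlt
  exact ⟨1 + 1 / ((m : ℝ) + 1), by simp; positivity, hm.le⟩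

/-- A tail bound for the increments over `[c, c * l]`, at finitely many times. -/
lemma measure_finite_increment_tail_le [IsProbabilityMeasure P] (h : IsCenteredGaussianProcess P X)
    {R : ℝ → ℝ → ℝ} {ρ : ℝ}
    (hR : ∀ s t : ℝ, 0 ≤ s → 0 ≤ t → R s t = ∫ ω, X s ω * X t ω ∂P)
    (hss : ∀ c > (0 : ℝ), ∀ s > (0 : ℝ), ∀ t > (0 : ℝ), R (c * s) (c * t) = c ^ (2 * ρ) * R s t)
    {k : ℕ} (t : Fin k → ℝ) (ht : ∀ i, 0 < t i) {c : ℝ} (hc : 0 < c) (u : ℝ) :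
    P {ω | ∃ i, c ^ ρ * u < X (c * t i) ω - X c ω} ≤
      P.map (fun ω i => X (t i) ω - X 1 ω) {y | u ≤ ‖y‖} := by
  have hcρ : 0 < c ^ ρ := Real.rpow_pos_of_pos hc ρ
  let S : Set (Fin (k + 1) → ℝ) := {z | ∃ i : Fin k, c ^ ρ * u < z i.succ - z 0}
  have hS : MeasurableSet S := by
    have : S = ⋃ i : Fin k, {z | c ^ ρ * u < z i.succ - z 0} := by ext; simp [S]
    rw [this]
    exact MeasurableSet.iUnion fun i => measurableSet_lt (by fun_prop) (by fun_prop)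
  have hlaw := congrArg (fun μ => μ S) (h.map_scale_eq hR hss (Fin.cons 1 t : Fin (k + 1) → ℝ)
    (fun i => Fin.cases one_pos ht i) hc)
  rw [Measure.map_apply (measurable_pi_lambda _ fun i => h.1 _) hS,
    Measure.map_apply (measurable_pi_lambda _ fun i => (h.1 _).const_mul _) hS] at hlaw
  have hm : Measurable (fun ω (i : Fin k) => X (t i) ω - X 1 ω) :=
    measurable_pi_lambda _ fun i => (h.1 _).sub (h.1 _)
  rw [Measure.map_apply hm (measurableSet_le (by fun_prop) (by fun_prop))]
  have hleft : {ω | ∃ i, c ^ ρ * u < X (c * t i) ω - X c ω} =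
      (fun ω i => X (c * (Fin.cons 1 t : Fin (k + 1) → ℝ) i) ω) ⁻¹' S := by
    ext ω; simp [S]
  rw [hleft, hlaw]
  refine measure_mono ?_
  rintro ω ⟨i, hi⟩
  simp only [Fin.cons_succ, Fin.cons_zero, ← mul_sub] at hi
  have hi' := lt_of_mul_lt_mul_left hi hcρ.le
  exact (hi'.le.trans (le_abs_self _)).trans
    (norm_le_pi_norm (fun i => X (t i) ω - X 1 ω) i)

/-- A tail bound for the supremum of the increments over `[c, c * l]`. -/
lemma exists_increment_tail_bound [IsProbabilityMeasure P] (h : IsCenteredGaussianProcess P X)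
    (hcont : ∀ᵐ ω ∂P, ContinuousOn (fun s : ℝ => X s ω) (Set.Ici (0 : ℝ)))
    {R : ℝ → ℝ → ℝ} {ρ : ℝ}
    (hR : ∀ s t : ℝ, 0 ≤ s → 0 ≤ t → R s t = ∫ ω, X s ω * X t ω ∂P)
    (hss : ∀ c > (0 : ℝ), ∀ s > (0 : ℝ), ∀ t > (0 : ℝ), R (c * s) (c * t) = c ^ (2 * ρ) * R s t)
    {q : ℝ} (hq : 0 < q) :
    ∃ l : ℝ, 1 < l ∧ ∃ C : ℝ≥0∞, C ≠ ∞ ∧ ∀ c : ℝ, 0 < c → ∀ u : ℝ, 0 ≤ u →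
      P {ω | ∃ s ∈ Set.Icc c (c * l), c ^ ρ * u < X s ω - X c ω} ≤
        C * ENNReal.ofReal (Real.exp (-(q * u ^ 2))) := by
  obtain ⟨κ, hκ, C, hC, hbound⟩ := exists_norm_tail_bound
  let a := √(κ / q)
  have ha : 0 < a := Real.sqrt_pos.2 (by positivity)
  obtain ⟨l, hl, hosc⟩ := exists_oscillation_le hcont ha
  refine ⟨l, hl, C, hC, fun c hc u hu => ?_⟩
  have hq' : κ * a⁻¹ ^ 2 = q := by
    rw [inv_pow, Real.sq_sqrt (by positivity)]; field_simp
  have : Nonempty (Set.Icc 1 l) := ⟨⟨1, le_rfl, hl.le⟩⟩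
  let d : ℕ → Set.Icc 1 l := TopologicalSpace.denseSeq _
  have hd : ∀ i, (0 : ℝ) < d i := fun i => one_pos.trans_le (d i).2.1
  let E : ℕ → Set Ω := fun k => {ω | ∃ i : Fin k, c ^ ρ * u < X (c * d i) ω - X c ω}
  have hE : Monotone E := by
    rintro m n hmn ω ⟨i, hi⟩
    exact ⟨i.castLE hmn, hi⟩
  have hEle : ∀ k, P (E k) ≤ C * ENNReal.ofReal (Real.exp (-(q * u ^ 2))) := by
    intro k
    refine (h.measure_finite_increment_tail_le hR hss (fun i : Fin k => (d i : ℝ))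
      (fun i => hd i) hc u).trans ?_
    obtain ⟨hG, h0⟩ := h.isGaussian_map_sub (fun i : Fin k => (d i : ℝ))
      (fun i => (hd i).le) zero_le_one
    rw [← hq']
    refine hbound _ h0 a ?_ u hu
    have hm : Measurable (fun ω (i : Fin k) => X (d i) ω - X 1 ω) :=
      measurable_pi_lambda _ fun i => (h.1 _).sub (h.1 _)
    rw [Measure.map_apply hm (measurableSet_le (by fun_prop) (by fun_prop))]
    refine hosc.trans (measure_mono fun ω hω => ?_)
    exact (pi_norm_le_iff_of_nonneg ha.le).2 fun i => hω _ (d i).2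
  have hsub : ∀ᵐ ω ∂P, ω ∈ {ω | ∃ s ∈ Set.Icc c (c * l), c ^ ρ * u < X s ω - X c ω} →
      ω ∈ ⋃ k, E k := by
    filter_upwards [hcont] with ω hω
    rintro ⟨s, hs, hsu⟩
    have hf : Continuous (fun r : Set.Icc 1 l => X (c * r) ω - X c ω) := by
      refine Continuous.sub ?_ continuous_const
      refine hω.comp_continuous (by fun_prop) fun r => ?_
      exact (mul_pos hc (one_pos.trans_le r.2.1)).le
    obtain ⟨i, hi⟩ := (TopologicalSpace.denseRange_denseSeq (Set.Icc 1 l)).exists_mem_open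
      (isOpen_lt continuous_const hf)
      ⟨⟨s / c, (one_le_div hc).2 hs.1, (div_le_iff₀' hc).2 hs.2⟩, by
        simpa [mul_div_cancel₀ s hc.ne', mul_div_cancel_left₀] using hsu⟩
    exact Set.mem_iUnion.2 ⟨i + 1, Fin.last i, hi⟩
  refine (measure_mono_ae (t := ⋃ k, E k) hsub).trans ?_
  rw [hE.measure_iUnion]
  exact iSup_le hEle

/-- A tail bound for the supremum of the process over `[c, c * l]`, with an exponent that is
sharp up to the choice of `l`. -/
lemma exists_sup_tail_bound [IsProbabilityMeasure P] (h : IsCenteredGaussianProcess P X)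
    (hcont : ∀ᵐ ω ∂P, ContinuousOn (fun s : ℝ => X s ω) (Set.Ici (0 : ℝ)))
    {R : ℝ → ℝ → ℝ} {ρ : ℝ}
    (hR : ∀ s t : ℝ, 0 ≤ s → 0 ≤ t → R s t = ∫ ω, X s ω * X t ω ∂P)
    (hss : ∀ c > (0 : ℝ), ∀ s > (0 : ℝ), ∀ t > (0 : ℝ), R (c * s) (c * t) = c ^ (2 * ρ) * R s t)
    {ε : ℝ} (hε : 0 < ε) :
    ∃ l : ℝ, 1 < l ∧ ∃ C : ℝ≥0∞, C ≠ ∞ ∧ ∃ p : ℝ, 1 < p ∧ ∀ c : ℝ, 0 < c → ∀ b : ℝ, 0 ≤ b →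
      P {ω | ∃ s ∈ Set.Icc c (c * l), c ^ ρ * ((√(R 1 1) + 2 * ε) * b) < X s ω} ≤
        C * ENNReal.ofReal (Real.exp (-(p * (b ^ 2 / 2)))) := by
  set σ := √(R 1 1) with hσ
  have hσ0 : 0 ≤ σ := Real.sqrt_nonneg _
  let v : ℝ≥0 := ⟨(σ + ε / 2) ^ 2, sq_nonneg _⟩
  have hvc : (v : ℝ) = (σ + ε / 2) ^ 2 := rfl
  have hR0 : 0 ≤ R 1 1 := by
    rw [hR 1 1 zero_le_one zero_le_one]
    exact integral_nonneg fun ω => mul_self_nonneg _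
  have hv : R 1 1 ≤ v := by
    rw [hvc, ← Real.sq_sqrt hR0, ← hσ]
    gcongr
    linarith
  let p := ((σ + ε) / (σ + ε / 2)) ^ 2
  have hp : 1 < p := by
    refine one_lt_pow₀ ?_ two_ne_zero
    rw [one_lt_div (by positivity)]
    linarith
  obtain ⟨l, hl, C, hC, hbound⟩ :=
    h.exists_increment_tail_bound hcont hR hss (q := p / (2 * ε ^ 2)) (by positivity)
  refine ⟨l, hl, 1 + C, by finiteness, p, hp, fun c hc b hb => ?_⟩
  have hsub : {ω | ∃ s ∈ Set.Icc c (c * l), c ^ ρ * ((σ + 2 * ε) * b) < X s ω} ⊆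
      {ω | c ^ ρ * ((σ + ε) * b) ≤ X c ω} ∪
        {ω | ∃ s ∈ Set.Icc c (c * l), c ^ ρ * (ε * b) < X s ω - X c ω} := by
    rintro ω ⟨s, hs, hsu⟩
    rcases le_or_gt (c ^ ρ * ((σ + ε) * b)) (X c ω) with h1 | h1
    · exact Or.inl h1
    · exact Or.inr ⟨s, hs, by linarith⟩
  refine (measure_mono hsub).trans ((measure_union_le _ _).trans ?_)
  rw [add_mul (1 : ℝ≥0∞) C, one_mul]
  refine add_le_add ((h.measure_value_tail_le hR hss hv hc (by positivity)).trans_eq ?_)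
    ((hbound c hc (ε * b) (by positivity)).trans_eq ?_)
  · rw [hvc]
    congr 2
    simp only [p]
    field_simp
  · congr 3
    field_simp

end IsCenteredGaussianProcess

/-- For the geometric grid `l ^ n`, the tails appearing in the Borel–Cantelli argument are
summable. -/
lemma tsum_exp_neg_mul_log_ne_top {L p : ℝ} (hL : 0 < L) (hp : 1 < p) {N : ℕ}
    (hN : 0 < N) :
    ∑' n : ℕ, ENNReal.ofReal (Real.exp (-(p * Real.log (((n + N : ℕ) : ℝ) * L)))) ≠ ∞ := by
  have hs : Summable fun n : ℕ => L ^ (-p) * ((n + N : ℕ) : ℝ) ^ (-p) :=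
    ((summable_nat_add_iff N).2 (Real.summable_nat_rpow.2 (by linarith))).mul_left _
  refine ne_of_lt (lt_of_eq_of_lt (tsum_congr fun n => ?_) hs.tsum_ofReal_lt_top)
  have hn : (0 : ℝ) < ((n + N : ℕ) : ℝ) := by exact_mod_cast (by omega : 0 < n + N)
  congr 1
  rw [mul_comm (L ^ (-p)), ← Real.mul_rpow hn.le hL.le, Real.rpow_def_of_pos (by positivity)]
  congr 1
  ring

lemma IsCenteredGaussianProcess.ae_eventually_le [IsProbabilityMeasure P]
    (h : IsCenteredGaussianProcess P X)
    (hcont : ∀ᵐ ω ∂P, ContinuousOn (fun s : ℝ => X s ω) (Set.Ici (0 : ℝ)))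
    {R : ℝ → ℝ → ℝ} {ρ : ℝ} (hρ : 0 < ρ)
    (hR : ∀ s t : ℝ, 0 ≤ s → 0 ≤ t → R s t = ∫ ω, X s ω * X t ω ∂P)
    (hss : ∀ c > (0 : ℝ), ∀ s > (0 : ℝ), ∀ t > (0 : ℝ), R (c * s) (c * t) = c ^ (2 * ρ) * R s t)
    {ε : ℝ} (hε : 0 < ε) :
    ∀ᵐ ω ∂P, ∀ᶠ s : ℝ in atTop,
      X s ω / √(2 * s ^ (2 * ρ) * Real.log (Real.log s)) ≤ √(R 1 1) + 2 * ε := by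
  obtain ⟨l, hl, C, hC, p, hp, hbound⟩ := h.exists_sup_tail_bound hcont hR hss hε
  have hL : 0 < Real.log l := Real.log_pos hl
  have hl0 : 0 < l := one_pos.trans hl
  obtain ⟨N, hN⟩ := exists_nat_gt (Real.log l)⁻¹
  have hN1 : 1 < (N : ℝ) * Real.log l := (inv_lt_iff_one_lt_mul₀ hL).1 hN
  have hN0 : 0 < N := by
    rcases Nat.eq_zero_or_pos N with h0 | h0
    · simp [h0] at hN1; linarith
    · exact h0
  let b : ℕ → ℝ := fun n => √(2 * Real.log ((n : ℝ) * Real.log l))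
  let B : ℕ → Set Ω := fun n =>
    {ω | ∃ s ∈ Set.Icc (l ^ n) (l ^ n * l), (l ^ n) ^ ρ * ((√(R 1 1) + 2 * ε) * b n) < X s ω}
  have hlogpos : ∀ n : ℕ, N ≤ n → 0 < Real.log ((n : ℝ) * Real.log l) := fun n hn => by
    refine Real.log_pos (hN1.trans_le ?_)
    gcongr
  have hB : ∀ n, P (B (n + N)) ≤
      C * ENNReal.ofReal (Real.exp (-(p * Real.log (((n + N : ℕ) : ℝ) * Real.log l)))) := by
    intro n
    refine (hbound (l ^ (n + N)) (by positivity) (b (n + N)) (Real.sqrt_nonneg _)).trans_eq ?_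
    have := hlogpos (n + N) (by omega)
    rw [Real.sq_sqrt (by positivity), mul_div_cancel_left₀ _ two_ne_zero]
  have hsum : ∑' n, P (B (n + N)) ≠ ∞ := by
    refine ne_top_of_le_ne_top ?_ (ENNReal.tsum_le_tsum hB)
    rw [ENNReal.tsum_mul_left]
    exact ENNReal.mul_ne_top hC (tsum_exp_neg_mul_log_ne_top hL hp hN0)
  filter_upwards [ae_eventually_notMem hsum] with ω hω
  obtain ⟨M, hM⟩ := eventually_atTop.1 hω
  filter_upwards [eventually_ge_atTop (l ^ (M + N)), eventually_ge_atTop 1] with s hs hs1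
  obtain ⟨n, hn1, hn2⟩ := exists_nat_pow_near hs1 hl
  have hMn : M + N ≤ n := by
    have : l ^ (M + N) < l ^ (n + 1) := hs.trans_lt hn2
    have := (pow_lt_pow_iff_right₀ hl).1 this
    omega
  have hnot := hM (n - N) (by omega)
  rw [Nat.sub_add_cancel (by omega)] at hnot
  have hX : X s ω ≤ (l ^ n) ^ ρ * ((√(R 1 1) + 2 * ε) * b n) := by
    by_contra hcon
    exact hnot ⟨s, ⟨hn1, by rw [← pow_succ]; exact hn2.le⟩, not_le.1 hcon⟩
  have hs0 : 0 < s := one_pos.trans_le hs1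
  have hnlog := hlogpos n (by omega)
  have hnL : 0 < (n : ℝ) * Real.log l := by
    have : (0 : ℝ) < n := by exact_mod_cast (by omega : 0 < n)
    positivity
  have hlog : Real.log ((n : ℝ) * Real.log l) ≤ Real.log (Real.log s) := by
    refine Real.log_le_log hnL ?_
    rw [← Real.log_pow]
    exact Real.log_le_log (by positivity) hn1
  have hden : √(2 * s ^ (2 * ρ) * Real.log (Real.log s)) =
      s ^ ρ * √(2 * Real.log (Real.log s)) := by
    rw [mul_right_comm, mul_comm, Real.sqrt_mul (by positivity), two_mul, Real.rpow_add hs0,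
      Real.sqrt_mul_self (by positivity)]
  have hpos : 0 < Real.log (Real.log s) := hnlog.trans_le hlog
  rw [hden, div_le_iff₀ (by positivity)]
  calc X s ω ≤ (l ^ n) ^ ρ * ((√(R 1 1) + 2 * ε) * b n) := hX
    _ ≤ s ^ ρ * ((√(R 1 1) + 2 * ε) * √(2 * Real.log (Real.log s))) := by
      gcongr
      exact Real.sqrt_le_sqrt (by linarith)
    _ = _ := by ring

end

lemma Real.limsup_le_of_forall_pos_eventually_le {α : Type*} {F : Filter α} {f : α → ℝ} {σ : ℝ}
    (hσ : 0 ≤ σ) (hf : ∀ ε > 0, ∀ᶠ x in F, f x ≤ σ + ε) : limsup f F ≤ σ := by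
  rw [limsup_eq]
  by_cases hb : BddBelow {a | ∀ᶠ x in F, f x ≤ a}
  · exact le_of_forall_pos_le_add fun ε hε => csInf_le hb (hf ε hε)
  · rw [Real.sInf_of_not_bddBelow hb]
    exact hσ

/-- Proposition 1 (upper bound in the LIL): under the self-similarity of the kernel
with exponent `ρ > 0`, almost surely
`limsup_{s→∞} X(s)/√(2 s^{2ρ} log log s) ≤ σ = R(1,1)^{1/2}`. -/
theorem lil_upper_bound {Ω : Type*} [MeasurableSpace Ω] (P : Measure Ω)
    [IsProbabilityMeasure P] (X : ℝ → Ω → ℝ) (R : ℝ → ℝ → ℝ) (ρ : ℝ) (hρ : 0 < ρ)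
    (hGauss : IsCenteredGaussianProcess P X)
    (hcont : ∀ᵐ ω ∂P, ContinuousOn (fun s : ℝ => X s ω) (Set.Ici (0 : ℝ)))
    (hR : ∀ s t : ℝ, 0 ≤ s → 0 ≤ t → R s t = ∫ ω, X s ω * X t ω ∂P)
    (hss : ∀ c > (0 : ℝ), ∀ s > (0 : ℝ), ∀ t > (0 : ℝ),
      R (c * s) (c * t) = c ^ (2 * ρ) * R s t) :
    ∀ᵐ ω ∂P,
      limsup (fun s : ℝ =>
          X s ω / Real.sqrt (2 * s ^ (2 * ρ) * Real.log (Real.log s))) atTop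
        ≤ Real.sqrt (R 1 1) := by
  have hall : ∀ᵐ ω ∂P, ∀ n : ℕ, ∀ᶠ s : ℝ in atTop,
      X s ω / Real.sqrt (2 * s ^ (2 * ρ) * Real.log (Real.log s)) ≤
        Real.sqrt (R 1 1) + 2 * (1 / ((n : ℝ) + 1)) :=
    ae_all_iff.2 fun n => hGauss.ae_eventually_le hcont hρ hR hss Nat.one_div_pos_of_nat
  filter_upwards [hall] with ω hω
  refine Real.limsup_le_of_forall_pos_eventually_le (Real.sqrt_nonneg _) fun ε hε => ?_
  obtain ⟨n, hn⟩ := exists_nat_one_div_lt (half_pos hε)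
  filter_upwards [hω n] with s hs
  linarith
end
end
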